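/- For every integer d ≥ 4, the cone C_Q(d) over the (d−2)-skeleton of the cube [−1,1]^d is an Almgren minimal set of dimension d−1 in ℝ^d. (Derived in the paper from Theorem 3.5 2° and Example 5.5.) -/

import Mathlib

open Set MeasureTheory Metric NNReal

noncomputable section

/-- A deformation in an open set `U ⊆ ℝ^N`. -/
def IsDeformation {N : ℕ} (U : Set (EuclideanSpace ℝ (Fin N)))
    (φ : ℝ → EuclideanSpace ℝ (Fin N) → EuclideanSpace ℝ (Fin N)) : Prop :=
  (∀ t ∈ Icc (0:ℝ) 1, MapsTo (φ t) (closure U) (closure U)) ∧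
  (∀ x ∈ closure U, φ 0 x = x) ∧
  ContinuousOn (fun p : ℝ × EuclideanSpace ℝ (Fin N) => φ p.1 p.2)
    (Icc (0:ℝ) 1 ×ˢ closure U) ∧
  (∃ K : ℝ≥0, LipschitzOnWith K (φ 1) (closure U)) ∧
  (closure (⋃ t ∈ Icc (0:ℝ) 1,
      ({x ∈ closure U | φ t x ≠ x} ∪ φ t '' {x ∈ closure U | φ t x ≠ x})) ⊆ U ∧
    IsCompact (closure (⋃ t ∈ Icc (0:ℝ) 1,
      ({x ∈ closure U | φ t x ≠ x} ∪ φ t '' {x ∈ closure U | φ t x ≠ x}))))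

/-- `E` is an Almgren minimal set of dimension `d` in the open set `U`. -/
def AlmgrenMinimal {N : ℕ} (d : ℝ) (U E : Set (EuclideanSpace ℝ (Fin N))) : Prop :=
  IsClosed E ∧ E ⊆ closure U ∧
  (∀ (x : EuclideanSpace ℝ (Fin N)) (r : ℝ), closedBall x r ⊆ U →
      μH[d] (E ∩ closedBall x r) < ⊤) ∧
  ∀ φ, IsDeformation U φ →
    μH[d] (E \ (φ 1 '' E)) ≤ μH[d] ((φ 1 '' E) \ E)

/-- Sum of squares of the coordinates with index in `[a, b)`. -/
def sumSq {n : ℕ} (z : EuclideanSpace ℝ (Fin n)) (a b : ℕ) : ℝ :=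
  ∑ i : Fin n, if a ≤ (i : ℕ) ∧ (i : ℕ) < b then z i ^ 2 else 0

end

noncomputable section

/-- The cone over a set `X ⊆ ℝ^d`: all nonnegative multiples of points of `X`. -/
def coneOver {d : ℕ} (X : Set (EuclideanSpace ℝ (Fin d))) : Set (EuclideanSpace ℝ (Fin d)) :=
  {y | ∃ t : ℝ, 0 ≤ t ∧ ∃ x ∈ X, y = t • x}

/-- The (d−2)-skeleton of the cube [−1,1]^d: points of the cube with at least two
coordinates of absolute value 1. -/
def cubeSkeleton (d : ℕ) : Set (EuclideanSpace ℝ (Fin d)) :=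
  {x | (∀ i, |x i| ≤ 1) ∧ ∃ i j : Fin d, i ≠ j ∧ |x i| = 1 ∧ |x j| = 1}

/-- The (d−2)-skeleton of the simplex with vertices `v 0, …, v d`: the union of the convex
hulls of all sets of `d−1` of the vertices. -/
def simplexSkeleton (d : ℕ) (v : Fin (d+1) → EuclideanSpace ℝ (Fin d)) :
    Set (EuclideanSpace ℝ (Fin d)) :=
  ⋃ A ∈ {A : Finset (Fin (d+1)) | A.card = d - 1}, convexHull ℝ (v '' ↑A)

end

section Sweep

open Module MeasureTheory.Measure
open scoped ENNReal RealInnerProductSpace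

lemma LipschitzOnWith.euclideanHausdorffMeasure_image_le {X Y : Type*} [MetricSpace X]
    [MeasurableSpace X] [BorelSpace X] [MetricSpace Y] [MeasurableSpace Y] [BorelSpace Y]
    {K : ℝ≥0} {f : X → Y} {s : Set X} (hf : LipschitzOnWith K f s) (n : ℕ) :
    μHE[n] (f '' s) ≤ K ^ n * μHE[n] s := by
  rw [euclideanHausdorffMeasure_def, euclideanHausdorffMeasure_def, Measure.smul_apply,
    Measure.smul_apply, mul_smul_comm]
  gcongr
  simpa using hf.hausdorffMeasure_image_le (d := (n : ℝ)) (by positivity)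

/-- The set of points that reach `B` when moved along `v` for a time in `[0, h]`. -/
def sweep {V : Type*} [AddCommGroup V] [Module ℝ V] (v : V) (h : ℝ) (B : Set V) : Set V :=
  {x | ∃ s ∈ Icc (0 : ℝ) h, x + s • v ∈ B}

lemma sweep_iUnion {V : Type*} [AddCommGroup V] [Module ℝ V] {ι : Type*} (v : V) (h : ℝ) (B : ι → Set V) :
    sweep v h (⋃ i, B i) = ⋃ i, sweep v h (B i) := by
  ext x
  simp only [sweep, mem_ofPred_eq, mem_iUnion]
  constructor
  · rintro ⟨s, hs, i, hi⟩
    exact ⟨i, s, hs, hi⟩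
  · rintro ⟨i, s, hs, hi⟩
    exact ⟨s, hs, i, hi⟩

variable {V : Type*} [NormedAddCommGroup V] [InnerProductSpace ℝ V] [FiniteDimensional ℝ V]
  [MeasurableSpace V] [BorelSpace V]

lemma volume_sweep_le_of_subset_closedBall {n : ℕ} (hn : finrank ℝ V = n + 1) {v : V}
    (hv : ‖v‖ = 1) {h δ : ℝ} {B : Set V} {c : V}
    (hB : B ⊆ closedBall c δ) :
    volume (sweep v h B) ≤ ENNReal.ofReal (h + 2 * δ) * μHE[n] B := by
  set s : Submodule ℝ V := ℝ ∙ v with hs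
  have hfin : finrank ℝ sᗮ = n := by
    have h1 : finrank ℝ s = 1 := finrank_span_singleton (by
      intro h0; rw [h0, norm_zero] at hv; norm_num at hv)
    have := s.finrank_add_finrank_orthogonal
    omega
  have hmp := s.measurePreserving_measurableEquivProd (0 : V)
  rw [InnerProductSpace.euclideanHausdorffMeasure_eq_volume] at hmp
  let e := LinearIsometryEquiv.toSpanUnitSingleton (𝕜 := ℝ) v hv
  let I : Set s := e '' Icc (⟪v, c⟫ - δ - h) (⟪v, c⟫ + δ)
  let J : Set sᗮ := sᗮ.orthogonalProjectionOnto '' B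
  have hsub : sweep v h B ⊆ s.measurableEquivProd (0 : V) ⁻¹' (I ×ˢ J) := by
    rintro x ⟨t, ht, hx⟩
    simp only [mem_preimage, Submodule.measurableEquivProd_apply, vsub_eq_sub, sub_zero,
      mem_prod]
    have hip : |⟪v, x + t • v⟫ - ⟪v, c⟫| ≤ δ := by
      rw [← inner_sub_right]
      have := hB hx
      rw [mem_closedBall, dist_eq_norm] at this
      calc _ ≤ ‖v‖ * ‖x + t • v - c‖ := abs_real_inner_le_norm _ _
        _ ≤ δ := by rw [hv, one_mul]; exact this
    have hvx : ⟪v, x + t • v⟫ = ⟪v, x⟫ + t := by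
      rw [inner_add_right, inner_smul_right, real_inner_self_eq_norm_sq, hv]; ring
    rw [hvx, abs_le] at hip
    constructor
    · refine ⟨⟪v, x⟫, ⟨by linarith [ht.1, ht.2], by linarith [ht.1, ht.2]⟩, ?_⟩
      apply Subtype.ext
      change _ = s.starProjection x
      rw [show s.starProjection x = ⟪v, x⟫ • v from Submodule.starProjection_unit_singleton ℝ hv x]
      simp [e]
    · refine ⟨x + t • v, hx, ?_⟩
      rw [map_add]
      have : sᗮ.orthogonalProjectionOnto (t • v) = 0 := by
        rw [Submodule.orthogonalProjectionOnto_eq_zero_iff, Submodule.orthogonal_orthogonal]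
        exact s.smul_mem _ (Submodule.mem_span_singleton_self v)
      rw [this, add_zero]
  calc volume (sweep v h B) ≤ volume (s.measurableEquivProd (0 : V) ⁻¹' (I ×ˢ J)) :=
        measure_mono hsub
    _ = volume (I ×ˢ J) := by
        rw [← hmp.map_eq, MeasurableEquiv.map_apply]
    _ = volume I * volume J := by
        rw [Measure.volume_eq_prod, Measure.prod_prod]
    _ ≤ _ := by
        gcongr
        · have : I = e.symm ⁻¹' Icc (⟪v, c⟫ - δ - h) (⟪v, c⟫ + δ) :=
            (e.toEquiv.image_eq_preimage_symm _)
          rw [this, e.symm.measurePreserving.measure_preimage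
            measurableSet_Icc.nullMeasurableSet, Real.volume_Icc]
          apply le_of_eq; congr 1; ring
        · rw [← InnerProductSpace.euclideanHausdorffMeasure_eq_volume, hfin]
          have hL : LipschitzWith 1 (sᗮ.orthogonalProjectionOnto) := by
            refine LipschitzWith.of_dist_le_mul fun x y => ?_
            rw [dist_eq_norm, dist_eq_norm, ← map_sub, NNReal.coe_one, one_mul]
            exact Submodule.norm_orthogonalProjectionOnto_apply_le _ _
          simpa using (hL.lipschitzOnWith (s := B)).euclideanHausdorffMeasure_image_le n

lemma volume_sweep_le {n : ℕ} (hn : finrank ℝ V = n + 1) {v : V}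
    (hv : ‖v‖ = 1) {h : ℝ} (hh : 0 < h) {B : Set V} (hB : MeasurableSet B) :
    volume (sweep v h B) ≤ ENNReal.ofReal h * μHE[n] B := by
  rcases eq_or_ne (μHE[n] B) ∞ with hinf | hfin
  · rw [hinf, ENNReal.mul_top (by simpa using hh)]; exact le_top
  have key : ∀ δ : ℝ, 0 < δ → volume (sweep v h B) ≤ ENNReal.ofReal (h + 2 * δ) * μHE[n] B := by
    intro δ hδ
    let Q : ℕ → Set V := disjointed fun i => closedBall (TopologicalSpace.denseSeq V i) δ
    have hQm : ∀ i, MeasurableSet (Q i) :=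
      MeasurableSet.disjointed fun i => isClosed_closedBall.measurableSet
    have hcov : ⋃ i, Q i = univ := by
      rw [iUnion_disjointed, eq_univ_iff_forall]
      intro x
      obtain ⟨i, hi⟩ := (TopologicalSpace.denseRange_denseSeq V).exists_dist_lt x hδ
      exact mem_iUnion.2 ⟨i, mem_closedBall.2 hi.le⟩
    have hBe : B = ⋃ i, B ∩ Q i := by rw [← inter_iUnion, hcov, inter_univ]
    calc volume (sweep v h B) = volume (⋃ i, sweep v h (B ∩ Q i)) := by
          rw [← sweep_iUnion, ← hBe]
      _ ≤ ∑' i, volume (sweep v h (B ∩ Q i)) := measure_iUnion_le _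
      _ ≤ ∑' i, ENNReal.ofReal (h + 2 * δ) * μHE[n] (B ∩ Q i) := by
          refine ENNReal.tsum_le_tsum fun i => ?_
          exact volume_sweep_le_of_subset_closedBall hn hv
            (inter_subset_right.trans (disjointed_subset _ i))
      _ = ENNReal.ofReal (h + 2 * δ) * μHE[n] B := by
          rw [ENNReal.tsum_mul_left, ← measure_iUnion, ← hBe]
          · intro i j hij
            exact ((disjoint_disjointed _) hij).mono inter_subset_right inter_subset_right
          · exact fun i => hB.inter (hQm i)
  have hlim : Filter.Tendsto (fun δ : ℝ => ENNReal.ofReal (h + 2 * δ) * μHE[n] B)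
      (nhdsWithin 0 (Ioi 0)) (nhds (ENNReal.ofReal h * μHE[n] B)) := by
    refine ENNReal.Tendsto.mul_const ?_ (Or.inr hfin)
    refine (ENNReal.continuous_ofReal.tendsto _).comp ?_
    have : Continuous fun δ : ℝ => h + 2 * δ := by fun_prop
    simpa using (this.tendsto 0).mono_left nhdsWithin_le_nhds
  exact ge_of_tendsto hlim (eventually_mem_nhdsWithin.mono fun δ hδ => key δ hδ)

/-- If secants of `B` make a small angle with the hyperplane orthogonal to `ν`, then sweeping `B`
in a direction of that hyperplane produces a small volume. -/
lemma volume_sweep_le_of_cone {n : ℕ} (hn : finrank ℝ V = n + 1) {v ν : V}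
    (hv : ‖v‖ = 1) (hν : ‖ν‖ = 1) (hvν : ⟪ν, v⟫ = 0) {h ε : ℝ} (hh : 0 < h) (hε : 0 < ε)
    {B : Set V} (hB : MeasurableSet B)
    (hcone : ∀ x ∈ B, ∀ y ∈ B, |⟪ν, x - y⟫| ≤ ε * ‖x - y‖) :
    volume (sweep v h B) ≤ ENNReal.ofReal h * (ENNReal.ofReal (ε * 2 ^ n) * μHE[n] B) := by
  let f : V →ₗ[ℝ] ℝ := (innerSL ℝ ν).toLinearMap
  let T : V →ₗ[ℝ] V := LinearMap.transvection f ((1 / ε - 1) • ν)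
  have hTa : ∀ x, T x = x + (⟪ν, x⟫ * (1 / ε - 1)) • ν := by
    intro x
    simp [T, f, LinearMap.transvection.apply, smul_smul]
  have hdet : T.det = 1 / ε := by
    rw [LinearMap.transvection.det]
    simp [f, hν]
  have hTv : T v = v := by rw [hTa, hvν]; simp
  have hdet0 : T.det ≠ 0 := by rw [hdet]; positivity
  have himg : T '' sweep v h B ⊆ sweep v h (T '' B) := by
    rintro _ ⟨x, ⟨s, hs, hx⟩, rfl⟩
    exact ⟨s, hs, x + s • v, hx, by rw [map_add, map_smul, hTv]⟩
  have hTB : MeasurableSet (T '' B) := by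
    let e := (LinearEquiv.ofIsUnitDet (f := T) (v := Module.finBasis ℝ V)
      (v' := Module.finBasis ℝ V) (by
        rw [LinearMap.det_toMatrix]; exact hdet0.isUnit)).toContinuousLinearEquiv
    have : T '' B = e '' B := rfl
    rw [this]
    exact e.toHomeomorph.toMeasurableEquiv.measurableSet_image.2 hB
  have h1 := volume_sweep_le hn hv hh hTB
  have h2 : volume (T '' sweep v h B) = ENNReal.ofReal (1 / ε) * volume (sweep v h B) := by
    rw [Measure.addHaar_image_linearMap, hdet, abs_of_pos (by positivity)]
  have hlip : LipschitzOnWith 2 T B := by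
    refine LipschitzOnWith.of_dist_le_mul fun x hx y hy => ?_
    rw [dist_eq_norm, dist_eq_norm, ← map_sub, hTa]
    have hc := hcone x hx y hy
    set w := x - y
    have e1 : w + (⟪ν, w⟫ * (1 / ε - 1)) • ν = (w - ⟪ν, w⟫ • ν) + (⟪ν, w⟫ / ε) • ν := by
      rw [mul_sub, sub_smul, mul_one, mul_one_div]; abel
    have e2 : ‖w - ⟪ν, w⟫ • ν‖ ≤ ‖w‖ := by
      have : ‖w - ⟪ν, w⟫ • ν‖ ^ 2 ≤ ‖w‖ ^ 2 := by
        rw [norm_sub_sq_real, inner_smul_right, norm_smul, hν, mul_one, Real.norm_eq_abs,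
          sq_abs, real_inner_comm]
        nlinarith [sq_nonneg ⟪ν, w⟫]
      exact (sq_le_sq₀ (norm_nonneg _) (norm_nonneg _)).1 this
    have e3 : ‖(⟪ν, w⟫ / ε) • ν‖ ≤ ‖w‖ := by
      rw [norm_smul, hν, mul_one, Real.norm_eq_abs, abs_div, abs_of_pos hε, div_le_iff₀ hε]
      linarith
    rw [e1]
    calc _ ≤ _ := norm_add_le _ _
      _ ≤ ‖w‖ + ‖w‖ := add_le_add e2 e3
      _ = _ := by push_cast; ring
  have h3 : μHE[n] (T '' B) ≤ 2 ^ n * μHE[n] B := by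
    simpa using hlip.euclideanHausdorffMeasure_image_le n
  have h4 : ENNReal.ofReal (1 / ε) * volume (sweep v h B)
      ≤ ENNReal.ofReal h * (2 ^ n * μHE[n] B) := by
    rw [← h2]
    exact (measure_mono himg).trans (h1.trans (by gcongr))
  have h5 : volume (sweep v h B)
      = ENNReal.ofReal ε * (ENNReal.ofReal (1 / ε) * volume (sweep v h B)) := by
    rw [← mul_assoc, ← ENNReal.ofReal_mul hε.le, mul_one_div_cancel hε.ne', ENNReal.ofReal_one,
      one_mul]
  rw [h5]
  refine (mul_le_mul_right h4 _).trans (le_of_eq ?_)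
  rw [ENNReal.ofReal_mul hε.le, ENNReal.ofReal_pow zero_le_two, ENNReal.ofReal_ofNat]
  ring

end Sweep

section Jump

open Module MeasureTheory.Measure Filter Topology
open scoped ENNReal RealInnerProductSpace

lemma integrable_of_abs_le_of_eq_zero {V : Type*} [NormedAddCommGroup V]
    [MeasurableSpace V] [BorelSpace V] {μ : Measure V} {f : V → ℝ} {C R : ℝ}
    (hf : AEStronglyMeasurable f μ) (hb : ∀ x, |f x| ≤ C) (h0 : ∀ x, R < ‖x‖ → f x = 0)
    (hfin : μ (closedBall 0 R) ≠ ∞) : Integrable f μ := by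
  have hi : Integrable ((closedBall (0 : V) R).indicator fun _ => C) μ := by
    rw [integrable_indicator_iff isClosed_closedBall.measurableSet]
    exact integrableOn_const hfin
  refine hi.mono' hf (Eventually.of_forall fun x => ?_)
  by_cases hx : x ∈ closedBall (0 : V) R
  · rw [indicator_of_mem hx, Real.norm_eq_abs]; exact hb x
  · rw [indicator_of_notMem hx]
    rw [mem_closedBall_zero_iff, not_le] at hx
    simp [h0 x hx]

lemma measurable_of_label {V ι : Type*} [MeasurableSpace V] [Countable ι] {lab : V → ι}
    (hlm : ∀ k, MeasurableSet (lab ⁻¹' {k})) {G : ι → V → ℝ} (hG : ∀ k, Measurable (G k)) :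
    Measurable fun x => G (lab x) x := by
  intro s hs
  have : (fun x => G (lab x) x) ⁻¹' s = ⋃ k, lab ⁻¹' {k} ∩ G k ⁻¹' s := by
    ext x; simp
  rw [this]
  exact MeasurableSet.iUnion fun k => (hlm k).inter (hG k hs)

variable {V : Type*} [NormedAddCommGroup V] [InnerProductSpace ℝ V] [FiniteDimensional ℝ V]
  [MeasurableSpace V] [BorelSpace V] {ι : Type*} [Finite ι]

lemma lintegral_jump_le {E : Set V} (hE : IsClosed E) {lab : V → ι}
    (hlab : ∀ x y, (∀ s ∈ Icc (0 : ℝ) 1, x + s • (y - x) ∉ E) → lab x = lab y)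
    (hlm : ∀ k, MeasurableSet (lab ⁻¹' {k})) {F : ι → V → ℝ} {θ : V → ℝ} {K : ℝ≥0} {R : ℝ}
    (hF : ∀ k, LipschitzWith K (F k)) (hθ : LipschitzWith K θ)
    (hθR : ∀ x, R < ‖x‖ → θ x = 0)
    (hFθ : ∀ k l x, |F k x - F l x| ≤ θ x) {v : V} (hv : ‖v‖ = 1) {m : Measure V}
    (hm : ∀ B ⊆ E, MeasurableSet B → ∀ h : ℝ, 0 < h →
      volume (sweep v h B) ≤ ENNReal.ofReal h * m B) {h : ℝ} (hh : 0 < h) (hh1 : h ≤ 1) :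
    ∫⁻ x, ENNReal.ofReal |F (lab x) (x + h • v) - F (lab (x + h • v)) (x + h • v)| ≤
      ENNReal.ofReal h *
        ∫⁻ x in E ∩ closedBall 0 (R + 1), ENNReal.ofReal (θ x + K * h) ∂m := by
  have hθ0 : ∀ x, 0 ≤ θ x := fun x => (abs_nonneg _).trans (hFθ (lab x) (lab x) x)
  have hFm : ∀ k, Measurable (F k) := fun k => (hF k).continuous.measurable
  have hadd : Measurable fun x : V => x + h • v := measurable_add_const _
  have hD : Measurable fun x =>
      |F (lab x) (x + h • v) - F (lab (x + h • v)) (x + h • v)| := by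
    have h1 : Measurable fun x => F (lab x) (x + h • v) :=
      measurable_of_label hlm (G := fun k x => F k (x + h • v)) fun k => (hFm k).comp hadd
    have h2 : Measurable fun x => F (lab (x + h • v)) (x + h • v) :=
      (measurable_of_label hlm hFm).comp hadd
    exact (h1.sub h2).norm
  rw [lintegral_eq_lintegral_meas_lt _ (Eventually.of_forall fun x => abs_nonneg _)
    hD.aemeasurable, lintegral_eq_lintegral_meas_lt (f := fun x => θ x + K * h) _
    (Eventually.of_forall fun x => by have := hθ0 x; positivity)
    (hθ.continuous.add continuous_const).measurable.aemeasurable,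
    ← lintegral_const_mul' _ _ ENNReal.ofReal_ne_top]
  refine setLIntegral_mono' measurableSet_Ioi fun t ht => ?_
  have hlt : MeasurableSet {x | t < θ x + K * h} :=
    (isOpen_lt continuous_const (hθ.continuous.add continuous_const)).measurableSet
  have hEB : MeasurableSet (E ∩ closedBall 0 (R + 1)) :=
    (hE.inter isClosed_closedBall).measurableSet
  rw [Measure.restrict_apply hlt]
  refine le_trans (measure_mono ?_) (hm _ (inter_subset_right.trans inter_subset_left)
    (hlt.inter hEB) h hh)
  intro x hx
  have hx : t < |F (lab x) (x + h • v) - F (lab (x + h • v)) (x + h • v)| := hx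
  have ht : 0 < t := ht
  by_cases hxx : lab x = lab (x + h • v)
  · rw [← hxx, sub_self, abs_zero] at hx; linarith
  have hex : ∃ s ∈ Icc (0 : ℝ) 1, x + s • (x + h • v - x) ∈ E := by
    by_contra hcon
    push Not at hcon
    exact hxx (hlab _ _ hcon)
  obtain ⟨s, hs, hsE⟩ := hex
  rw [add_sub_cancel_left, smul_smul] at hsE
  have hdist : dist (x + h • v) (x + (s * h) • v) ≤ h := by
    rw [dist_add_left, dist_eq_norm, ← sub_smul, norm_smul, hv, mul_one, Real.norm_eq_abs,
      abs_of_nonneg (by nlinarith [hs.2])]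
    nlinarith [hs.1]
  have hθp : t < θ (x + h • v) := hx.trans_le (hFθ _ _ _)
  refine ⟨s * h, ⟨by nlinarith [hs.1], by nlinarith [hs.2]⟩, ?_, hsE, ?_⟩
  · have h1 := (hθ.dist_le_mul (x + h • v) (x + (s * h) • v)).trans
      (mul_le_mul_of_nonneg_left hdist K.2)
    rw [Real.dist_eq] at h1
    have h2 := (abs_le.1 h1).2
    change t < θ (x + (s * h) • v) + K * h
    have : (K : ℝ) = (↑K : ℝ) := rfl
    linarith
  · rw [mem_closedBall_zero_iff]
    have h1 : ‖x + h • v‖ ≤ R := by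
      by_contra hcon
      rw [hθR _ (not_le.1 hcon)] at hθp; linarith
    have h2 : ‖x + (s * h) • v‖ ≤ ‖x + h • v‖ + dist (x + h • v) (x + (s * h) • v) := by
      rw [dist_comm, dist_eq_norm]
      calc _ = ‖(x + h • v) + (x + (s * h) • v - (x + h • v))‖ := by congr 1; abel
        _ ≤ _ := norm_add_le _ _
    linarith

/-- A piecewise Lipschitz function, whose pieces may only change across `E`: the integral of its
classical directional derivative is controlled by the size of the jumps. -/
lemma abs_integral_lineDeriv_le {E : Set V} (hE : IsClosed E) {lab : V → ι}
    (hlab : ∀ x y, (∀ s ∈ Icc (0 : ℝ) 1, x + s • (y - x) ∉ E) → lab x = lab y)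
    (hlm : ∀ k, MeasurableSet (lab ⁻¹' {k})) {F : ι → V → ℝ} {θ : V → ℝ} {K : ℝ≥0} {R : ℝ}
    (hF : ∀ k, LipschitzWith K (F k)) (hFR : ∀ k x, R < ‖x‖ → F k x = 0)
    (hθ : LipschitzWith K θ) (hθR : ∀ x, R < ‖x‖ → θ x = 0)
    (hFθ : ∀ k l x, |F k x - F l x| ≤ θ x) {v : V} (hv : ‖v‖ = 1) {m : Measure V}
    (hfin : m (E ∩ closedBall 0 (R + 1)) ≠ ∞)
    (hm : ∀ B ⊆ E, MeasurableSet B → ∀ h : ℝ, 0 < h →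
      volume (sweep v h B) ≤ ENNReal.ofReal h * m B) :
    |∫ x, lineDeriv ℝ (F (lab x)) x v| ≤ ∫ x in E, θ x ∂m := by
  have hFm : ∀ k, Measurable (F k) := fun k => (hF k).continuous.measurable
  have hθ0 : ∀ x, 0 ≤ θ x := fun x => (abs_nonneg _).trans (hFθ (lab x) (lab x) x)
  set M : ℝ := (m (E ∩ closedBall 0 (R + 1))).toReal with hM
  have hEB : MeasurableSet (E ∩ closedBall 0 (R + 1)) :=
    (hE.inter isClosed_closedBall).measurableSet
  have hnorm : ∀ {h : ℝ}, 0 < h → h ≤ 1 → ∀ x : V, R + 1 < ‖x‖ → R < ‖x + h • v‖ := by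
    intro h hh hh1 x hx
    have : ‖x‖ ≤ ‖x + h • v‖ + ‖h • v‖ := by
      calc ‖x‖ = ‖(x + h • v) - h • v‖ := by congr 1; abel
        _ ≤ _ := norm_sub_le _ _
    rw [norm_smul, hv, mul_one, Real.norm_eq_abs, abs_of_pos hh] at this
    linarith
  have hquot : ∀ {h : ℝ}, 0 < h → ∀ k x, |(F k (x + h • v) - F k x) / h| ≤ K := by
    intro h hh k x
    rw [abs_div, abs_of_pos hh, div_le_iff₀ hh]
    have := (hF k).dist_le_mul (x + h • v) x
    rwa [Real.dist_eq, dist_self_add_left, norm_smul, hv, mul_one, Real.norm_eq_abs,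
      abs_of_pos hh] at this
  have hqm : ∀ h : ℝ, Measurable fun x => (F (lab x) (x + h • v) - F (lab x) x) / h := by
    intro h
    refine measurable_of_label hlm (G := fun k x => (F k (x + h • v) - F k x) / h) fun k => ?_
    exact (((hFm k).comp (measurable_add_const _)).sub (hFm k)).div_const _
  have hbdd : ∃ C, ∀ k x, |F k x| ≤ C := by
    have : ∀ k, ∃ C, ∀ x, |F k x| ≤ C := by
      intro k
      obtain ⟨C, hC⟩ := (hF k).continuous.bounded_above_of_compact_support
        (HasCompactSupport.intro (isCompact_closedBall (0 : V) R) fun x hx => hFR k x (by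
          simpa using hx))
      exact ⟨C, fun x => hC x⟩
    choose C hC using this
    obtain ⟨D, hD⟩ := (Set.finite_range C).bddAbove
    exact ⟨D, fun k x => (hC k x).trans (hD ⟨k, rfl⟩)⟩
  obtain ⟨C, hC⟩ := hbdd
  have hvol : ∀ r : ℝ, volume (closedBall (0 : V) r) ≠ ∞ := fun r => measure_closedBall_lt_top.ne
  have hθint : IntegrableOn θ (E ∩ closedBall 0 (R + 1)) m := by
    obtain ⟨D, hD⟩ := hθ.continuous.bounded_above_of_compact_support
        (HasCompactSupport.intro (isCompact_closedBall (0 : V) R) fun x hx => hθR x (by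
          simpa using hx))
    have : IsFiniteMeasure (m.restrict (E ∩ closedBall 0 (R + 1))) :=
      ⟨by rw [Measure.restrict_apply_univ]; exact hfin.lt_top⟩
    exact Integrable.of_bound hθ.continuous.measurable.aestronglyMeasurable D
      (Eventually.of_forall hD)
  have hmain : ∀ h : ℝ, 0 < h → h ≤ 1 →
      |∫ x, (F (lab x) (x + h • v) - F (lab x) x) / h| ≤ (∫ x in E, θ x ∂m) + K * h * M := by
    intro h hh hh1
    have i1 : Integrable (fun x => F (lab x) (x + h • v)) := by
      refine integrable_of_abs_le_of_eq_zero (C := C) (R := R + 1) ?_ (fun x => hC _ _) ?_ (hvol _)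
      · exact (measurable_of_label hlm (G := fun k x => F k (x + h • v)) fun k =>
          (hFm k).comp (measurable_add_const _)).aestronglyMeasurable
      · exact fun x hx => hFR _ _ (hnorm hh hh1 x hx)
    have i2 : Integrable (fun x => F (lab x) x) :=
      integrable_of_abs_le_of_eq_zero (C := C) (R := R)
        (measurable_of_label hlm hFm).aestronglyMeasurable (fun x => hC _ _)
        (fun x hx => hFR _ _ hx) (hvol _)
    have i3 : Integrable (fun x => F (lab (x + h • v)) (x + h • v)) :=
      i2.comp_add_right (h • v)
    have e1 : ∫ x, (F (lab x) (x + h • v) - F (lab x) x) / h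
        = (∫ x, (F (lab x) (x + h • v) - F (lab (x + h • v)) (x + h • v))) / h := by
      rw [integral_div, integral_sub i1 i2, integral_sub i1 i3,
        integral_add_right_eq_self (fun x => F (lab x) x)]
    have e2 : |∫ x, (F (lab x) (x + h • v) - F (lab (x + h • v)) (x + h • v))|
        ≤ (∫⁻ x, ENNReal.ofReal
            |F (lab x) (x + h • v) - F (lab (x + h • v)) (x + h • v)|).toReal := by
      refine (abs_integral_le_integral_abs).trans (le_of_eq ?_)
      exact integral_eq_lintegral_of_nonneg_ae (Eventually.of_forall fun x => abs_nonneg _)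
        (i1.sub i3).abs.aestronglyMeasurable
    have hcont : Integrable (fun _ : V => (K : ℝ) * h) (m.restrict (E ∩ closedBall 0 (R + 1))) :=
      integrableOn_const hfin
    have e3 : ∫⁻ x in E ∩ closedBall 0 (R + 1), ENNReal.ofReal (θ x + K * h) ∂m
        = ENNReal.ofReal ((∫ x in E, θ x ∂m) + K * h * M) := by
      rw [← ofReal_integral_eq_lintegral_ofReal (f := fun x => θ x + K * h) (hθint.add hcont)
        (Eventually.of_forall fun x => by
          have := hθ0 x
          change 0 ≤ θ x + K * h
          positivity)]
      congr 1
      rw [integral_add hθint hcont, setIntegral_const]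
      congr 1
      · rw [setIntegral_eq_of_subset_of_forall_sdiff_eq_zero hE.measurableSet inter_subset_left]
        rintro x ⟨hx, hx2⟩
        refine hθR x ?_
        by_contra hcon
        exact hx2 ⟨hx, by rw [mem_closedBall_zero_iff]; linarith⟩
      · rw [smul_eq_mul, Measure.real, hM]; ring
    have hpos : 0 ≤ (∫ x in E, θ x ∂m) + K * h * M :=
      add_nonneg (integral_nonneg hθ0) (by rw [hM]; positivity)
    have e4 := lintegral_jump_le hE hlab hlm hF hθ hθR hFθ hv hm hh hh1
    rw [e3, ← ENNReal.ofReal_mul hh.le] at e4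
    have e5 := ENNReal.toReal_mono ENNReal.ofReal_ne_top e4
    rw [ENNReal.toReal_ofReal (by positivity)] at e5
    rw [e1, abs_div, abs_of_pos hh, div_le_iff₀ hh]
    linarith [e2.trans e5]
  have hseq : Tendsto (fun j : ℕ => 1 / ((j : ℝ) + 1)) atTop (𝓝 0) :=
    tendsto_one_div_add_atTop_nhds_zero_nat
  have hlim : Tendsto (fun j : ℕ => ∫ x, (F (lab x) (x + (1 / ((j : ℝ) + 1)) • v)
      - F (lab x) x) / (1 / ((j : ℝ) + 1))) atTop (𝓝 (∫ x, lineDeriv ℝ (F (lab x)) x v)) := by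
    have hj0 : ∀ j : ℕ, 0 < 1 / ((j : ℝ) + 1) := fun j => by positivity
    have hj1 : ∀ j : ℕ, 1 / ((j : ℝ) + 1) ≤ 1 := fun j => by
      rw [div_le_one (by positivity)]; linarith [(Nat.cast_nonneg j : (0 : ℝ) ≤ j)]
    refine tendsto_integral_of_dominated_convergence
      ((closedBall (0 : V) (R + 1)).indicator fun _ => (K : ℝ)) ?_ ?_ ?_ ?_
    · exact fun j => (hqm _).aestronglyMeasurable
    · rw [integrable_indicator_iff isClosed_closedBall.measurableSet]
      exact integrableOn_const (hvol _)
    · refine fun j => Eventually.of_forall fun x => ?_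
      by_cases hx : x ∈ closedBall (0 : V) (R + 1)
      · rw [indicator_of_mem hx]; exact hquot (hj0 j) _ _
      · rw [mem_closedBall_zero_iff, not_le] at hx
        rw [hFR _ _ (hnorm (hj0 j) (hj1 j) x hx), hFR _ x (by linarith)]
        simp only [sub_self, zero_div, norm_zero]
        exact indicator_nonneg (fun _ _ => K.2) _
    · have hae : ∀ᵐ x : V, ∀ k, LineDifferentiableAt ℝ (F k) x v := by
        rw [ae_all_iff]
        exact fun k => (hF k).ae_lineDifferentiableAt v
      filter_upwards [hae] with x hx
      have h1 := (hx (lab x)).hasLineDerivAt.tendsto_slope_zero_right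
      refine (h1.comp (tendsto_nhdsWithin_iff.2
        ⟨hseq, Eventually.of_forall fun j => hj0 j⟩)).congr fun j => ?_
      simp only [Function.comp_apply, smul_eq_mul]
      rw [inv_mul_eq_div]
  have hlim2 : Tendsto (fun j : ℕ => (∫ x in E, θ x ∂m) + K * (1 / ((j : ℝ) + 1)) * M) atTop
      (𝓝 ((∫ x in E, θ x ∂m) + K * 0 * M)) :=
    ((hseq.const_mul _).mul_const _).const_add _
  rw [mul_zero, zero_mul, add_zero] at hlim2
  refine le_of_tendsto_of_tendsto' hlim.abs hlim2 fun j => hmain _ (by positivity) ?_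
  rw [div_le_one (by positivity)]; linarith [(Nat.cast_nonneg j : (0 : ℝ) ≤ j)]

end Jump

section Rectifiable

open Module MeasureTheory.Measure Filter Topology
open scoped ENNReal RealInnerProductSpace

variable {V : Type*} [NormedAddCommGroup V] [InnerProductSpace ℝ V]

/-- Secants of `B` make a small angle with the hyperplane orthogonal to `ν`. -/
def ConeCondition (ε : ℝ) (ν : V) (B : Set V) : Prop :=
  ∀ x ∈ B, ∀ y ∈ B, |⟪ν, x - y⟫| ≤ ε * ‖x - y‖

lemma ConeCondition.mono {ε : ℝ} {ν : V} {A B : Set V} (h : ConeCondition ε ν B) (hAB : A ⊆ B) :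
    ConeCondition ε ν A := fun x hx y hy => h x (hAB hx) y (hAB hy)

lemma ConeCondition.closure {ε : ℝ} {ν : V} {B : Set V} (h : ConeCondition ε ν B) :
    ConeCondition ε ν (closure B) := by
  have hcl : IsClosed {p : V × V | |⟪ν, p.1 - p.2⟫| ≤ ε * ‖p.1 - p.2‖} :=
    isClosed_le (by fun_prop) (by fun_prop)
  have hsub : B ×ˢ B ⊆ {p : V × V | |⟪ν, p.1 - p.2⟫| ≤ ε * ‖p.1 - p.2‖} :=
    fun p hp => h _ hp.1 _ hp.2
  have := closure_minimal hsub hcl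
  rw [closure_prod_eq] at this
  exact fun x hx y hy => this (mk_mem_prod hx hy)

/-- `E` is covered, up to a null set, by countably many closed sets which are nearly flat. -/
def NearlyFlatCover [MeasurableSpace V] [BorelSpace V] (n : ℕ) (E : Set V) : Prop :=
  ∀ ε : ℝ, 0 < ε → ∃ B : ℕ → Set V,
    (∀ i, IsClosed (B i) ∧ ∃ ν : V, ‖ν‖ = 1 ∧ ConeCondition ε ν (B i)) ∧
      μHE[n] (E \ ⋃ i, B i) = 0

lemma nearlyFlatCover_iUnion [MeasurableSpace V] [BorelSpace V] {n : ℕ} {ι : Type*}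
    [Countable ι] [Nonempty ι] {E : ι → Set V} (h : ∀ i, NearlyFlatCover n (E i)) :
    NearlyFlatCover n (⋃ i, E i) := by
  intro ε hε
  choose B hB hB0 using fun i => h i ε hε
  obtain ⟨g, hg⟩ := exists_surjective_nat (ι × ℕ)
  refine ⟨fun k => B (g k).1 (g k).2, fun k => hB _ _, ?_⟩
  refine measure_mono_null (t := ⋃ i, (E i \ ⋃ j, B i j)) ?_ (measure_iUnion_null hB0)
  rintro x ⟨hx, hx2⟩
  obtain ⟨i, hi⟩ := mem_iUnion.1 hx
  refine mem_iUnion.2 ⟨i, hi, fun hj => hx2 ?_⟩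
  obtain ⟨j, hj⟩ := mem_iUnion.1 hj
  obtain ⟨k, hk⟩ := hg (i, j)
  exact mem_iUnion.2 ⟨k, by rw [hk]; exact hj⟩

lemma NearlyFlatCover.mono [MeasurableSpace V] [BorelSpace V] {n : ℕ} {A E : Set V}
    (h : NearlyFlatCover n E) (hA : A ⊆ E) : NearlyFlatCover n A := by
  intro ε hε
  obtain ⟨B, hB, h0⟩ := h ε hε
  exact ⟨B, hB, measure_mono_null (sdiff_subset_sdiff_left hA) h0⟩

lemma exists_unit_normal [FiniteDimensional ℝ V] {W : Type*} [AddCommGroup W] [Module ℝ W]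
    [FiniteDimensional ℝ W]
    (hWV : finrank ℝ W < finrank ℝ V) (L : W →ₗ[ℝ] V) :
    ∃ ν : V, ‖ν‖ = 1 ∧ ∀ w, ⟪ν, L w⟫ = 0 := by
  have hne : (LinearMap.range L)ᗮ ≠ ⊥ := by
    intro hbot
    rw [Submodule.orthogonal_eq_bot_iff] at hbot
    have h1 := LinearMap.finrank_range_le L
    rw [hbot, finrank_top] at h1
    omega
  obtain ⟨z, hz, hz0⟩ := Submodule.exists_mem_ne_zero_of_ne_bot hne
  have hzn : ‖z‖ ≠ 0 := norm_ne_zero_iff.2 hz0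
  refine ⟨‖z‖⁻¹ • z, by rw [norm_smul, norm_inv, norm_norm, inv_mul_cancel₀ hzn], fun w => ?_⟩
  rw [inner_smul_left, real_inner_comm, hz _ (LinearMap.mem_range_self L w), mul_zero]

variable {W : Type*} [NormedAddCommGroup W] [InnerProductSpace ℝ W] [FiniteDimensional ℝ W]

lemma exists_radius_coneCondition [FiniteDimensional ℝ V] (hWV : finrank ℝ W < finrank ℝ V)
    {ε : ℝ} (hε : 0 < ε) (L : W →L[ℝ] V) :
    ∃ r : ℝ≥0, r ≠ 0 ∧ (Function.Injective L → ∀ (f : W → V) (s : Set W),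
      ApproximatesLinearOn f L s r → ∃ ν : V, ‖ν‖ = 1 ∧ ConeCondition ε ν (f '' s)) := by
  by_cases hL : Function.Injective L
  swap
  · exact ⟨1, one_ne_zero, fun h => absurd h hL⟩
  obtain ⟨K, hK, hKL⟩ := L.toLinearMap.exists_antilipschitzWith (LinearMap.ker_eq_bot.2 hL)
  have hK' : (0 : ℝ) < K := hK
  obtain ⟨ν, hν, hνL⟩ := exists_unit_normal hWV L.toLinearMap
  refine ⟨⟨ε / (K * (1 + ε)), by positivity⟩, ?_, fun _ f s hf => ⟨ν, hν, ?_⟩⟩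
  · intro h
    have : ε / (K * (1 + ε)) = 0 := congrArg NNReal.toReal h
    have h2 : 0 < ε / (K * (1 + ε)) := by positivity
    linarith
  set r : ℝ := ε / (K * (1 + ε)) with hr
  have hr1 : r = ε * (1 / K - r) := by
    rw [hr]; field_simp; ring
  rintro _ ⟨x, hx, rfl⟩ _ ⟨y, hy, rfl⟩
  have h1 : ‖f x - f y - L (x - y)‖ ≤ r * ‖x - y‖ := hf x hx y hy
  have h2 : ‖x - y‖ ≤ K * ‖L (x - y)‖ := by
    have := hKL.le_mul_dist x y
    rw [dist_eq_norm, dist_eq_norm] at this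
    rw [map_sub]; exact this
  have h3 : 1 / K * ‖x - y‖ ≤ ‖L (x - y)‖ := by
    rw [div_mul_eq_mul_div, one_mul, div_le_iff₀ hK']; linarith
  have h4 : ‖L (x - y)‖ ≤ ‖f x - f y‖ + ‖f x - f y - L (x - y)‖ := by
    calc ‖L (x - y)‖ = ‖(f x - f y) - (f x - f y - L (x - y))‖ := by congr 1; abel
      _ ≤ _ := norm_sub_le _ _
  have h5 : ⟪ν, f x - f y⟫ = ⟪ν, f x - f y - L (x - y)⟫ := by
    rw [inner_sub_right _ _ (L (x - y))]
    rw [show ⟪ν, L (x - y)⟫ = 0 from hνL _, sub_zero]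
  calc |⟪ν, f x - f y⟫| ≤ ‖ν‖ * ‖f x - f y - L (x - y)‖ := by
        rw [h5]; exact abs_real_inner_le_norm _ _
    _ ≤ r * ‖x - y‖ := by rw [hν, one_mul]; exact h1
    _ = ε * (1 / K * ‖x - y‖ - r * ‖x - y‖) := by
      conv_lhs => rw [hr1]
      ring
    _ ≤ ε * ‖f x - f y‖ := by gcongr; linarith

variable [MeasurableSpace V] [BorelSpace V] [MeasurableSpace W] [BorelSpace W]

lemma euclideanHausdorffMeasure_image_le_of_dist_le {X Y Z : Type*} [MetricSpace X]
    [MeasurableSpace X] [BorelSpace X] [MetricSpace Y] [MeasurableSpace Y] [BorelSpace Y]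
    {C : ℝ≥0} {f : Z → X} {g : Z → Y} {s : Set Z}
    (h : ∀ x ∈ s, ∀ y ∈ s, dist (f x) (f y) ≤ C * dist (g x) (g y)) (n : ℕ) :
    μHE[n] (f '' s) ≤ C ^ n * μHE[n] (g '' s) := by
  rcases isEmpty_or_nonempty Z with hZ | hZ
  · simp [eq_empty_of_isEmpty s]
  have hinv : ∀ x ∈ s, Function.invFunOn g s (g x) ∈ s ∧ g (Function.invFunOn g s (g x)) = g x :=
    fun x hx => Function.invFunOn_pos ⟨x, hx, rfl⟩
  have hlip : LipschitzOnWith C (f ∘ Function.invFunOn g s) (g '' s) := by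
    refine LipschitzOnWith.of_dist_le_mul ?_
    rintro _ ⟨x, hx, rfl⟩ _ ⟨y, hy, rfl⟩
    have := h _ (hinv x hx).1 _ (hinv y hy).1
    rwa [(hinv x hx).2, (hinv y hy).2] at this
  have himg : f '' s ⊆ (f ∘ Function.invFunOn g s) '' (g '' s) := by
    rintro _ ⟨x, hx, rfl⟩
    refine ⟨g x, ⟨x, hx, rfl⟩, ?_⟩
    have := h _ (hinv x hx).1 _ hx
    rw [(hinv x hx).2, dist_self, mul_zero] at this
    exact dist_le_zero.1 this
  exact (measure_mono himg).trans (hlip.euclideanHausdorffMeasure_image_le n)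

lemma euclideanHausdorffMeasure_image_le_of_degenerate {f : W → V} {L : W →L[ℝ] V} {z : W}
    (hz : ‖z‖ = 1) (hLz : L z = 0) {δ : ℝ≥0} (hδ : δ ≠ 0) (hδ1 : δ ≤ 1) {s : Set W}
    (hf : ApproximatesLinearOn f L s δ) :
    μHE[finrank ℝ W] (f '' s) ≤ (‖L‖₊ + 2) ^ finrank ℝ W * (δ * volume s) := by
  let φ : W →ₗ[ℝ] ℝ := (innerSL ℝ z).toLinearMap
  let T : W →ₗ[ℝ] W := LinearMap.transvection φ (((δ : ℝ) - 1) • z)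
  have hTa : ∀ x, T x = x + (⟪z, x⟫ * ((δ : ℝ) - 1)) • z := by
    intro x
    simp [T, φ, LinearMap.transvection.apply, smul_smul]
  have hdet : T.det = δ := by
    rw [LinearMap.transvection.det]
    simp [φ, hz]
  have hδ' : (δ : ℝ) ≤ 1 := hδ1
  have hδ0 : (0 : ℝ) ≤ δ := δ.2
  have hT : volume (T '' s) = δ * volume s := by
    rw [Measure.addHaar_image_linearMap, hdet, abs_of_nonneg hδ0, ENNReal.ofReal_coe_nnreal]
  rw [← hT, ← InnerProductSpace.euclideanHausdorffMeasure_eq_volume]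
  refine (euclideanHausdorffMeasure_image_le_of_dist_le (C := ‖L‖₊ + 2) (fun x hx y hy => ?_)
    (finrank ℝ W)).trans (le_of_eq (by push_cast; rfl))
  rw [dist_eq_norm, dist_eq_norm, ← map_sub, hTa]
  set w := x - y with hw
  set a := ⟪z, w⟫
  set w' := w - a • z with hw'
  have horth : ⟪w', z⟫ = 0 := by
    rw [hw', inner_sub_left, inner_smul_left, real_inner_self_eq_norm_sq, hz, real_inner_comm]
    simp [a]
  have e1 : w + (a * (δ - 1)) • z = w' + (a * δ) • z := by
    rw [hw', mul_sub, sub_smul, mul_one]; abel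
  have e2 : ‖w' + (a * δ) • z‖ ^ 2 = ‖w'‖ ^ 2 + (a * δ) ^ 2 := by
    rw [norm_add_sq_real, inner_smul_right, horth, norm_smul, hz, mul_one, Real.norm_eq_abs,
      sq_abs]; ring
  have e3 : ‖w'‖ ≤ ‖w' + (a * δ) • z‖ :=
    (sq_le_sq₀ (norm_nonneg _) (norm_nonneg _)).1 (by rw [e2]; nlinarith [sq_nonneg (a * δ)])
  have e4 : |a| * δ ≤ ‖w' + (a * δ) • z‖ := by
    refine (sq_le_sq₀ (by positivity) (norm_nonneg _)).1 ?_
    rw [e2, mul_pow, sq_abs, ← mul_pow]; nlinarith [sq_nonneg ‖w'‖]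
  have e5 : ‖f x - f y - L w‖ ≤ δ * ‖w‖ := hf x hx y hy
  have e6 : L w' = L w := by rw [hw', map_sub L, map_smul, hLz, smul_zero, sub_zero]
  have e7 : ‖w‖ ≤ ‖w'‖ + |a| := by
    calc ‖w‖ = ‖w' + a • z‖ := by rw [hw', sub_add_cancel]
      _ ≤ ‖w'‖ + ‖a • z‖ := norm_add_le _ _
      _ = _ := by rw [norm_smul, hz, mul_one, Real.norm_eq_abs]
  rw [e1]
  calc ‖f x - f y‖ = ‖(f x - f y - L w) + L w‖ := by rw [sub_add_cancel]
    _ ≤ ‖f x - f y - L w‖ + ‖L w‖ := norm_add_le _ _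
    _ ≤ δ * ‖w‖ + ‖L‖ * ‖w'‖ := by
        gcongr
        rw [← e6]; exact L.le_opNorm _
    _ ≤ δ * (‖w'‖ + |a|) + ‖L‖ * ‖w'‖ := by gcongr
    _ ≤ (‖L‖ + 1) * ‖w'‖ + |a| * δ := by nlinarith [norm_nonneg w']
    _ ≤ (‖L‖ + 1) * ‖w' + (a * δ) • z‖ + ‖w' + (a * δ) • z‖ := by gcongr
    _ = _ := by push_cast; ring

lemma euclideanHausdorffMeasure_image_eq_zero_of_degenerate [FiniteDimensional ℝ V]
    {f : W → V} {f' : W → W →L[ℝ] V} {s : Set W} (hs : volume s ≠ ∞) (hsm : MeasurableSet s)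
    (hf : ∀ x ∈ s, HasFDerivWithinAt f (f' x) s x)
    (hinj : ∀ x ∈ s, ¬ Function.Injective (f' x)) :
    μHE[finrank ℝ W] (f '' s) = 0 := by
  rcases s.eq_empty_or_nonempty with rfl | hne
  · simp
  have key : ∀ η : ℝ≥0, 0 < η → η ≤ 1 → μHE[finrank ℝ W] (f '' s) ≤ η * volume s := by
    intro η hη hη1
    obtain ⟨t, A, hdisj, htm, hst, happ, hA⟩ :=
      exists_partition_approximatesLinearOn_of_hasFDerivWithinAt f s f' hf
        (fun A => η / (‖A‖₊ + 2) ^ finrank ℝ W) (fun A => by positivity)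
    have hpiece : ∀ i, μHE[finrank ℝ W] (f '' (s ∩ t i)) ≤ η * volume (s ∩ t i) := by
      intro i
      obtain ⟨y, hy, hAy⟩ := hA hne i
      have hni := hinj y hy
      rw [← hAy] at hni
      obtain ⟨z, hz, hz0⟩ : ∃ z, A i z = 0 ∧ z ≠ 0 := by
        by_contra hcon
        push Not at hcon
        exact hni ((injective_iff_map_eq_zero (A i)).2 hcon)
      have hzn : ‖z‖ ≠ 0 := norm_ne_zero_iff.2 hz0
      have h1 : (1 : ℝ≥0) ≤ (‖A i‖₊ + 2) ^ finrank ℝ W :=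
        one_le_pow₀ (le_add_left one_le_two)
      refine (euclideanHausdorffMeasure_image_le_of_degenerate (z := ‖z‖⁻¹ • z) (L := A i)
        (by rw [norm_smul, norm_inv, norm_norm, inv_mul_cancel₀ hzn])
        (by rw [map_smul, hz, smul_zero]) (by positivity) ?_ (happ i)).trans (le_of_eq ?_)
      · exact (div_le_self (zero_le) h1).trans hη1
      · rw [← mul_assoc]
        congr 1
        norm_cast
        rw [mul_div_cancel₀]
        positivity
    calc μHE[finrank ℝ W] (f '' s) ≤ μHE[finrank ℝ W] (⋃ i, f '' (s ∩ t i)) := by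
          refine measure_mono ?_
          rw [← image_iUnion, ← inter_iUnion, inter_eq_left.2 hst]
      _ ≤ ∑' i, μHE[finrank ℝ W] (f '' (s ∩ t i)) := measure_iUnion_le _
      _ ≤ ∑' i, η * volume (s ∩ t i) := ENNReal.tsum_le_tsum hpiece
      _ = η * volume s := by
          rw [ENNReal.tsum_mul_left, ← measure_iUnion, ← inter_iUnion, inter_eq_left.2 hst]
          · exact fun i j hij => (hdisj hij).mono inter_subset_right inter_subset_right
          · exact fun i => hsm.inter (htm i)
  have hlim : Tendsto (fun η : ℝ≥0 => (η : ℝ≥0∞) * volume s) (𝓝[>] 0) (𝓝 0) := by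
    have : Tendsto (fun η : ℝ≥0 => (η : ℝ≥0∞) * volume s) (𝓝 0) (𝓝 ((0 : ℝ≥0) * volume s)) :=
      ENNReal.Tendsto.mul_const (ENNReal.continuous_coe.tendsto 0) (Or.inr hs)
    simpa using this.mono_left nhdsWithin_le_nhds
  refine le_antisymm (ge_of_tendsto hlim ?_) (zero_le)
  filter_upwards [Ioc_mem_nhdsGT (zero_lt_one' ℝ≥0)] with η hη
  exact key η hη.1 hη.2

/-- The image of a Lipschitz map is rectifiable. -/
lemma LipschitzWith.nearlyFlatCover_range [FiniteDimensional ℝ V]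
    (hWV : finrank ℝ W < finrank ℝ V) {K : ℝ≥0} {f : W → V} (hf : LipschitzWith K f) :
    NearlyFlatCover (finrank ℝ W) (range f) := by
  intro ε hε
  have hdm : MeasurableSet {x | DifferentiableAt ℝ f x} := measurableSet_of_differentiableAt ℝ f
  let S : Set W := {x | DifferentiableAt ℝ f x ∧ Function.Injective (fderiv ℝ f x)}
  have hinjm : MeasurableSet {x | Function.Injective (fderiv ℝ f x)} :=
    measurable_fderiv ℝ f ContinuousLinearMap.isOpen_injective.measurableSet
  choose r hr0 hr using exists_radius_coneCondition (W := W) (V := V) hWV hε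
  obtain ⟨t, A, -, -, hst, happ, hA⟩ :=
      exists_partition_approximatesLinearOn_of_hasFDerivWithinAt f S (fderiv ℝ f)
        (fun x hx => hx.1.hasFDerivAt.hasFDerivWithinAt) r hr0
  have hν0 : ∃ ν : V, ‖ν‖ = 1 := by
    obtain ⟨ν, hν, -⟩ := exists_unit_normal hWV (0 : W →ₗ[ℝ] V)
    exact ⟨ν, hν⟩
  refine ⟨fun i => closure (f '' (S ∩ t i)), fun i => ⟨isClosed_closure, ?_⟩, ?_⟩
  · rcases S.eq_empty_or_nonempty with hS | hS
    · obtain ⟨ν, hν⟩ := hν0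
      refine ⟨ν, hν, ?_⟩
      simp only [hS, empty_inter, image_empty, closure_empty]
      exact fun x hx => absurd hx (notMem_empty x)
    · obtain ⟨y, hy, hAy⟩ := hA hS i
      obtain ⟨ν, hν, hc⟩ := hr (A i) (by rw [hAy]; exact hy.2) f _ (happ i)
      exact ⟨ν, hν, hc.closure⟩
  · let D : ℕ → Set W := fun k =>
      ({x | DifferentiableAt ℝ f x} ∩ {x | Function.Injective (fderiv ℝ f x)}ᶜ) ∩ closedBall 0 k
    have hsub : range f \ ⋃ i, closure (f '' (S ∩ t i)) ⊆
        f '' {x | DifferentiableAt ℝ f x}ᶜ ∪ ⋃ k, f '' D k := by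
      rintro _ ⟨⟨x, rfl⟩, hx⟩
      by_cases hd : DifferentiableAt ℝ f x
      · by_cases hi : Function.Injective (fderiv ℝ f x)
        · exfalso
          obtain ⟨i, hi'⟩ := mem_iUnion.1 (hst (⟨hd, hi⟩ : x ∈ S))
          exact hx (mem_iUnion.2 ⟨i, subset_closure ⟨x, ⟨⟨hd, hi⟩, hi'⟩, rfl⟩⟩)
        · right
          obtain ⟨k, hk⟩ := exists_nat_ge ‖x‖
          exact mem_iUnion.2 ⟨k, x, ⟨⟨hd, hi⟩, mem_closedBall_zero_iff.2 hk⟩, rfl⟩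
      · exact Or.inl ⟨x, hd, rfl⟩
    refine measure_mono_null hsub (measure_union_null ?_ (measure_iUnion_null fun k => ?_))
    · refine le_antisymm ?_ (zero_le)
      refine (hf.lipschitzOnWith.euclideanHausdorffMeasure_image_le _).trans (le_of_eq ?_)
      rw [InnerProductSpace.euclideanHausdorffMeasure_eq_volume,
        show volume {x | DifferentiableAt ℝ f x}ᶜ = 0 from hf.ae_differentiableAt, mul_zero]
    · refine euclideanHausdorffMeasure_image_eq_zero_of_degenerate (f' := fderiv ℝ f) ?_ ?_ ?_ ?_
      · exact (measure_mono inter_subset_right |>.trans_lt measure_closedBall_lt_top).ne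
      · exact (hdm.inter hinjm.compl).inter isClosed_closedBall.measurableSet
      · exact fun x hx => hx.1.1.hasFDerivAt.hasFDerivWithinAt
      · exact fun x hx => hx.1.2

end Rectifiable

section Divergence

open Module MeasureTheory.Measure Filter Topology
open scoped ENNReal RealInnerProductSpace

variable {V : Type*} [NormedAddCommGroup V] [InnerProductSpace ℝ V] [FiniteDimensional ℝ V]
  [MeasurableSpace V] [BorelSpace V]

lemma NearlyFlatCover.exists_compact_family {n : ℕ} {G : Set V} (hG : MeasurableSet G)
    (hfin : μHE[n] G ≠ ∞) (h : NearlyFlatCover n G) {ε : ℝ} (hε : 0 < ε) :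
    ∃ (N : ℕ) (A : Fin N → Set V), (∀ i, IsCompact (A i) ∧ A i ⊆ G ∧
      ∃ ν : V, ‖ν‖ = 1 ∧ ConeCondition ε ν (A i)) ∧ Pairwise (Function.onFun Disjoint A) ∧
      μHE[n] (G \ ⋃ i, A i) ≤ ENNReal.ofReal ε := by
  obtain ⟨B, hB, hB0⟩ := h ε hε
  have hε' : ENNReal.ofReal ε ≠ 0 := by simpa using hε
  obtain ⟨e, he0, hesum⟩ := ENNReal.exists_pos_sum_of_countable' hε' ℕ
  set μ := (μHE[n] : Measure V).restrict G with hμ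
  have hfμ : IsFiniteMeasure μ := ⟨by rw [hμ, Measure.restrict_apply_univ]; exact hfin.lt_top⟩
  have hDm : ∀ i, MeasurableSet (disjointed B i ∩ G) := fun i =>
    (MeasurableSet.disjointed (fun i => (hB i).1.measurableSet) i).inter hG
  choose C hCD hC hCe using fun i =>
    (hDm i).exists_isCompact_sdiff_lt (μ := μ) (measure_ne_top _ _) (he0 i).ne'
  have hsub : G \ ⋃ i, C i ⊆ (G \ ⋃ i, B i) ∪ ⋃ i, ((disjointed B i ∩ G) \ C i) := by
    rintro x ⟨hx, hx2⟩
    by_cases hxB : x ∈ ⋃ i, B i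
    · right
      rw [← iUnion_disjointed] at hxB
      obtain ⟨i, hi⟩ := mem_iUnion.1 hxB
      exact mem_iUnion.2 ⟨i, ⟨hi, hx⟩, fun hc => hx2 (mem_iUnion.2 ⟨i, hc⟩)⟩
    · exact Or.inl ⟨hx, hxB⟩
  have hlt : μ (G \ ⋃ i, C i) < ENNReal.ofReal ε := by
    refine (measure_mono hsub).trans_lt ((measure_union_le _ _).trans_lt ?_)
    have h0 : μ (G \ ⋃ i, B i) = 0 :=
      le_antisymm ((Measure.restrict_apply_le _ _).trans hB0.le) zero_le
    rw [h0, zero_add]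
    exact (measure_iUnion_le _).trans_lt
      ((ENNReal.tsum_le_tsum fun i => (hCe i).le).trans_lt hesum)
  have hCm : ∀ i, MeasurableSet (C i) := fun i => (hC i).isClosed.measurableSet
  have htend : Tendsto (fun N : ℕ => μ (G \ ⋃ i : Fin N, C i)) atTop
      (𝓝 (μ (⋂ N : ℕ, G \ ⋃ i : Fin N, C i))) := by
    refine tendsto_measure_iInter_atTop
      (fun N => (hG.diff (MeasurableSet.iUnion fun i => hCm _)).nullMeasurableSet) ?_
      ⟨0, measure_ne_top _ _⟩
    intro N M hNM x hx
    refine ⟨hx.1, fun hc => hx.2 ?_⟩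
    obtain ⟨i, hi⟩ := mem_iUnion.1 hc
    exact mem_iUnion.2 ⟨⟨i, i.2.trans_le hNM⟩, hi⟩
  have hInt : ⋂ N : ℕ, G \ ⋃ i : Fin N, C i ⊆ G \ ⋃ i, C i := by
    intro x hx
    refine ⟨(mem_iInter.1 hx 0).1, fun hc => ?_⟩
    obtain ⟨i, hi⟩ := mem_iUnion.1 hc
    exact (mem_iInter.1 hx (i + 1)).2 (mem_iUnion.2 ⟨⟨i, i.lt_succ_self⟩, hi⟩)
  obtain ⟨N, hN⟩ := (htend.eventually_lt_const ((measure_mono hInt).trans_lt hlt)).exists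
  refine ⟨N, fun i => C i, fun i => ⟨hC i, (hCD i).trans inter_subset_right, ?_⟩, ?_, ?_⟩
  · obtain ⟨ν, hν, hc⟩ := (hB i).2
    exact ⟨ν, hν, hc.mono ((hCD i).trans (inter_subset_left.trans (disjointed_subset _ _)))⟩
  · intro i j hij
    exact ((disjoint_disjointed B) (fun h => hij (Fin.ext h))).mono
      ((hCD i).trans inter_subset_left) ((hCD j).trans inter_subset_left)
  · have : μ (G \ ⋃ i : Fin N, C i) = μHE[n] (G \ ⋃ i : Fin N, C i) := by
      rw [hμ, Measure.restrict_apply (hG.diff (MeasurableSet.iUnion fun i => hCm _)),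
        inter_eq_left.2 sdiff_subset]
    rw [← this]; exact hN.le

lemma exists_lipschitzWith_smul {ι W : Type*} [NormedAddCommGroup W] [NormedSpace ℝ W]
    {θ : V → ℝ} {X : ι → V → W} {K L : ℝ≥0} {R M : ℝ}
    (hθ : LipschitzWith K θ) (hθR : ∀ x, R < ‖x‖ → θ x = 0) (hX : ∀ k, LipschitzWith L (X k))
    (hXM : ∀ k x, ‖X k x‖ ≤ M) : ∃ C : ℝ≥0, ∀ k, LipschitzWith C fun x => θ x • X k x := by
  obtain ⟨D, hD⟩ := hθ.continuous.bounded_above_of_compact_support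
    (HasCompactSupport.intro (isCompact_closedBall (0 : V) R) fun x hx => hθR x (by
      simpa using hx))
  refine ⟨K * M.toNNReal + D.toNNReal * L, fun k => LipschitzWith.of_dist_le_mul fun x y => ?_⟩
  have h1 := hθ.dist_le_mul x y
  have h2 := (hX k).dist_le_mul x y
  rw [dist_eq_norm] at h1 h2 ⊢
  have e : θ x • X k x - θ y • X k y = (θ x - θ y) • X k x + θ y • (X k x - X k y) := by
    rw [sub_smul, smul_sub]; abel
  have hM := (hXM k x).trans (Real.le_coe_toNNReal M)
  have hD' := (hD y).trans (Real.le_coe_toNNReal D)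
  calc _ ≤ ‖(θ x - θ y) • X k x‖ + ‖θ y • (X k x - X k y)‖ := by rw [e]; exact norm_add_le _ _
    _ = ‖θ x - θ y‖ * ‖X k x‖ + ‖θ y‖ * ‖X k x - X k y‖ := by rw [norm_smul, norm_smul]
    _ ≤ (K * dist x y) * M.toNNReal + D.toNNReal * (L * dist x y) := by gcongr
    _ = _ := by push_cast; ring

/-- The classical divergence of a vector field. -/
noncomputable def divergence (Y : V → V) (x : V) : ℝ := LinearMap.trace ℝ V (fderiv ℝ Y x)

variable {ι : Type*} [Finite ι]

lemma divergence_eq_sum_lineDeriv {κ : Type*} [Fintype κ] (b : OrthonormalBasis κ ℝ V)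
    {Y : V → V} {x : V} (hY : DifferentiableAt ℝ Y x) :
    divergence Y x = ∑ i, lineDeriv ℝ (fun y => ⟪b i, Y y⟫) x (b i) := by
  rw [divergence, LinearMap.trace_eq_sum_inner _ b]
  refine Finset.sum_congr rfl fun i _ => ?_
  have h : HasFDerivAt (fun y => ⟪b i, Y y⟫) ((innerSL ℝ (b i)).comp (fderiv ℝ Y x)) x :=
    (innerSL ℝ (b i)).hasFDerivAt.comp x hY.hasFDerivAt
  rw [(h.hasLineDerivAt (b i)).lineDeriv]
  rfl

lemma integrable_divergence {lab : V → ι} (hlm : ∀ k, MeasurableSet (lab ⁻¹' {k}))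
    {Y : ι → V → V} {K : ℝ≥0} {R : ℝ} (hY : ∀ k, LipschitzWith K (Y k))
    (hYR : ∀ k x, R < ‖x‖ → Y k x = 0) : Integrable fun x => divergence (Y (lab x)) x := by
  refine integrable_of_abs_le_of_eq_zero (R := R) (C := finrank ℝ V * K) ?_ ?_ ?_
    measure_closedBall_lt_top.ne
  · refine (measurable_of_label hlm (G := fun k x => divergence (Y k) x)
      fun k => ?_).aestronglyMeasurable
    exact (LinearMap.continuous_of_finiteDimensional
      ((LinearMap.trace ℝ V).comp (ContinuousLinearMap.coeLM ℝ))).measurable.comp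
        (measurable_fderiv ℝ (Y k))
  · intro x
    rw [divergence, LinearMap.trace_eq_sum_inner _ (stdOrthonormalBasis ℝ V)]
    refine (Finset.abs_sum_le_sum_abs _ _).trans ?_
    refine (Finset.sum_le_card_nsmul _ _ (K : ℝ) fun i _ => ?_).trans (by simp)
    refine (abs_real_inner_le_norm _ _).trans ?_
    rw [(stdOrthonormalBasis ℝ V).norm_eq_one, one_mul]
    refine ((fderiv ℝ (Y (lab x)) x).le_opNorm _).trans ?_
    rw [(stdOrthonormalBasis ℝ V).norm_eq_one, mul_one]
    exact norm_fderiv_le_of_lipschitz ℝ (hY _)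
  · intro x hx
    have : Y (lab x) =ᶠ[𝓝 x] fun _ => 0 := by
      filter_upwards [(isOpen_lt continuous_const continuous_norm).mem_nhds hx] with y hy
      exact hYR _ _ hy
    rw [divergence, this.fderiv_eq]
    simp

lemma abs_integral_divergence_le_of_cone {n : ℕ} (hn : finrank ℝ V = n + 1) {E : Set V}
    (hE : IsClosed E) {lab : V → ι}
    (hlab : ∀ x y, (∀ s ∈ Icc (0 : ℝ) 1, x + s • (y - x) ∉ E) → lab x = lab y)
    (hlm : ∀ k, MeasurableSet (lab ⁻¹' {k})) {X : ι → V → V} {θ : V → ℝ} {K L : ℝ≥0} {R M : ℝ}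
    (hX : ∀ k, LipschitzWith L (X k)) (hXM : ∀ k x, ‖X k x‖ ≤ M)
    (hX1 : ∀ k l x, ‖X k x - X l x‖ ≤ 1)
    (hθ : LipschitzWith K θ) (hθR : ∀ x, R < ‖x‖ → θ x = 0) (hθ0 : ∀ x, 0 ≤ θ x)
    (hfin : ∀ r, μHE[n] (E ∩ closedBall 0 r) ≠ ∞) {A : Set V} (hA : MeasurableSet A)
    (hAE : A ⊆ E) {ε : ℝ} (hε : 0 < ε) {ν : V} (hν : ‖ν‖ = 1) (hc : ConeCondition ε ν A) :
    |∫ x, divergence (fun y => θ y • X (lab x) y) x| ≤ (∫ x in E, θ x ∂μHE[n]) +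
      n * (ε * 2 ^ n * (∫ x in A, θ x ∂μHE[n]) + ∫ x in E \ A, θ x ∂μHE[n]) := by
  obtain ⟨b, hb⟩ : ∃ b : OrthonormalBasis (Fin (n + 1)) ℝ V, b 0 = ν := by
    obtain ⟨b, hb⟩ := Orthonormal.exists_orthonormalBasis_extension_of_card_eq (𝕜 := ℝ) (E := V)
      (ι := Fin (n + 1)) (by simpa using hn) (v := fun _ => ν) (s := {0}) (by
        rw [orthonormal_iff_ite]
        intro i j
        have hij : i = j := Subsingleton.elim i j
        rw [if_pos hij]
        simp [hν])
    exact ⟨b, hb 0 rfl⟩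
  obtain ⟨C, hC⟩ := exists_lipschitzWith_smul hθ hθR hX hXM
  have hbn : ∀ i, ‖b i‖ = 1 := fun i => b.norm_eq_one i
  have hF : ∀ i k, LipschitzWith C fun y => ⟪b i, θ y • X k y⟫ := by
    intro i k
    refine LipschitzWith.of_dist_le_mul fun x y => ?_
    rw [Real.dist_eq, ← inner_sub_right]
    refine (abs_real_inner_le_norm _ _).trans ?_
    rw [hbn, one_mul, ← dist_eq_norm]
    exact (hC k).dist_le_mul x y
  have hFθ : ∀ i k l x, |⟪b i, θ x • X k x⟫ - ⟪b i, θ x • X l x⟫| ≤ θ x := by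
    intro i k l x
    rw [← inner_sub_right, ← smul_sub]
    refine (abs_real_inner_le_norm _ _).trans ?_
    rw [hbn, one_mul, norm_smul, Real.norm_eq_abs, abs_of_nonneg (hθ0 x)]
    exact mul_le_of_le_one_right (hθ0 x) (hX1 k l x)
  have hFR : ∀ i k x, R < ‖x‖ → ⟪b i, θ x • X k x⟫ = 0 := by
    intro i k x hx
    rw [hθR x hx, zero_smul, inner_zero_right]
  have hsum : ∫ x, divergence (fun y => θ y • X (lab x) y) x
      = ∑ i, ∫ x, lineDeriv ℝ (fun y => ⟪b i, θ y • X (lab x) y⟫) x (b i) := by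
    rw [← integral_finsetSum]
    · refine integral_congr_ae ?_
      have hae : ∀ᵐ x : V, ∀ k, DifferentiableAt ℝ (fun y => θ y • X k y) x := by
        rw [ae_all_iff]
        exact fun k => (hC k).ae_differentiableAt
      filter_upwards [hae] with x hx
      exact divergence_eq_sum_lineDeriv b (hx (lab x))
    · intro i _
      refine integrable_of_abs_le_of_eq_zero (R := R) (C := C) ?_ ?_ ?_
        measure_closedBall_lt_top.ne
      · exact (measurable_of_label hlm fun k =>
          measurable_lineDeriv (hF i k).continuous).aestronglyMeasurable
      · intro x
        have := norm_lineDeriv_le_of_lipschitz ℝ (hF i (lab x)) (x₀ := x) (v := b i)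
        rwa [hbn, mul_one] at this
      · intro x hx
        have : (fun y => ⟪b i, θ y • X (lab x) y⟫) =ᶠ[𝓝 x] fun _ => 0 := by
          filter_upwards [(isOpen_lt continuous_const continuous_norm).mem_nhds hx] with y hy
          exact hFR _ _ _ hy
        rw [this.lineDeriv_eq]
        simp [lineDeriv]
  have hfin' : ∀ S ⊆ E, IntegrableOn θ S μHE[n] := by
    intro S hS
    obtain ⟨D, hD⟩ := hθ.continuous.bounded_above_of_compact_support
      (HasCompactSupport.intro (isCompact_closedBall (0 : V) R) fun x hx => hθR x (by
        simpa using hx))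
    refine IntegrableOn.mono_set ?_ hS
    refine integrable_of_abs_le_of_eq_zero (R := R) (C := D)
      hθ.continuous.measurable.aestronglyMeasurable hD hθR ?_
    rw [Measure.restrict_apply isClosed_closedBall.measurableSet, inter_comm]
    exact hfin R
  have hline : ∀ i (m : Measure V), m (E ∩ closedBall 0 (R + 1)) ≠ ∞ →
      (∀ B ⊆ E, MeasurableSet B → ∀ h : ℝ, 0 < h →
        volume (sweep (b i) h B) ≤ ENNReal.ofReal h * m B) →
      |∫ x, lineDeriv ℝ (fun y => ⟪b i, θ y • X (lab x) y⟫) x (b i)| ≤ ∫ x in E, θ x ∂m := by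
    intro i m h1 h2
    exact abs_integral_lineDeriv_le (F := fun k y => ⟪b i, θ y • X k y⟫) hE hlab hlm
      (fun k => (hF i k).weaken (le_max_left C K)) (hFR i) (hθ.weaken (le_max_right C K)) hθR
      (hFθ i) (hbn i) h1 h2
  have h0 := hline 0 μHE[n] (hfin _) fun B _ hB h hh => volume_sweep_le hn (hbn 0) hh hB
  have hθA := hfin' A hAE
  have hθEA := hfin' (E \ A) sdiff_subset
  have hi : ∀ i, i ≠ 0 → |∫ x, lineDeriv ℝ (fun y => ⟪b i, θ y • X (lab x) y⟫) x (b i)| ≤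
      ε * 2 ^ n * (∫ x in A, θ x ∂μHE[n]) + ∫ x in E \ A, θ x ∂μHE[n] := by
    intro i hi
    set m : Measure V := ENNReal.ofReal (ε * 2 ^ n) • μHE[n].restrict A + μHE[n].restrict (E \ A)
      with hm
    refine (hline i m ?_ ?_).trans_eq ?_
    · have hEB : MeasurableSet (E ∩ closedBall 0 (R + 1)) :=
        (hE.inter isClosed_closedBall).measurableSet
      rw [hm, Measure.add_apply, Measure.smul_apply, smul_eq_mul]
      refine ENNReal.add_ne_top.2 ⟨ENNReal.mul_ne_top ENNReal.ofReal_ne_top ?_, ?_⟩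
      · exact ((Measure.restrict_apply_le _ _).trans_lt (hfin _).lt_top).ne
      · exact ((Measure.restrict_apply_le _ _).trans_lt (hfin _).lt_top).ne
    · intro B hBE hB h hh
      have hsub : sweep (b i) h B ⊆ sweep (b i) h (B ∩ A) ∪ sweep (b i) h (B \ A) := by
        rintro x ⟨s, hs, hx⟩
        by_cases hA : x + s • b i ∈ A
        · exact Or.inl ⟨s, hs, hx, hA⟩
        · exact Or.inr ⟨s, hs, hx, hA⟩
      refine (measure_mono hsub).trans ((measure_union_le _ _).trans ?_)
      have e1 := volume_sweep_le_of_cone hn (hbn i) hν (ν := ν) (by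
        rw [← hb]; exact b.inner_eq_zero (Ne.symm hi)) hh hε (hB.inter hA)
        (hc.mono inter_subset_right)
      have e2 := volume_sweep_le hn (hbn i) hh (hB.diff hA)
      refine (add_le_add e1 e2).trans_eq ?_
      have e3 : B ∩ (E \ A) = B \ A := by
        ext x; exact ⟨fun h => ⟨h.1, h.2.2⟩, fun h => ⟨h.1, hBE h.1, h.2⟩⟩
      rw [hm, Measure.add_apply, Measure.smul_apply, smul_eq_mul, Measure.restrict_apply hB,
        Measure.restrict_apply hB, e3, mul_add]
    · rw [hm, Measure.restrict_add, Measure.restrict_smul,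
        Measure.restrict_restrict hE.measurableSet, Measure.restrict_restrict hE.measurableSet, inter_eq_right.2 hAE,
        inter_eq_right.2 sdiff_subset, integral_add_measure (hθA.smul_measure
          ENNReal.ofReal_ne_top) hθEA, integral_smul_measure, ENNReal.toReal_ofReal (by positivity),
        smul_eq_mul]
  rw [hsum, Fin.sum_univ_succ]
  refine (abs_add_le _ _).trans (add_le_add h0 ((Finset.abs_sum_le_sum_abs _ _).trans ?_))
  refine (Finset.sum_le_card_nsmul _ _ _ fun i _ => hi i.succ (Fin.succ_ne_zero i)).trans ?_
  simp [mul_add]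

end Divergence

section DivergenceBound

open Module MeasureTheory.Measure Filter Topology
open scoped ENNReal RealInnerProductSpace

lemma exists_lipschitz_partition {V : Type*} [PseudoMetricSpace V] {N : ℕ} {A : Fin N → Set V}
    (hA : ∀ i, IsCompact (A i)) (hAc : ∀ i, IsClosed (A i))
    (hd : Pairwise (Function.onFun Disjoint A)) :
    ∃ (K : ℝ≥0) (ζ : Option (Fin N) → V → ℝ), (∀ o, LipschitzWith K (ζ o)) ∧
      (∀ o x, 0 ≤ ζ o x) ∧ (∀ x, ∑ o, ζ o x = 1) ∧
      ∀ i, ∀ x ∈ A i, ∀ o, o ≠ some i → ζ o x = 0 := by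
  have hr : ∀ p : Fin N × Fin N, ∀ᶠ r in 𝓝[>] (0 : ℝ), p.1 ≠ p.2 →
      Disjoint (thickening r (A p.1)) (thickening r (A p.2)) := by
    intro p
    by_cases hp : p.1 = p.2
    · exact Eventually.of_forall fun r h => absurd hp h
    obtain ⟨δ, hδ, h⟩ := (hd hp).exists_thickenings (hA p.1) (hAc p.2)
    filter_upwards [Ioo_mem_nhdsGT hδ] with r hr _
    exact h.mono (thickening_mono hr.2.le _) (thickening_mono hr.2.le _)
  obtain ⟨r, hr, hr0⟩ := ((eventually_all.2 hr).and self_mem_nhdsWithin).exists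
  have hr0 : 0 < r := hr0
  set z : Fin N → V → ℝ := fun i x => thickenedIndicator hr0 (A i) x with hz
  have hz0 : ∀ i x, 0 ≤ z i x := fun i x => NNReal.coe_nonneg _
  have hz1 : ∀ i x, z i x ≤ 1 := fun i x => by
    exact_mod_cast thickenedIndicator_le_one hr0 (A i) x
  have hzl : ∀ i x y, |z i x - z i y| ≤ (r.toNNReal⁻¹ : ℝ≥0) * dist x y := fun i x y =>
    (lipschitzWith_thickenedIndicator hr0 (A i)).dist_le_mul x y
  have hs : ∀ x, ∑ i, z i x ≤ 1 := by
    intro x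
    by_cases h : ∃ i, x ∈ thickening r (A i)
    · obtain ⟨i, hi⟩ := h
      rw [Finset.sum_eq_single i]
      · exact hz1 i x
      · intro j _ hj
        have : x ∉ thickening r (A j) := fun hj' =>
          (disjoint_left.1 (hr (i, j) (Ne.symm hj)) hi hj')
        exact NNReal.coe_eq_zero.2 (thickenedIndicator_zero hr0 (A j) this)
      · simp
    · push Not at h
      rw [Finset.sum_eq_zero]
      · exact zero_le_one
      · intro j _
        exact NNReal.coe_eq_zero.2 (thickenedIndicator_zero hr0 (A j) (h j))
  have hsum : ∀ x, ∑ o : Option (Fin N), (Option.elim o (1 - ∑ i, z i x) fun i => z i x) = 1 := by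
    intro x
    rw [Fintype.sum_option]
    simp
  have hnn : ∀ (o : Option (Fin N)) x, 0 ≤ Option.elim o (1 - ∑ i, z i x) fun i => z i x := by
    rintro (_ | i) x
    · simpa using hs x
    · exact hz0 i x
  refine ⟨(N + 1) * r.toNNReal⁻¹, fun o x => Option.elim o (1 - ∑ i, z i x) fun i => z i x,
    ?_, hnn, hsum, ?_⟩
  · rintro (_ | i)
    · refine LipschitzWith.of_dist_le_mul fun x y => ?_
      simp only [Option.elim]
      rw [Real.dist_eq, sub_sub_sub_cancel_left, ← Finset.sum_sub_distrib]
      refine (Finset.abs_sum_le_sum_abs _ _).trans ((Finset.sum_le_card_nsmul _ _ _ fun i _ =>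
        hzl i y x).trans ?_)
      rw [Finset.card_univ, Fintype.card_fin, nsmul_eq_mul, dist_comm]
      push_cast
      have : 0 ≤ ((r.toNNReal : ℝ))⁻¹ * dist x y := by positivity
      nlinarith
    · refine LipschitzWith.of_dist_le_mul fun x y => ?_
      simp only [Option.elim]
      rw [Real.dist_eq]
      refine (hzl i x y).trans ?_
      push_cast
      have : 0 ≤ ((r.toNNReal : ℝ))⁻¹ * dist x y := by positivity
      have hN : (0 : ℝ) ≤ N := by positivity
      nlinarith
  · intro i x hx o ho
    have h1 : z i x = 1 := NNReal.coe_eq_one.2 (thickenedIndicator_one hr0 (A i) hx)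
    have h2 := Finset.sum_le_univ_sum_of_nonneg (s := {o, some i}) fun o => hnn o x
    rw [hsum, Finset.sum_pair ho] at h2
    have h3 := hnn o x
    simp only [Option.elim] at h2 h3 ⊢
    linarith

variable {V : Type*} [NormedAddCommGroup V] [InnerProductSpace ℝ V] [FiniteDimensional ℝ V]
  [MeasurableSpace V] [BorelSpace V] {ι : Type*} [Finite ι]

/-- Calibration inequality: a field which is piecewise Lipschitz, with pieces that only change
across the rectifiable closed set `E` and with jumps of norm at most one. -/
lemma abs_integral_divergence_le {n : ℕ} (hn : finrank ℝ V = n + 1) {E : Set V}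
    (hE : IsClosed E) (hEf : NearlyFlatCover n E) {lab : V → ι}
    (hlab : ∀ x y, (∀ s ∈ Icc (0 : ℝ) 1, x + s • (y - x) ∉ E) → lab x = lab y)
    (hlm : ∀ k, MeasurableSet (lab ⁻¹' {k})) {X : ι → V → V} {χ : V → ℝ} {K L : ℝ≥0} {R M : ℝ}
    (hX : ∀ k, LipschitzWith L (X k)) (hXM : ∀ k x, ‖X k x‖ ≤ M)
    (hX1 : ∀ k l x, ‖X k x - X l x‖ ≤ 1)
    (hχ : LipschitzWith K χ) (hχR : ∀ x, R < ‖x‖ → χ x = 0) (hχ0 : ∀ x, 0 ≤ χ x)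
    (hχ1 : ∀ x, χ x ≤ 1) (hfin : ∀ r, μHE[n] (E ∩ closedBall 0 r) ≠ ∞) :
    |∫ x, divergence (fun y => χ y • X (lab x) y) x| ≤ ∫ x in E, χ x ∂μHE[n] := by
  have hχi : ∀ S ⊆ E, IntegrableOn χ S μHE[n] := by
    intro S hS
    refine IntegrableOn.mono_set ?_ hS
    refine integrable_of_abs_le_of_eq_zero (R := R) (C := 1)
      hχ.continuous.measurable.aestronglyMeasurable
      (fun x => by rw [abs_of_nonneg (hχ0 x)]; exact hχ1 x) hχR ?_
    rw [Measure.restrict_apply isClosed_closedBall.measurableSet, inter_comm]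
    exact hfin R
  set I := ∫ x in E, χ x ∂μHE[n] with hI
  have hI0 : 0 ≤ I := integral_nonneg hχ0
  have key : ∀ ε : ℝ, 0 < ε → |∫ x, divergence (fun y => χ y • X (lab x) y) x| ≤
      I + n * (ε * 2 ^ n * I + ε) := by
    intro ε hε
    set G := E ∩ closedBall 0 R with hG
    have hGm : MeasurableSet G := (hE.inter isClosed_closedBall).measurableSet
    obtain ⟨N, A, hA, hAd, hAμ⟩ := (hEf.mono inter_subset_left).exists_compact_family hGm
      (hfin R) hε
    obtain ⟨C, ζ, hζ, hζ0, hζs, hζA⟩ := exists_lipschitz_partition (fun i => (hA i).1)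
      (fun i => (hA i).1.isClosed) hAd
    have hζ1 : ∀ o x, ζ o x ≤ 1 := fun o x => by
      rw [← hζs x]
      exact Finset.single_le_sum (f := fun o => ζ o x) (fun o _ => hζ0 o x) (Finset.mem_univ o)
    set θ : Option (Fin N) → V → ℝ := fun o x => χ x * ζ o x with hθ
    obtain ⟨Kθ, hKθ⟩ := exists_lipschitzWith_smul (X := ζ) (M := 1) hχ hχR hζ fun o x => by
      rw [Real.norm_eq_abs, abs_of_nonneg (hζ0 o x)]; exact hζ1 o x
    have hθl : ∀ o, LipschitzWith Kθ (θ o) := hKθ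
    have hθR : ∀ o x, R < ‖x‖ → θ o x = 0 := fun o x hx => by simp [hθ, hχR x hx]
    have hθ0 : ∀ o x, 0 ≤ θ o x := fun o x => mul_nonneg (hχ0 x) (hζ0 o x)
    have hθχ : ∀ o x, θ o x ≤ χ x := fun o x => mul_le_of_le_one_right (hχ0 x) (hζ1 o x)
    have hθs : ∀ x, ∑ o, θ o x = χ x := fun x => by
      simp only [hθ]; rw [← Finset.mul_sum, hζs, mul_one]
    have hθi : ∀ o, ∀ S ⊆ E, IntegrableOn (θ o) S μHE[n] := fun o S hS =>
      (hχi S hS).mono' (hθl o).continuous.measurable.aestronglyMeasurable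
        (Eventually.of_forall fun x => by
          rw [Real.norm_eq_abs, abs_of_nonneg (hθ0 o x)]; exact hθχ o x)
    set U : Set V := ⋃ i, A i with hU
    have hUm : MeasurableSet U := MeasurableSet.iUnion fun i => (hA i).1.isClosed.measurableSet
    have hbound : ∀ o, |∫ x, divergence (fun y => θ o y • X (lab x) y) x| ≤
        (∫ x in E, θ o x ∂μHE[n]) + n * (ε * 2 ^ n * (∫ x in E, θ o x ∂μHE[n]) +
          ∫ x in E \ U, θ o x ∂μHE[n]) := by
      have aux : ∀ (o : Option (Fin N)) (A' : Set V), MeasurableSet A' → A' ⊆ E → A' ⊆ U →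
          (∃ ν : V, ‖ν‖ = 1 ∧ ConeCondition ε ν A') → (∀ x ∈ U, x ∉ A' → θ o x = 0) →
          |∫ x, divergence (fun y => θ o y • X (lab x) y) x| ≤
        (∫ x in E, θ o x ∂μHE[n]) + n * (ε * 2 ^ n * (∫ x in E, θ o x ∂μHE[n]) +
          ∫ x in E \ U, θ o x ∂μHE[n]) := by
        rintro o A' hA'm hA'E hA'U ⟨ν, hν, hc⟩ hz
        refine (abs_integral_divergence_le_of_cone hn hE hlab hlm hX hXM hX1 (hθl o) (hθR o)
          (hθ0 o) hfin hA'm hA'E hε hν hc).trans ?_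
        have e1 : ∫ x in A', θ o x ∂μHE[n] ≤ ∫ x in E, θ o x ∂μHE[n] :=
          setIntegral_mono_set (hθi o E subset_rfl) (Eventually.of_forall (hθ0 o))
            hA'E.eventuallyLE
        have e2 : ∫ x in E \ U, θ o x ∂μHE[n] = ∫ x in E \ A', θ o x ∂μHE[n] := by
          refine (setIntegral_eq_of_subset_of_forall_sdiff_eq_zero
            (hE.measurableSet.diff hA'm) (sdiff_subset_sdiff_right hA'U) ?_).symm
          rintro x ⟨⟨hxE, hxA⟩, hxU⟩
          exact hz x (by_contra fun h => hxU ⟨hxE, h⟩) hxA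
        rw [e2]
        gcongr
      rintro (_ | i)
      · have : Nontrivial V := by
          apply Module.nontrivial_of_finrank_pos (R := ℝ); omega
        obtain ⟨ν, hν⟩ := exists_norm_eq V zero_le_one
        refine aux none ∅ MeasurableSet.empty (empty_subset _) (empty_subset _)
          ⟨ν, hν, fun x hx => absurd hx (notMem_empty x)⟩ fun x hx _ => ?_
        obtain ⟨i, hi⟩ := mem_iUnion.1 hx
        simp [hθ, hζA i x hi none (by simp)]
      · refine aux (some i) (A i) (hA i).1.isClosed.measurableSet
          ((hA i).2.1.trans inter_subset_left) (subset_iUnion A i) (hA i).2.2 fun x hx hxi => ?_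
        obtain ⟨j, hj⟩ := mem_iUnion.1 hx
        have : j ≠ i := by rintro rfl; exact hxi hj
        simp [hθ, hζA j x hj (some i) (by simpa using this.symm)]
    obtain ⟨C', hC'⟩ : ∃ C' : ℝ≥0, ∀ o k, LipschitzWith C' fun x => θ o x • X k x := by
      choose C' hC' using fun o => exists_lipschitzWith_smul (hθl o) (hθR o) hX hXM
      exact ⟨∑ o, C' o, fun o k => (hC' o k).weaken
        (Finset.single_le_sum (fun _ _ => zero_le) (Finset.mem_univ o))⟩
    have hdec : ∫ x, divergence (fun y => χ y • X (lab x) y) x =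
        ∑ o, ∫ x, divergence (fun y => θ o y • X (lab x) y) x := by
      rw [← integral_finsetSum _ fun o _ => integrable_divergence hlm
        (Y := fun k y => θ o y • X k y) (hC' o) fun k x hx => by rw [hθR o x hx, zero_smul]]
      refine integral_congr_ae ?_
      have hae : ∀ᵐ x : V, ∀ o k, DifferentiableAt ℝ (fun y => θ o y • X k y) x := by
        simp only [ae_all_iff]
        exact fun o k => (hC' o k).ae_differentiableAt
      filter_upwards [hae] with x hx
      have : (fun y => χ y • X (lab x) y) = fun y => ∑ o, θ o y • X (lab x) y := by
        ext1 y; rw [← Finset.sum_smul, hθs]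
      simp only [divergence]
      rw [this, fderiv_fun_sum fun o _ => hx o (lab x)]
      simp
    have hInt : ∀ S ⊆ E, ∑ o, ∫ x in S, θ o x ∂μHE[n] = ∫ x in S, χ x ∂μHE[n] := by
      intro S hS
      rw [← integral_finsetSum _ fun o _ => hθi o S hS]
      simp only [hθs]
    have hlast : ∫ x in E \ U, χ x ∂μHE[n] ≤ ε := by
      have hfG : μHE[n] (G \ U) ≠ ∞ := ne_top_of_le_ne_top ENNReal.ofReal_ne_top hAμ
      have e1 : ∫ x in E \ U, χ x ∂μHE[n] = ∫ x in G \ U, χ x ∂μHE[n] := by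
        refine (setIntegral_eq_of_subset_of_forall_sdiff_eq_zero (hE.measurableSet.diff hUm)
          (sdiff_subset_sdiff_left inter_subset_left) ?_)
        rintro x ⟨⟨hxE, hxU⟩, hx⟩
        refine hχR x (by_contra fun h => hx ⟨⟨hxE, ?_⟩, hxU⟩)
        rw [mem_closedBall_zero_iff]; exact not_lt.1 h
      rw [e1]
      calc _ ≤ ∫ x in G \ U, (1 : ℝ) ∂μHE[n] :=
            setIntegral_mono (hχi _ (sdiff_subset.trans inter_subset_left))
              (integrableOn_const hfG) hχ1
        _ = (μHE[n] (G \ U)).toReal := by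
            rw [setIntegral_const, smul_eq_mul, mul_one]; rfl
        _ ≤ ε := ENNReal.toReal_le_of_le_ofReal hε.le hAμ
    rw [hdec]
    refine (Finset.abs_sum_le_sum_abs _ _).trans
      ((Finset.sum_le_sum fun o _ => hbound o).trans ?_)
    rw [Finset.sum_add_distrib, ← Finset.mul_sum, Finset.sum_add_distrib, ← Finset.mul_sum,
      hInt E subset_rfl, hInt (E \ U) sdiff_subset]
    gcongr
  have ht : Tendsto (fun ε : ℝ => I + n * (ε * 2 ^ n * I + ε)) (𝓝[>] 0) (𝓝 I) := by
    have : Tendsto (fun ε : ℝ => I + n * (ε * 2 ^ n * I + ε)) (𝓝 0)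
        (𝓝 (I + n * (0 * 2 ^ n * I + 0))) := Continuous.tendsto (by fun_prop) 0
    simp only [zero_mul, add_zero, mul_zero] at this
    exact this.mono_left nhdsWithin_le_nhds
  exact ge_of_tendsto ht (eventually_nhdsWithin_of_forall fun ε hε => key ε hε)

end DivergenceBound

section Degree

open Module MeasureTheory.Measure Filter Topology
open scoped ENNReal RealInnerProductSpace

variable {V : Type*} [NormedAddCommGroup V] [InnerProductSpace ℝ V] [FiniteDimensional ℝ V]

lemma exists_polynomial_eval_eq_det (M : V →L[ℝ] V) :
    ∃ p : Polynomial ℝ, p.natDegree ≤ finrank ℝ V ∧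
      ∀ t : ℝ, p.eval t = (ContinuousLinearMap.id ℝ V + t • M).det := by
  set b := finBasis ℝ V
  set A := LinearMap.toMatrix b b (M : V →ₗ[ℝ] V) with hA
  refine ⟨_, (Polynomial.natDegree_det_X_add_C_le A 1).trans (by simp), fun t => ?_⟩
  rw [← Polynomial.coe_evalRingHom, RingHom.map_det, ContinuousLinearMap.det,
    ← LinearMap.det_toMatrix b]
  congr 1
  have : ((ContinuousLinearMap.id ℝ V + t • M : V →L[ℝ] V) : V →ₗ[ℝ] V) =
      LinearMap.id + t • (M : V →ₗ[ℝ] V) := rfl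
  have h2 : LinearMap.toMatrix b b (LinearMap.id + t • (M : V →ₗ[ℝ] V)) = 1 + t • A := by
    rw [map_add, map_smul, LinearMap.toMatrix_id, ← hA]
  rw [this, h2]
  ext i j
  simp [Matrix.one_apply, apply_ite, add_comm]
  ring

lemma bijective_id_add_of_lipschitzWith {V : Type*} [NormedAddCommGroup V] [CompleteSpace V]
    {u : V → V} {K : ℝ≥0} (hu : LipschitzWith K u) (hK : K < 1) :
    Function.Bijective fun x => x + u x := by
  constructor
  · intro x y hxy
    have h1 : x - y = u y - u x := by
      have : x + u x = y + u y := hxy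
      rw [sub_eq_sub_iff_add_eq_add, this, add_comm]
    have h2 := hu.dist_le_mul y x
    rw [dist_eq_norm, ← h1, dist_eq_norm, ← norm_sub_rev x y] at h2
    have hK' : (K : ℝ) < 1 := by exact_mod_cast hK
    have : ‖x - y‖ = 0 := by nlinarith [norm_nonneg (x - y)]
    exact sub_eq_zero.1 (norm_eq_zero.1 this)
  · intro y
    have hc : ContractingWith K fun x => y - u x := by
      refine ⟨hK, LipschitzWith.of_dist_le_mul fun a b => ?_⟩
      rw [dist_sub_left]
      exact hu.dist_le_mul a b
    refine ⟨ContractingWith.fixedPoint _ hc, ?_⟩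
    have := hc.fixedPoint_isFixedPt
    have h2 : y - u (ContractingWith.fixedPoint _ hc) = ContractingWith.fixedPoint _ hc := this
    have h3 := sub_eq_iff_eq_add.1 h2
    exact h3.symm

variable [MeasurableSpace V] [BorelSpace V]

lemma LipschitzWith.volume_image_eq_zero {f : V → V} {K : ℝ≥0} (hf : LipschitzWith K f)
    {S : Set V} (hS : volume S = 0) : volume (f '' S) = 0 := by
  have := (hf.lipschitzOnWith (s := S)).euclideanHausdorffMeasure_image_le (finrank ℝ V)
  rw [InnerProductSpace.euclideanHausdorffMeasure_eq_volume, hS, mul_zero] at this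
  exact le_antisymm this zero_le

lemma exists_pos_integral_det_eq_zero : ∃ δ : ℝ≥0, 0 < δ ∧ ∀ (u : V → V) (K : ℝ≥0) (R : ℝ),
    LipschitzWith K u → K < δ → (∀ x, R < ‖x‖ → u x = 0) →
    ∫ x, ((ContinuousLinearMap.id ℝ V + fderiv ℝ u x).det - 1) = 0 := by
  have hdet1 : (ContinuousLinearMap.id ℝ V).det = 1 := by
    rw [ContinuousLinearMap.det]; exact LinearMap.det_id
  obtain ⟨δ, hδ, hδd⟩ : ∃ δ > 0, ∀ A : V →L[ℝ] V, ‖A‖ < δ →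
      0 < (ContinuousLinearMap.id ℝ V + A).det := by
    have hcont : ContinuousAt (fun A : V →L[ℝ] V => (ContinuousLinearMap.id ℝ V + A).det) 0 :=
      (ContinuousLinearMap.continuous_det.comp (continuous_const.add continuous_id)).continuousAt
    have h1 : (0 : ℝ) < (fun A : V →L[ℝ] V => (ContinuousLinearMap.id ℝ V + A).det) 0 := by
      simp [hdet1]
    obtain ⟨δ, hδ, h⟩ := Metric.eventually_nhds_iff.1 (hcont.eventually_const_lt h1)
    exact ⟨δ, hδ, fun A hA => h (by simpa using hA)⟩
  refine ⟨min 1 δ.toNNReal, by simpa using hδ, fun u K R hu hK hR => ?_⟩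
  have hK1 : K < 1 := hK.trans_le (min_le_left _ _)
  have hKδ : (K : ℝ) < δ := by
    have := NNReal.coe_lt_coe.2 (hK.trans_le (min_le_right _ _))
    rwa [Real.coe_toNNReal _ hδ.le] at this
  set g : V → V := fun x => x + u x with hg
  obtain ⟨hinj, hsurj⟩ := bijective_id_add_of_lipschitzWith hu hK1
  have hgl : LipschitzWith (1 + K) g := LipschitzWith.id.add hu
  set B := closedBall (0 : V) R with hB
  have hBm : MeasurableSet B := isClosed_closedBall.measurableSet
  have hgout : ∀ x, x ∉ B → g x = x := fun x hx => by
    rw [hg]; simp only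
    rw [hR x (by simpa [hB] using hx), add_zero]
  have hgB : g '' B = B := by
    ext y
    constructor
    · rintro ⟨x, hx, rfl⟩
      by_contra hcon
      have : g x = x := hinj (hgout _ hcon)
      rw [this] at hcon
      exact hcon hx
    · intro hy
      obtain ⟨x, rfl⟩ := hsurj y
      by_cases hx : x ∈ B
      · exact ⟨x, hx, rfl⟩
      · have := hgout x hx
        exact absurd (by rw [← this]; exact hy) hx
  set D := {x | DifferentiableAt ℝ u x} with hD
  have hDm : MeasurableSet D := measurableSet_of_differentiableAt ℝ u
  have hDn : volume Dᶜ = 0 := hu.ae_differentiableAt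
  have hpos : ∀ x, 0 < (ContinuousLinearMap.id ℝ V + fderiv ℝ u x).det := fun x =>
    hδd _ ((norm_fderiv_le_of_lipschitz ℝ hu).trans_lt hKδ)
  have hcv := lintegral_abs_det_fderiv_eq_addHaar_image volume (hBm.inter hDm)
    (f := g) (f' := fun x => ContinuousLinearMap.id ℝ V + fderiv ℝ u x)
    (fun x hx => ((hasFDerivAt_id x).add
      (show DifferentiableAt ℝ u x from hx.2).hasFDerivAt).hasFDerivWithinAt) hinj.injOn
  have himg : volume (g '' (B ∩ D)) = volume B := by
    refine le_antisymm ((measure_mono (image_mono inter_subset_left)).trans_eq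
      (by rw [hgB])) ?_
    have hsub : B ⊆ g '' (B ∩ D) ∪ g '' Dᶜ := by
      rw [← image_union]
      nth_rw 1 [← hgB]
      refine image_mono fun x hx => ?_
      by_cases hxD : x ∈ D
      · exact Or.inl ⟨hx, hxD⟩
      · exact Or.inr hxD
    refine (measure_mono hsub).trans ((measure_union_le _ _).trans_eq ?_)
    rw [hgl.volume_image_eq_zero hDn, add_zero]
  have hae : (B ∩ D : Set V) =ᵐ[volume] B := by
    have : D =ᵐ[volume] univ := by rw [ae_eq_univ]; exact hDn
    simpa using (ae_eq_refl B).inter this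
  rw [himg, setLIntegral_congr hae] at hcv
  have hmeas : Measurable fun x => (ContinuousLinearMap.id ℝ V + fderiv ℝ u x).det :=
    ContinuousLinearMap.continuous_det.measurable.comp
      ((measurable_fderiv ℝ u).const_add _)
  have hvB : volume B ≠ ∞ := measure_closedBall_lt_top.ne
  have hInt : IntegrableOn (fun x => (ContinuousLinearMap.id ℝ V + fderiv ℝ u x).det) B := by
    refine ⟨hmeas.aestronglyMeasurable, ?_⟩
    rw [hasFiniteIntegral_iff_norm]
    exact (hcv.trans_lt hvB.lt_top)
  have hval : ∫ x in B, (ContinuousLinearMap.id ℝ V + fderiv ℝ u x).det = (volume B).toReal := by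
    rw [integral_eq_lintegral_of_nonneg_ae (Eventually.of_forall fun x => (hpos x).le)
      hmeas.aestronglyMeasurable, ← hcv]
    congr 1
    refine lintegral_congr fun x => ?_
    rw [abs_of_pos (hpos x)]
  rw [← setIntegral_eq_integral_of_forall_compl_eq_zero (s := B), integral_sub hInt
    (integrableOn_const hvB), hval, setIntegral_const]
  · simp [Measure.real]
  · intro x hx
    have : u =ᶠ[𝓝 x] fun _ => 0 := by
      filter_upwards [isClosed_closedBall.isOpen_compl.mem_nhds hx] with y hy
      exact hR y (by simpa using hy)
    rw [this.fderiv_eq]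
    simp [hdet1]

lemma measurable_det_fderiv (u : V → V) : Measurable fun x => (fderiv ℝ u x).det :=
  ContinuousLinearMap.continuous_det.measurable.comp (measurable_fderiv ℝ u)

lemma exists_abs_det_fderiv_le {u : V → V} {K : ℝ≥0} (hu : LipschitzWith K u) :
    ∃ C : ℝ, ∀ x, |(fderiv ℝ u x).det| ≤ C := by
  have := (isCompact_closedBall (0 : V →L[ℝ] V) K).exists_bound_of_continuousOn
    ContinuousLinearMap.continuous_det.continuousOn
  obtain ⟨C, hC⟩ := this
  exact ⟨C, fun x => hC _ (by
    simpa using norm_fderiv_le_of_lipschitz ℝ hu (x₀ := x))⟩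

lemma integrable_det_sub_one {u : V → V} {K : ℝ≥0} {R : ℝ} (hu : LipschitzWith K u)
    (hR : ∀ x, R < ‖x‖ → u x = x) : Integrable fun x => (fderiv ℝ u x).det - 1 := by
  obtain ⟨C, hC⟩ := exists_abs_det_fderiv_le hu
  refine integrable_of_abs_le_of_eq_zero (R := R) (C := C + 1)
    ((measurable_det_fderiv u).sub_const 1).aestronglyMeasurable (fun x => ?_) (fun x hx => ?_)
    measure_closedBall_lt_top.ne
  · refine (abs_sub _ _).trans ?_
    rw [abs_one]
    exact add_le_add_left (hC x) 1
  · have : u =ᶠ[𝓝 x] fun y => y := by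
      filter_upwards [(isOpen_lt continuous_const continuous_norm).mem_nhds hx] with y hy
      exact hR _ hy
    rw [this.fderiv_eq, fderiv_fun_id, ContinuousLinearMap.det]
    exact sub_eq_zero.2 LinearMap.det_id

/-- A Lipschitz map which is the identity near infinity preserves the signed volume. -/
lemma integral_det_fderiv_sub_one {f : V → V} {K : ℝ≥0} {R : ℝ} (hf : LipschitzWith K f)
    (hR : ∀ x, R < ‖x‖ → f x = x) : ∫ x, ((fderiv ℝ f x).det - 1) = 0 := by
  obtain ⟨δ, hδ, h⟩ := exists_pos_integral_det_eq_zero (V := V)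
  set u : V → V := fun x => f x - x with hu
  set L : ℝ≥0 := K + 1
  have hul : LipschitzWith L u := hf.sub LipschitzWith.id
  set d := finrank ℝ V
  set τ : ℝ≥0 := δ / ((d + 1) * (L + 1)) with hτ
  have hτ0 : 0 < τ := by positivity
  set v : ℕ → ℝ := fun i => i * τ with hv
  set s := Finset.range (d + 1)
  have hvs : Set.InjOn v s := fun i _ j _ hij => by
    have := mul_right_cancel₀ (NNReal.coe_pos.2 hτ0).ne' hij
    exact_mod_cast this
  set c : ℕ → ℝ := fun i => (Lagrange.basis s v i).eval 1 with hc
  have hcs : ∑ i ∈ s, c i = 1 := by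
    have := congrArg (Polynomial.eval 1) (Lagrange.sum_basis hvs ⟨0, by simp [s]⟩)
    rwa [Polynomial.eval_finsetSum, Polynomial.eval_one] at this
  have hinterp : ∀ M : V →L[ℝ] V, (ContinuousLinearMap.id ℝ V + M).det - 1 =
      ∑ i ∈ s, c i * ((ContinuousLinearMap.id ℝ V + v i • M).det - 1) := by
    intro M
    obtain ⟨p, hp, hpe⟩ := exists_polynomial_eval_eq_det M
    have hdeg : p.degree < s.card := by
      refine Polynomial.degree_le_natDegree.trans_lt ?_
      rw [Finset.card_range]
      exact_mod_cast Nat.lt_succ_of_le hp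
    have := congrArg (Polynomial.eval 1) (Lagrange.eq_interpolate hvs hdeg)
    rw [Lagrange.interpolate_apply, Polynomial.eval_finsetSum, hpe, one_smul] at this
    simp only [Polynomial.eval_mul, Polynomial.eval_C, hpe] at this
    simp only [mul_sub, Finset.sum_sub_distrib, mul_one, hcs]
    rw [this]
    congr 1
    exact Finset.sum_congr rfl fun i _ => mul_comm _ _
  have hui : ∀ i ∈ s, LipschitzWith (i * τ * L) fun x => v i • u x := by
    intro i _
    refine LipschitzWith.of_dist_le_mul fun x y => ?_
    have hv0 : 0 ≤ v i := by simp only [hv]; positivity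
    rw [dist_smul₀, Real.norm_eq_abs, abs_of_nonneg hv0]
    push_cast
    rw [mul_assoc ((i : ℝ) * τ)]
    exact mul_le_mul_of_nonneg_left (hul.dist_le_mul x y) hv0
  have hR' : ∀ i x, R < ‖x‖ → v i • u x = 0 := fun i x hx => by simp [hu, hR x hx]
  have hzero : ∀ i ∈ s,
      ∫ x, ((ContinuousLinearMap.id ℝ V + v i • fderiv ℝ u x).det - 1) = 0 := by
    intro i hi
    rw [← h _ _ R (hui i hi) ?_ (hR' i)]
    · refine integral_congr_ae ?_
      filter_upwards [hul.ae_differentiableAt] with x hx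
      rw [fderiv_fun_const_smul hx]
    · have hi' : (i : ℝ≥0) ≤ d := by exact_mod_cast Nat.lt_succ_iff.1 (Finset.mem_range.1 hi)
      calc (i : ℝ≥0) * τ * L ≤ d * τ * L := by gcongr
        _ < (d + 1) * τ * (L + 1) := by
          have : 0 < τ * (d + 1 + L) := by positivity
          calc d * τ * L < d * τ * L + τ * (d + 1 + L) := lt_add_of_pos_right _ this
            _ = _ := by ring
        _ = δ := by rw [hτ]; field_simp
  have hII : ∀ i ∈ s, Integrable fun x =>
      c i * ((ContinuousLinearMap.id ℝ V + v i • fderiv ℝ u x).det - 1) := by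
    intro i hi
    refine Integrable.const_mul ?_ _
    have h1 : LipschitzWith (1 + i * τ * L) fun x => x + v i • u x :=
      LipschitzWith.id.add (hui i hi)
    refine (integrable_det_sub_one h1 (R := R) fun x hx => by
      rw [hR' i x hx, add_zero]).congr ?_
    filter_upwards [hul.ae_differentiableAt] with x hx
    have hd : HasFDerivAt (fun x => x + v i • u x)
        (ContinuousLinearMap.id ℝ V + v i • fderiv ℝ u x) x :=
      (hasFDerivAt_id x).add (hx.hasFDerivAt.const_smul (v i))
    rw [hd.fderiv]
  calc ∫ x, ((fderiv ℝ f x).det - 1)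
      = ∫ x, ∑ i ∈ s, c i * ((ContinuousLinearMap.id ℝ V + v i • fderiv ℝ u x).det - 1) := by
        refine integral_congr_ae ?_
        filter_upwards [hf.ae_differentiableAt] with x hx
        have hd : HasFDerivAt u (fderiv ℝ f x - ContinuousLinearMap.id ℝ V) x :=
          hx.hasFDerivAt.sub (hasFDerivAt_id x)
        rw [← hinterp, hd.fderiv, add_sub_cancel]
    _ = 0 := by
        rw [integral_finsetSum _ hII]
        refine Finset.sum_eq_zero fun i hi => ?_
        rw [integral_const_mul, hzero i hi, mul_zero]

end Degree

section Separation

open Module MeasureTheory.Measure Filter Topology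
open scoped ENNReal RealInnerProductSpace

lemma IsPreconnected.exists_mem_frontier {X : Type*} [TopologicalSpace X] {s R : Set X}
    (hs : IsPreconnected s) {x y : X} (hx : x ∈ s) (hy : y ∈ s) (hxR : x ∈ R) (hyR : y ∉ R) :
    ∃ z ∈ s, z ∈ frontier R := by
  by_contra! h
  have hsub : s ⊆ interior R ∪ interior Rᶜ := by
    intro z hz
    by_contra hc
    rw [mem_union, not_or] at hc
    refine h z hz ⟨?_, hc.1⟩
    rw [interior_compl, notMem_compl_iff] at hc
    exact hc.2
  have hd : Disjoint (interior R) (interior Rᶜ) :=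
    disjoint_compl_right.mono interior_subset interior_subset
  have hxi : x ∈ interior R := by
    rcases hsub hx with h1 | h1
    · exact h1
    · exact absurd hxR (interior_subset h1)
  have := hs.subset_left_of_subset_union isOpen_interior isOpen_interior hd hsub ⟨x, hx, hxi⟩ hy
  exact hyR (interior_subset this)

variable {V : Type*} [NormedAddCommGroup V] [InnerProductSpace ℝ V] [FiniteDimensional ℝ V]

lemma exists_mem_frontier_of_segment {R : Set V} {x y : V} (hx : x ∈ R) (hy : y ∉ R) :
    ∃ z ∈ frontier R, dist z y ≤ dist x y ∧ dist x z ≤ dist x y := by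
  obtain ⟨z, hz, hzR⟩ := (convex_segment (𝕜 := ℝ) x y).isPreconnected.exists_mem_frontier
    (left_mem_segment ℝ x y) (right_mem_segment ℝ x y) hx hy
  have := dist_add_dist_of_mem_segment hz
  exact ⟨z, hzR, by linarith [dist_nonneg (x := x) (y := z)],
    by linarith [dist_nonneg (x := z) (y := y)]⟩

lemma LipschitzWith.indicator_of_frontier {g : V → ℝ} {K : ℝ≥0} (hg : LipschitzWith K g)
    {R : Set V} (h0 : ∀ x ∈ frontier R, g x = 0) : LipschitzWith K (R.indicator g) := by
  have key : ∀ x ∈ R, ∀ y ∉ R, |g x| ≤ K * dist x y := by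
    intro x hx y hy
    obtain ⟨z, hz, -, hxz⟩ := exists_mem_frontier_of_segment hx hy
    have := hg.dist_le_mul x z
    rw [h0 z hz, Real.dist_eq, sub_zero] at this
    exact this.trans (mul_le_mul_of_nonneg_left hxz K.2)
  refine LipschitzWith.of_dist_le_mul fun x y => ?_
  by_cases hx : x ∈ R <;> by_cases hy : y ∈ R
  · rw [indicator_of_mem hx, indicator_of_mem hy]; exact hg.dist_le_mul x y
  · rw [indicator_of_mem hx, indicator_of_notMem hy, Real.dist_eq, sub_zero]
    exact key x hx y hy
  · rw [indicator_of_mem hy, indicator_of_notMem hx, Real.dist_eq, zero_sub, abs_neg, dist_comm]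
    exact key y hy x hx
  · rw [indicator_of_notMem hx, indicator_of_notMem hy, dist_self]
    positivity

variable [MeasurableSpace V] [BorelSpace V]

lemma ae_mem_interior_or {R : Set V} (hR : volume (frontier R) = 0) :
    ∀ᵐ x, x ∈ interior R ∨ x ∈ interior Rᶜ := by
  filter_upwards [measure_eq_zero_iff_ae_notMem.1 hR] with x hx
  by_contra hc
  rw [not_or] at hc
  refine hx ⟨?_, hc.1⟩
  rw [interior_compl, notMem_compl_iff] at hc
  exact hc.2

lemma setIntegral_fderiv_mul_det_eq_zero {φ : V → V} {K L : ℝ≥0} {B : ℝ}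
    (hφ : LipschitzWith K φ) (hB : ∀ x, B < ‖x‖ → φ x = x) {R : Set V} (hRm : MeasurableSet R)
    (hR : volume (frontier R) = 0) {ζ : V → ℝ} (hζ : Differentiable ℝ ζ) (hζL : LipschitzWith L ζ)
    (hζB : ∀ x, B < ‖x‖ → ζ x = 0) (hζR : ∀ x ∈ frontier R, ζ (φ x) = 0) (v : V) :
    ∫ x in R, fderiv ℝ ζ (φ x) v * (fderiv ℝ φ x).det = 0 := by
  set w := R.indicator (fun x => ζ (φ x)) with hw
  have hwL : LipschitzWith (L * K) w := (hζL.comp hφ).indicator_of_frontier hζR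
  set ψ : V → V := fun x => φ x + w x • v with hψ
  have hwv : LipschitzWith (‖v‖₊ * (L * K)) fun x => w x • v := by
    refine LipschitzWith.of_dist_le_mul fun x y => ?_
    have := hwL.dist_le_mul x y
    rw [dist_eq_norm, ← sub_smul, norm_smul, ← dist_eq_norm]
    push_cast at this ⊢
    calc dist (w x) (w y) * ‖v‖ ≤ (L * K * dist x y) * ‖v‖ := by gcongr
      _ = _ := by ring
  have hψL := hφ.add hwv
  have hψB : ∀ x, B < ‖x‖ → φ x + w x • v = x := by
    intro x hx
    have : w x = 0 := by
      by_cases hxR : x ∈ R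
      · rw [hw, indicator_of_mem hxR, hB x hx, hζB x hx]
      · rw [hw, indicator_of_notMem hxR]
    rw [this, zero_smul, add_zero, hB x hx]
  have h1 := integral_det_fderiv_sub_one hφ hB
  have h2 := integral_det_fderiv_sub_one hψL hψB
  have h3 : ∫ x, (((fderiv ℝ (fun x => φ x + w x • v) x).det - 1) - ((fderiv ℝ φ x).det - 1)) = 0 := by
    rw [integral_sub (integrable_det_sub_one hψL hψB) (integrable_det_sub_one hφ hB), h1, h2,
      sub_zero]
  rw [← integral_indicator hRm, ← h3]
  refine integral_congr_ae ?_
  filter_upwards [ae_mem_interior_or hR, hφ.ae_differentiableAt] with x hx hdx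
  rcases hx with hx | hx
  · rw [indicator_of_mem (interior_subset hx)]
    have heq : (fun x => φ x + w x • v) =ᶠ[𝓝 x] (fun z => z + ζ z • v) ∘ φ := by
      filter_upwards [isOpen_interior.mem_nhds hx] with y hy
      simp only [hw, Function.comp_apply, indicator_of_mem (interior_subset hy)]
    have hd1 : HasFDerivAt (fun z => z + ζ z • v)
        (ContinuousLinearMap.id ℝ V + (fderiv ℝ ζ (φ x)).smulRight v) (φ x) :=
      (hasFDerivAt_id _).add ((hζ (φ x)).hasFDerivAt.smul_const v)
    rw [heq.fderiv_eq, (hd1.comp x hdx.hasFDerivAt).fderiv, ContinuousLinearMap.det,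
      ContinuousLinearMap.det]
    have : ((ContinuousLinearMap.id ℝ V + (fderiv ℝ ζ (φ x)).smulRight v).comp (fderiv ℝ φ x) :
        V →ₗ[ℝ] V) = (LinearMap.transvection (fderiv ℝ ζ (φ x) : V →ₗ[ℝ] ℝ) v).comp
          (fderiv ℝ φ x : V →ₗ[ℝ] V) := by
      ext y
      simp [LinearMap.transvection.apply]
    rw [this, LinearMap.det_comp, LinearMap.transvection.det]
    simp only [ContinuousLinearMap.coe_coe]
    ring
  · rw [indicator_of_notMem (interior_subset hx)]
    have heq : (fun x => φ x + w x • v) =ᶠ[𝓝 x] φ := by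
      filter_upwards [isOpen_interior.mem_nhds hx] with y hy
      have : y ∉ R := interior_subset hy
      simp only [hw, indicator_of_notMem this, zero_smul, add_zero]
    rw [heq.fderiv_eq, sub_self]

lemma hasFDerivAt_setIntegral_det_mul_bump {φ : V → V} {K : ℝ≥0} {B ε : ℝ}
    (hφ : LipschitzWith K φ) (hB : ∀ x, B < ‖x‖ → φ x = x) (hε : ε ≤ 1) {R : Set V}
    (hRm : MeasurableSet R) (hR : volume (frontier R) = 0) {η : V → ℝ} (hη : ContDiff ℝ 1 η)
    (hηε : ∀ z, ε ≤ ‖z‖ → η z = 0) {y : V} (hy : ∀ x ∈ frontier R, ε ≤ ‖φ x - y‖) :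
    HasFDerivAt (fun y => ∫ x in R, (fderiv ℝ φ x).det * η (φ x - y)) (0 : V →L[ℝ] ℝ) y := by
  have hηc : HasCompactSupport η := HasCompactSupport.intro (isCompact_closedBall 0 1)
    fun z hz => hηε z (by
      rw [mem_closedBall, dist_zero_right, not_le] at hz
      exact hε.trans hz.le)
  obtain ⟨L, hL⟩ := hη.lipschitzWith_of_hasCompactSupport hηc one_ne_zero
  obtain ⟨C, hC⟩ := exists_abs_det_fderiv_le hφ
  have hC0 : 0 ≤ C := (abs_nonneg _).trans (hC 0)
  have hφc := hφ.continuous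
  have hη' : Continuous (fderiv ℝ η) := hη.continuous_fderiv one_ne_zero
  obtain ⟨M, hM⟩ := hη.continuous.bounded_above_of_compact_support hηc
  set B' := max B (‖y‖ + 2) with hB'
  have hfar : ∀ y' ∈ ball y 1, ∀ x, B' < ‖x‖ → ε < ‖φ x - y'‖ := by
    intro y' hy' x hx
    have h1 := (le_max_left B (‖y‖ + 2)).trans_lt hx
    have h2 := (le_max_right B (‖y‖ + 2)).trans_lt hx
    rw [hB x h1]
    have h3 := norm_sub_norm_le x y'
    have h4 := norm_sub_norm_le y' y
    rw [mem_ball, dist_eq_norm] at hy'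
    linarith
  have hfd0 : ∀ z, ε < ‖z‖ → fderiv ℝ η z = 0 := by
    intro z hz
    have : η =ᶠ[𝓝 z] fun _ => 0 := by
      filter_upwards [(isOpen_lt continuous_const continuous_norm).mem_nhds hz] with a ha
      exact hηε a (le_of_lt ha)
    rw [this.fderiv_eq, fderiv_fun_const]
    rfl
  have hmeas : Measurable fun x => (fderiv ℝ φ x).det := measurable_det_fderiv φ
  set F' : V → V → V →L[ℝ] ℝ := fun y x => (fderiv ℝ φ x).det • (-fderiv ℝ η (φ x - y)) with hF'
  have hbound : ∀ x, ∀ y' ∈ ball y 1,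
      ‖F' y' x‖ ≤ (closedBall (0 : V) B').indicator (fun _ => C * L) x := by
    intro x y' hy'
    by_cases hx : x ∈ closedBall (0 : V) B'
    · rw [indicator_of_mem hx, hF', norm_smul, norm_neg]
      exact mul_le_mul (hC x) (norm_fderiv_le_of_lipschitz ℝ hL) (norm_nonneg _) hC0
    · rw [indicator_of_notMem hx]
      rw [mem_closedBall, dist_zero_right, not_le] at hx
      simp only [hF', hfd0 _ (hfar y' hy' x hx), neg_zero, smul_zero, norm_zero, le_refl]
  have hbi : Integrable ((closedBall (0 : V) B').indicator (fun _ => C * (L : ℝ)))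
      (volume.restrict R) := by
    rw [integrable_indicator_iff measurableSet_closedBall]
    refine integrableOn_const (ne_top_of_le_ne_top ?_ (Measure.restrict_apply_le _ _))
    exact (isCompact_closedBall _ _).measure_lt_top.ne
  have hF'm : AEStronglyMeasurable (F' y) (volume.restrict R) :=
    (hmeas.smul ((hη'.comp (hφc.sub continuous_const)).neg.measurable)).aestronglyMeasurable
  have hF'i : Integrable (F' y) (volume.restrict R) :=
    hbi.mono' hF'm (Eventually.of_forall fun x => hbound x y (mem_ball_self one_pos))
  have hFi : Integrable (fun x => (fderiv ℝ φ x).det * η (φ x - y)) := by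
    refine integrable_of_abs_le_of_eq_zero (R := B') (C := C * M)
      (hmeas.mul (hη.continuous.comp (hφc.sub continuous_const)).measurable).aestronglyMeasurable
      (fun x => ?_) (fun x hx => ?_) (isCompact_closedBall _ _).measure_lt_top.ne
    · rw [abs_mul]
      exact mul_le_mul (hC x) (hM _) (abs_nonneg _) hC0
    · rw [hηε _ (hfar y (mem_ball_self one_pos) x hx).le, mul_zero]
  have key := hasFDerivAt_integral_of_dominated_of_fderiv_le (𝕜 := ℝ)
    (μ := volume.restrict R) (F := fun y x => (fderiv ℝ φ x).det * η (φ x - y)) (F' := F')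
    (x₀ := y) (ball_mem_nhds y one_pos)
    (Eventually.of_forall fun y' => (hmeas.mul
      (hη.continuous.comp (hφc.sub continuous_const)).measurable).aestronglyMeasurable)
    hFi.integrableOn hF'm (Eventually.of_forall hbound) hbi
    (Eventually.of_forall fun x y' _ => by
      have h1 : HasFDerivAt (fun y' => φ x - y') (-ContinuousLinearMap.id ℝ V) y' :=
        (hasFDerivAt_id y').const_sub (φ x)
      have h2 := ((hη.differentiable one_ne_zero (φ x - y')).hasFDerivAt.comp y' h1).const_mul
        (fderiv ℝ φ x).det
      refine h2.congr_fderiv ?_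
      ext v
      simp [hF'])
  refine key.congr_fderiv ?_
  ext v
  rw [ContinuousLinearMap.integral_apply hF'i]
  have hb := setIntegral_fderiv_mul_det_eq_zero (B := B') (L := L) hφ
    (fun x hx => hB x ((le_max_left _ _).trans_lt hx)) hRm hR
    (ζ := fun z => η (z - y))
    (fun z => (hη.differentiable one_ne_zero (z - y)).comp z
      (differentiableAt_id.sub_const y))
    (LipschitzWith.of_dist_le_mul fun a b => by
      simpa using hL.dist_le_mul (a - y) (b - y))
    (fun x hx => hηε _ (by
      have h2 := (le_max_right B (‖y‖ + 2)).trans_lt hx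
      have := norm_sub_norm_le x y
      linarith))
    (fun x hx => hηε _ (hy x hx)) v
  simp only [fderiv_comp_sub] at hb
  rw [zero_apply]
  rw [← neg_eq_zero, ← integral_neg, ← hb]
  refine integral_congr_ae (Eventually.of_forall fun x => ?_)
  simp [hF', mul_comm]

lemma not_joinedIn_compl {φ : V → V} {K : ℝ≥0} {B : ℝ} (hφ : LipschitzWith K φ)
    (hB : ∀ x, B < ‖x‖ → φ x = x) (hB' : ∀ x, ‖x‖ ≤ B → ‖φ x‖ ≤ B) {R E : Set V}
    (hRm : MeasurableSet R) (hR : volume (frontier R) = 0) (hE : IsClosed E)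
    (hRE : ∀ x ∈ frontier R, φ x ∈ E) {y₀ y₁ : V} (h0 : y₀ ∈ interior R) (h0B : B + 1 < ‖y₀‖)
    (h1 : y₁ ∉ R) (h1B : B + 1 < ‖y₁‖) : ¬ JoinedIn Eᶜ y₀ y₁ := by
  intro hj
  set γ := hj.somePath with hγ
  have hγE : Disjoint (range γ) E := by
    rw [disjoint_left]
    rintro _ ⟨t, rfl⟩
    exact hj.somePath_mem t
  obtain ⟨ε', hε', hd⟩ := hγE.exists_cthickenings (isCompact_range γ.continuous) hE
  set ε := min ε' 1 with hε
  have hε0 : 0 < ε := lt_min hε' one_pos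
  have hε1 : ε ≤ 1 := min_le_right _ _
  set U : Set V := (cthickening ε E)ᶜ with hU
  have hUo : IsOpen U := isClosed_cthickening.isOpen_compl
  have hγU : range γ ⊆ U := by
    intro z hz hz'
    exact disjoint_left.1 hd (self_subset_cthickening _ hz)
      (cthickening_mono (min_le_left _ _) _ hz')
  have hUd : ∀ y ∈ U, ∀ z ∈ E, ε ≤ ‖z - y‖ := by
    intro y hy z hz
    by_contra! hlt
    refine hy (mem_cthickening_of_dist_le y z ε E hz ?_)
    rw [dist_comm, dist_eq_norm]
    exact hlt.le
  let η : ContDiffBump (0 : V) := ⟨ε / 2, ε, by positivity, by linarith⟩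
  have hηε : ∀ z, ε ≤ ‖z‖ → η z = 0 := by
    intro z hz
    refine η.zero_of_le_dist ?_
    rw [dist_zero_right]
    exact hz
  have hηpos : ∀ z, ‖z‖ < ε → 0 < η z := by
    intro z hz
    refine η.pos_of_mem_ball ?_
    rw [mem_ball, dist_zero_right]
    exact hz
  set D : V → ℝ := fun y => ∫ x in R, (fderiv ℝ φ x).det * η (φ x - y) with hD
  have hfd : ∀ y ∈ U, HasFDerivAt D (0 : V →L[ℝ] ℝ) y := fun y hy =>
    hasFDerivAt_setIntegral_det_mul_bump hφ hB hε1 hRm hR η.contDiff hηε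
      fun x hx => hUd y hy _ (hRE x hx)
  have hy₀ : y₀ ∈ range γ := ⟨0, γ.source⟩
  have hy₁ : y₁ ∈ range γ := ⟨1, γ.target⟩
  have hsub := (isPreconnected_range γ.continuous).subset_connectedComponentIn hy₀ hγU
  have hUsub := connectedComponentIn_subset U y₀
  have hDeq : D y₀ = D y₁ := by
    refine hUo.connectedComponentIn.is_const_of_fderiv_eq_zero (𝕜 := ℝ)
      isPreconnected_connectedComponentIn
      (fun y hy => (hfd y (hUsub hy)).differentiableAt.differentiableWithinAt)
      (fun y hy => (hfd y (hUsub hy)).fderiv) (hsub hy₀) (hsub hy₁)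
  have hnear : ∀ y, B + 1 < ‖y‖ → ∀ x, ‖φ x - y‖ < ε → B < ‖x‖ := by
    intro y hy x hx
    by_contra! hxB
    have := hB' x hxB
    have h3 := norm_sub_norm_le y (φ x)
    rw [norm_sub_rev] at h3
    linarith
  have hD1 : D y₁ = 0 := by
    refine setIntegral_eq_zero_of_forall_eq_zero fun x hx => ?_
    rw [hηε, mul_zero]
    by_contra! hlt
    have hxB := hnear y₁ h1B x hlt
    rw [hB x hxB] at hlt
    obtain ⟨z, hz, hzy, -⟩ := exists_mem_frontier_of_segment hx h1
    have h4 : ‖z - y₁‖ < ε := by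
      rw [← dist_eq_norm] at hlt ⊢
      exact hzy.trans_lt hlt
    have hzB : B < ‖z‖ := by
      have h3 := norm_sub_norm_le y₁ z
      rw [norm_sub_rev] at h3
      linarith
    have h5 := hRE z hz
    rw [hB z hzB] at h5
    exact absurd h4 (not_lt.2 (hUd y₁ (hγU hy₁) z h5))
  have hdet : ∀ x, B < ‖x‖ → (fderiv ℝ φ x).det = 1 := by
    intro x hx
    have : φ =ᶠ[𝓝 x] id := by
      filter_upwards [(isOpen_lt continuous_const continuous_norm).mem_nhds hx] with a ha
      exact hB a ha
    rw [this.fderiv_eq, fderiv_id, ContinuousLinearMap.det]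
    exact LinearMap.det_id
  have hD0 : D y₀ = ∫ x in R, η (x - y₀) := by
    refine integral_congr_ae (Eventually.of_forall fun x => ?_)
    by_cases hx : B < ‖x‖
    · simp only [hdet x hx, hB x hx, one_mul]
    · have h6 : ε ≤ ‖φ x - y₀‖ := by
        by_contra! hlt
        exact hx (hnear y₀ h0B x hlt)
      have h7 : ε ≤ ‖x - y₀‖ := by
        have h3 := norm_sub_norm_le y₀ x
        rw [norm_sub_rev] at h3
        linarith
      simp only [hηε _ h6, hηε _ h7, mul_zero]
  have hInt : Integrable (fun x => η (x - y₀)) :=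
    (η.continuous.integrable_of_hasCompactSupport η.hasCompactSupport).comp_sub_right y₀
  have hpos : 0 < D y₀ := by
    rw [hD0, setIntegral_pos_iff_support_of_nonneg_ae
      (Eventually.of_forall fun x => η.nonneg) hInt.integrableOn]
    refine ((isOpen_ball.inter isOpen_interior).measure_pos volume
      ⟨y₀, mem_ball_self hε0, h0⟩).trans_le (measure_mono ?_)
    rintro x ⟨hx, hxR⟩
    refine ⟨(hηpos _ ?_).ne', interior_subset hxR⟩
    rwa [mem_ball, dist_eq_norm] at hx
  rw [hDeq, hD1] at hpos
  exact lt_irrefl _ hpos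

end Separation

section Labels

open Module MeasureTheory.Measure Filter Topology
open scoped ENNReal RealInnerProductSpace

variable {V : Type*} [NormedAddCommGroup V] [InnerProductSpace ℝ V] [FiniteDimensional ℝ V]
  [MeasurableSpace V] [BorelSpace V]

lemma exists_label {ι : Type*} [Finite ι] [Nonempty ι] {φ : V → V} {K : ℝ≥0} {B : ℝ}
    (hφ : LipschitzWith K φ) (hB : ∀ x, B < ‖x‖ → φ x = x) (hB' : ∀ x, ‖x‖ ≤ B → ‖φ x‖ ≤ B)
    {R : ι → Set V} {E : Set V} (hRc : ∀ k, IsClosed (R k)) (hR : ∀ k, volume (frontier (R k)) = 0)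
    (hE : IsClosed E) (hRE : ∀ k, ∀ x ∈ frontier (R k), φ x ∈ E)
    (hdisj : ∀ k l, k ≠ l → ∀ x ∈ interior (R l), x ∉ R k) :
    ∃ lab : V → ι, (∀ k, MeasurableSet (lab ⁻¹' {k})) ∧
      (∀ x y, (∀ s ∈ Icc (0:ℝ) 1, x + s • (y - x) ∉ E) → lab x = lab y) ∧
      ∀ k, ∀ x ∈ interior (R k), B + 1 < ‖x‖ → x ∉ E → lab x = k := by
  classical
  set P : ι → V → Prop := fun k y => ∃ z ∈ interior (R k), B + 1 < ‖z‖ ∧ JoinedIn Eᶜ z y with hP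
  have huniq : ∀ k l y, P k y → P l y → k = l := by
    rintro k l y ⟨z, hz, hzB, hzj⟩ ⟨w, hw, hwB, hwj⟩
    by_contra hkl
    exact not_joinedIn_compl hφ hB hB' (hRc k).measurableSet (hR k) hE (hRE k) hz hzB
      (hdisj k l hkl w hw) hwB (hzj.trans hwj.symm)
  obtain ⟨k₀⟩ := ‹Nonempty ι›
  set sel : (ι → Prop) → ι := fun p => if h : ∃ k, p k then h.choose else k₀ with hsel
  set lab : V → ι := fun y => sel fun k => P k y with hlabdef
  have hlabP : ∀ k y, P k y → lab y = k := by
    intro k y hk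
    have h : ∃ k, P k y := ⟨k, hk⟩
    simp only [hlabdef, hsel, dif_pos h]
    exact huniq _ _ y h.choose_spec hk
  have hPlab : ∀ k y, k ≠ k₀ → lab y = k → P k y := by
    intro k y hk hl
    by_cases h : ∃ k, P k y
    · obtain ⟨l, hl'⟩ := h
      rwa [← hl, hlabP l y hl']
    · simp only [hlabdef, hsel, dif_neg h] at hl
      exact absurd hl.symm hk
  have hPopen : ∀ k, IsOpen {y | P k y} := by
    intro k
    have : {y | P k y} = ⋃ z ∈ interior (R k) ∩ {z | B + 1 < ‖z‖}, pathComponentIn Eᶜ z := by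
      ext y
      simp only [hP, mem_ofPred_eq, mem_iUnion, exists_prop, mem_inter_iff, and_assoc]
      rfl
    rw [this]
    exact isOpen_biUnion fun z _ => hE.isOpen_compl.pathComponentIn z
  have hpre : ∀ k, k ≠ k₀ → lab ⁻¹' {k} = {y | P k y} := fun k hk =>
    Subset.antisymm (fun y hy => hPlab k y hk hy) fun y hy => hlabP k y hy
  refine ⟨lab, fun k => ?_, fun x y hxy => ?_, fun k x hx hxB hxE => ?_⟩
  · by_cases hk : k = k₀
    · have : lab ⁻¹' {k} = (⋃ l ∈ {l | l ≠ k₀}, lab ⁻¹' {l})ᶜ := by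
        ext y
        have : lab y = k₀ ↔ ∀ l, l ≠ k₀ → lab y ≠ l :=
          ⟨fun h l hl h' => hl (h' ▸ h), fun h => by_contra fun h' => h _ h' rfl⟩
        simpa [hk] using this
      rw [this]
      refine (MeasurableSet.biUnion (Set.to_countable _) fun l hl => ?_).compl
      rw [hpre l hl]
      exact (hPopen l).measurableSet
    · rw [hpre k hk]
      exact (hPopen k).measurableSet
  · have hj : JoinedIn Eᶜ x y := by
      refine JoinedIn.ofLine (f := fun s => x + s • (y - x)) (by fun_prop) (by simp) (by simp) ?_
      rintro _ ⟨s, hs, rfl⟩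
      exact hxy s hs
    have : (fun k => P k x) = fun k => P k y := by
      ext k
      exact ⟨fun ⟨z, h1, h2, h3⟩ => ⟨z, h1, h2, h3.trans hj⟩,
        fun ⟨z, h1, h2, h3⟩ => ⟨z, h1, h2, h3.trans hj.symm⟩⟩
    simp only [hlabdef, this]
  · exact hlabP k x ⟨x, hx, hxB, JoinedIn.refl hxE⟩

end Labels

section Profile

/-- The odd `C¹` function on `[-1, 1]` with derivative `profileDeriv` and value `1` at `1`. -/
noncomputable def profile (t : ℝ) : ℝ := (15 * t - 6 * (t * |t|) - t ^ 3) / 8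

/-- The derivative of `profile`. -/
noncomputable def profileDeriv (t : ℝ) : ℝ := 3 / 8 * (1 - |t|) * (5 + |t|)

lemma profile_vertex_nonneg {p q : ℝ} (hp : 0 ≤ p) (hpq : p ≤ q) (hq : q ≤ 1) :
    let H : ℝ → ℝ := fun t => (15 * t - 6 * t ^ 2 - t ^ 3) / 8
    let D : ℝ := 3 / 8 * (1 - p) * (5 + p) - 3 / 8 * (1 - q) * (5 + q)
    0 ≤ 2 - H p - H q ∧ 0 ≤ 2 - H p - H q + 1 / 3 * D * (p - q) ∧
    0 ≤ 2 - H p - H q + 21 / 100 * (2 - (H p) ^ 2 - (H q) ^ 2 - 1 / 9 * D ^ 2) ∧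
    0 ≤ 2 - H p - H q + 1 / 3 * D * (p - q) + 21 / 100 * (2 - (H p - 1 / 3 * D * p) ^ 2 -
      (H q + 1 / 3 * D * q) ^ 2 - 2 / 9 * D ^ 2) := by
  intro H D
  obtain ⟨y, hy⟩ : ∃ y, y = 1 - q := ⟨_, rfl⟩
  obtain ⟨z, hz⟩ : ∃ z, z = q - p := ⟨_, rfl⟩
  have hy0 : 0 ≤ y := by linarith
  have hz0 : 0 ≤ z := by linarith
  obtain ⟨w, hw⟩ : ∃ w, w = 1 - y - z := ⟨_, rfl⟩
  have hw0 : 0 ≤ w := by linarith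
  have hp' : p = 1 - y - z := by linarith
  have hq' : q = 1 - y := by linarith
  simp only [H, D]
  clear_value H D
  rw [hp', hq']
  clear hp hpq hq hy hz hp' hq'
  refine ⟨?_, ?_, ?_, ?_⟩
  · have : 0 ≤ 2 * y^3 + 33/8 * y^2 * z + 9/4 * y^2 * w + 3 * y * z^2 + 9/4 * y * z * w + z^3 + 9/8 * z^2 * w := by
      positivity
    rw [hw] at this
    linarith
  · have : 0 ≤ 2 * y^3 + 33/8 * y^2 * z + 9/4 * y^2 * w + 5/2 * y * z^2 + 9/4 * y * z * w + 3/8 * z^3 +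
        3/8 * z^2 * w := by
      positivity
    rw [hw] at this
    linarith
  · have : 0 ≤ 121/50 * y^6 + 2529/200 * y^5 * z + 1077/100 * y^5 * w + 172059/6400 * y^4 * z^2 +
        28479/640 * y^4 * z * w + 11247/640 * y^4 * w^2 + 24141/800 * y^3 * z^3 +
        2889/40 * y^3 * z^2 * w + 17211/320 * y^3 * z * w^2 + 497/40 * y^3 * w^3 +
        123843/6400 * y^2 * z^4 + 94977/1600 * y^2 * z^3 * w + 197823/3200 * y^2 * z^2 * w^2 +
        10011/400 * y^2 * z * w^3 + 639/200 * y^2 * w^4 + 22287/3200 * y * z^5 +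
        83031/3200 * y * z^4 * w + 54513/1600 * y * z^3 * w^2 + 2919/160 * y * z^2 * w^3 +
        639/200 * y * z * w^4 + 7219/6400 * z^6 + 16077/3200 * z^5 * w + 26217/3200 * z^4 * w^2 +
        9247/1600 * z^3 * w^3 + 2367/1600 * z^2 * w^4 := by
      positivity
    rw [hw] at this
    linarith
  · have : 0 ≤ 121/50 * y^6 + 2529/200 * y^5 * z + 1077/100 * y^5 * w + 168523/6400 * y^4 * z^2 +
        28479/640 * y^4 * z * w + 11247/640 * y^4 * w^2 + 21937/800 * y^3 * z^3 +
        2757/40 * y^3 * z^2 * w + 17211/320 * y^3 * z * w^2 + 497/40 * y^3 * w^3 +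
        11523/800 * y^2 * z^4 + 38229/800 * y^2 * z^3 * w + 7065/128 * y^2 * z^2 * w^2 +
        10011/400 * y^2 * z * w^3 + 639/200 * y^2 * w^4 + 1013/320 * y * z^5 + 20643/1600 * y * z^4 * w +
        1557/80 * y * z^3 * w^2 + 10337/800 * y * z^2 * w^3 + 639/200 * y * z * w^4 + 489/6400 * z^6 +
        999/3200 * z^5 * w + 2913/6400 * z^4 * w^2 + 447/1600 * z^3 * w^3 + 3/50 * z^2 * w^4 := by
      positivity
    rw [hw] at this
    linarith

lemma profile_form_nonneg {p q κ ε : ℝ} (hp : 0 ≤ p) (hpq : p ≤ q) (hq : q ≤ 1) (hκ : 0 ≤ κ)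
    (hκ' : κ ≤ 21 / 100) (hε : 0 ≤ ε) (hε' : ε ≤ 1 / 3) :
    0 ≤ 2 - profile p - profile q + ε * (profileDeriv p - profileDeriv q) * (p - q) +
      κ * (2 - (profile p - ε * (profileDeriv p - profileDeriv q) * p) ^ 2 -
        (profile q + ε * (profileDeriv p - profileDeriv q) * q) ^ 2 -
        (ε - ε ^ 2) * (profileDeriv p - profileDeriv q) ^ 2) := by
  obtain ⟨h1, h2, h3, h4⟩ := profile_vertex_nonneg hp hpq hq
  have hHp : profile p = (15 * p - 6 * p ^ 2 - p ^ 3) / 8 := by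
    rw [profile, abs_of_nonneg hp]; ring
  have hHq : profile q = (15 * q - 6 * q ^ 2 - q ^ 3) / 8 := by
    rw [profile, abs_of_nonneg (hp.trans hpq)]; ring
  have hD : profileDeriv p - profileDeriv q =
      3 / 8 * (1 - p) * (5 + p) - 3 / 8 * (1 - q) * (5 + q) := by
    rw [profileDeriv, profileDeriv, abs_of_nonneg hp, abs_of_nonneg (hp.trans hpq)]
  dsimp only at h1 h2 h3 h4
  rw [← hHp, ← hHq] at h1 h2 h3 h4
  rw [← hD] at h2 h3 h4
  generalize profile p = P at *
  generalize profile q = Q at *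
  generalize profileDeriv p - profileDeriv q = D at *
  have e1 : 0 ≤ 1 - 3 * ε := by linarith
  have k1 : 0 ≤ 21 / 100 - κ := by linarith
  have hA := add_nonneg (mul_nonneg e1 h1) (mul_nonneg (mul_nonneg zero_le_three hε) h2)
  have hB := add_nonneg (mul_nonneg e1 h3) (mul_nonneg (mul_nonneg zero_le_three hε) h4)
  have hC : 0 ≤ κ * ((p ^ 2 + q ^ 2) * D ^ 2 * (ε * (1 / 3 - ε))) :=
    mul_nonneg hκ (mul_nonneg (by positivity) (mul_nonneg hε (by linarith)))
  have hE : 0 ≤ κ * ((ε - 1 / 3) ^ 2 * D ^ 2) := by positivity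
  have hF := add_nonneg (mul_nonneg k1 hA) (mul_nonneg hκ hB)
  linarith

lemma profile_abs_sq_add_le {p q κ ε : ℝ} (hp : 0 ≤ p) (hp1 : p ≤ 1) (hq : 0 ≤ q) (hq1 : q ≤ 1)
    (hκ : 0 ≤ κ) (hκ' : κ ^ 2 + κ = 1 / 4) (hε : 0 ≤ ε) (hε' : ε ≤ 1 / 3) :
    (1 / 2 + κ * (profile p - ε * (profileDeriv p - profileDeriv q) * p)) ^ 2 +
      (1 / 2 + κ * (profile q + ε * (profileDeriv p - profileDeriv q) * q)) ^ 2 +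
      (ε - ε ^ 2) * (κ * (profileDeriv p - profileDeriv q)) ^ 2 ≤ 1 := by
  wlog hpq : p ≤ q generalizing p q
  · have := this hq hq1 hp hp1 (le_of_not_ge hpq)
    linarith
  have hκ1 : κ ≤ 21 / 100 := by nlinarith
  have h := mul_nonneg hκ (profile_form_nonneg hp hpq hq1 hκ hκ1 hε hε')
  generalize profile p = P at *
  generalize profile q = Q at *
  generalize profileDeriv p - profileDeriv q = D at *
  linarith

lemma mul_profileDeriv_le_profile {p : ℝ} (hp : 0 ≤ p) :
    p * profileDeriv p ≤ profile p := by
  rw [profile, profileDeriv, abs_of_nonneg hp]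
  have : 0 ≤ p ^ 2 * (3 + p) := by positivity
  linarith

lemma profileDeriv_nonneg {p : ℝ} (hp1 : |p| ≤ 1) : 0 ≤ profileDeriv p := by
  rw [profileDeriv]
  have := abs_nonneg p
  exact mul_nonneg (by linarith) (by linarith)

lemma profileDeriv_abs (p : ℝ) : profileDeriv |p| = profileDeriv p := by
  rw [profileDeriv, profileDeriv, abs_abs]

lemma profile_neg (p : ℝ) : profile (-p) = -profile p := by
  rw [profile, profile, abs_neg]; ring

lemma profile_sq_add_le {p q κ ε : ℝ} (hp : |p| ≤ 1) (hq : |q| ≤ 1)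
    (hκ : 0 ≤ κ) (hκ' : κ ^ 2 + κ = 1 / 4) (hε : 0 ≤ ε) (hε' : ε ≤ 1 / 3) :
    (1 / 2 + κ * (profile p - ε * (profileDeriv p - profileDeriv q) * p)) ^ 2 +
      (1 / 2 + κ * (profile q + ε * (profileDeriv p - profileDeriv q) * q)) ^ 2 +
      (ε - ε ^ 2) * (κ * (profileDeriv p - profileDeriv q)) ^ 2 ≤ 1 := by
  have key : ∀ p q : ℝ, |p| ≤ 1 → |q| ≤ 1 →
      (1 / 2 + κ * (profile p - ε * (profileDeriv p - profileDeriv q) * p)) ^ 2 ≤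
      (1 / 2 + κ * (profile |p| - ε * (profileDeriv |p| - profileDeriv |q|) * |p|)) ^ 2 := by
    intro p q hp hq
    rw [profileDeriv_abs, profileDeriv_abs]
    rcases abs_cases p with ⟨h1, h2⟩ | ⟨h1, h2⟩
    · rw [h1]
    · rw [h1, profile_neg]
      have h3 := mul_profileDeriv_le_profile (abs_nonneg p)
      rw [profileDeriv_abs, h1, profile_neg] at h3
      have h4 := profileDeriv_nonneg hp
      have h5 := profileDeriv_nonneg hq
      have h6 : 0 ≤ -profile p - ε * (profileDeriv p - profileDeriv q) * -p := by
        have h7 : 0 ≤ (1 - ε) * (-p * profileDeriv p) :=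
          mul_nonneg (by linarith) (mul_nonneg (by linarith) h4)
        have h8 : 0 ≤ ε * (profileDeriv q * -p) :=
          mul_nonneg hε (mul_nonneg h5 (by linarith))
        linarith
      have h9 := mul_nonneg hκ h6
      nlinarith
  have h1 := key p q hp hq
  have h2 := key q p hq hp
  have h3 := profile_abs_sq_add_le (abs_nonneg p) hp (abs_nonneg q) hq hκ hκ' hε hε'
  rw [profileDeriv_abs, profileDeriv_abs] at h1 h2 h3
  have e : ∀ x y : ℝ, 1 / 2 + κ * (x - ε * (profileDeriv q - profileDeriv p) * y) =
    1 / 2 + κ * (x + ε * (profileDeriv p - profileDeriv q) * y) := fun x y => by ring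
  rw [e, e] at h2
  linarith

end Profile

section BoundedLipschitz

/-- A bounded Lipschitz real function. -/
def BoundedLipschitz {X : Type*} [PseudoMetricSpace X] (f : X → ℝ) : Prop :=
  (∃ K : ℝ≥0, LipschitzWith K f) ∧ ∃ M : ℝ, ∀ x, |f x| ≤ M

namespace BoundedLipschitz

variable {X : Type*} [PseudoMetricSpace X] {f g : X → ℝ}

lemma const (c : ℝ) : BoundedLipschitz fun _ : X => c :=
  ⟨⟨0, LipschitzWith.const c⟩, |c|, fun _ => le_rfl⟩

lemma add (hf : BoundedLipschitz f) (hg : BoundedLipschitz g) :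
    BoundedLipschitz fun x => f x + g x := by
  obtain ⟨⟨K, hK⟩, M, hM⟩ := hf
  obtain ⟨⟨L, hL⟩, N, hN⟩ := hg
  exact ⟨⟨_, hK.add hL⟩, M + N, fun x => (abs_add_le _ _).trans (add_le_add (hM x) (hN x))⟩

lemma mul (hf : BoundedLipschitz f) (hg : BoundedLipschitz g) :
    BoundedLipschitz fun x => f x * g x := by
  obtain ⟨⟨K, hK⟩, M, hM⟩ := hf
  obtain ⟨⟨L, hL⟩, N, hN⟩ := hg
  refine ⟨⟨M.toNNReal * L + N.toNNReal * K, LipschitzWith.of_dist_le_mul fun x y => ?_⟩,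
    M.toNNReal * N, fun x => ?_⟩
  · have h1 := hK.dist_le_mul x y
    have h2 := hL.dist_le_mul x y
    rw [Real.dist_eq] at h1 h2 ⊢
    have h3 : f x * g x - f y * g y = f x * (g x - g y) + g y * (f x - f y) := by ring
    rw [h3]
    push_cast
    calc |f x * (g x - g y) + g y * (f x - f y)|
        ≤ |f x| * |g x - g y| + |g y| * |f x - f y| := by
          rw [← abs_mul, ← abs_mul]; exact abs_add_le _ _
      _ ≤ M.toNNReal * (L * dist x y) + N.toNNReal * (K * dist x y) := by
          have h4 := (hM x).trans (Real.le_coe_toNNReal M)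
          have h5 := (hN y).trans (Real.le_coe_toNNReal N)
          gcongr
      _ = _ := by ring
  · rw [abs_mul]
    exact mul_le_mul ((hM x).trans (Real.le_coe_toNNReal M)) (hN x) (abs_nonneg _)
      (NNReal.coe_nonneg _)

lemma abs (hf : BoundedLipschitz f) : BoundedLipschitz fun x => |f x| := by
  obtain ⟨⟨K, hK⟩, M, hM⟩ := hf
  refine ⟨⟨K, LipschitzWith.of_dist_le_mul fun x y => ?_⟩, M, fun x => by
    rw [abs_abs]; exact hM x⟩
  have h1 := hK.dist_le_mul x y
  rw [Real.dist_eq] at h1 ⊢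
  exact (abs_abs_sub_abs_le _ _).trans h1

lemma sub (hf : BoundedLipschitz f) (hg : BoundedLipschitz g) :
    BoundedLipschitz fun x => f x - g x := by
  have := hf.add ((const (-1)).mul hg)
  simpa [sub_eq_add_neg] using this

lemma profile (hf : BoundedLipschitz f) : BoundedLipschitz fun x => profile (f x) := by
  have := (const (1 / 8)).mul ((((const 15).mul hf).sub ((const 6).mul (hf.mul hf.abs))).sub
    (hf.mul (hf.mul hf)))
  convert this using 2 with x
  rw [_root_.profile]
  ring

lemma profileDeriv (hf : BoundedLipschitz f) : BoundedLipschitz fun x => profileDeriv (f x) := by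
  have := (const (3 / 8)).mul (((const 1).sub hf.abs).mul ((const 5).add hf.abs))
  convert this using 2 with x
  rw [_root_.profileDeriv]
  ring

end BoundedLipschitz

end BoundedLipschitz

section CubeNorm

open Module MeasureTheory.Measure Filter Topology
open scoped ENNReal RealInnerProductSpace

variable {d : ℕ}

/-- The sup norm on Euclidean space. -/
noncomputable def cubeNorm (x : EuclideanSpace ℝ (Fin d)) : ℝ := ‖WithLp.ofLp x‖

lemma cubeNorm_nonneg (x : EuclideanSpace ℝ (Fin d)) : 0 ≤ cubeNorm x := norm_nonneg _

lemma abs_apply_le_cubeNorm (x : EuclideanSpace ℝ (Fin d)) (i : Fin d) : |x i| ≤ cubeNorm x :=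
  norm_le_pi_norm (WithLp.ofLp x) i

lemma cubeNorm_le_iff {x : EuclideanSpace ℝ (Fin d)} {r : ℝ} (hr : 0 ≤ r) :
    cubeNorm x ≤ r ↔ ∀ i, |x i| ≤ r :=
  pi_norm_le_iff_of_nonneg hr

lemma exists_abs_apply_eq_cubeNorm (hd : 0 < d) (x : EuclideanSpace ℝ (Fin d)) :
    ∃ i, |x i| = cubeNorm x := by
  have : Nonempty (Fin d) := ⟨⟨0, hd⟩⟩
  obtain ⟨i, hi⟩ := Finite.exists_max fun i => |x i|
  exact ⟨i, le_antisymm (abs_apply_le_cubeNorm x i)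
    ((cubeNorm_le_iff (abs_nonneg _)).2 hi)⟩

lemma lipschitzWith_cubeNorm : LipschitzWith 1 (cubeNorm (d := d)) := by
  have := (lipschitzWith_one_norm (E := Fin d → ℝ)).comp (PiLp.lipschitzWith_ofLp 2 fun _ => ℝ)
  rw [mul_one] at this
  exact this

lemma cubeNorm_smul (c : ℝ) (x : EuclideanSpace ℝ (Fin d)) :
    cubeNorm (c • x) = |c| * cubeNorm x := by
  rw [cubeNorm, WithLp.ofLp_smul, norm_smul, Real.norm_eq_abs, cubeNorm]

lemma cubeNorm_le_norm (x : EuclideanSpace ℝ (Fin d)) : cubeNorm x ≤ ‖x‖ :=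
  (cubeNorm_le_iff (norm_nonneg x)).2 fun i => PiLp.norm_apply_le x i

lemma norm_le_sqrt_mul_cubeNorm (x : EuclideanSpace ℝ (Fin d)) : ‖x‖ ≤ √d * cubeNorm x := by
  rw [EuclideanSpace.norm_eq, ← Real.sqrt_sq (cubeNorm_nonneg x), ← Real.sqrt_mul d.cast_nonneg]
  refine Real.sqrt_le_sqrt ?_
  calc ∑ i, ‖x i‖ ^ 2 ≤ ∑ _i : Fin d, cubeNorm x ^ 2 := by
        refine Finset.sum_le_sum fun i _ => ?_
        have := abs_apply_le_cubeNorm x i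
        rw [Real.norm_eq_abs]
        gcongr
    _ = d * cubeNorm x ^ 2 := by simp

lemma volume_cubeNorm_lt {r : ℝ} (hr : 0 < r) :
    volume {x : EuclideanSpace ℝ (Fin d) | cubeNorm x < r} = ENNReal.ofReal ((2 * r) ^ d) := by
  have h1 : {x : EuclideanSpace ℝ (Fin d) | cubeNorm x < r} =
      WithLp.ofLp ⁻¹' ball (0 : Fin d → ℝ) r := by
    ext x; simp [cubeNorm]
  rw [h1, (PiLp.volume_preserving_ofLp (Fin d)).measure_preimage
    measurableSet_ball.nullMeasurableSet, Real.volume_pi_ball _ hr, Fintype.card_fin]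

lemma ae_cubeNorm_ne (hd : 0 < d) (r : ℝ) :
    ∀ᵐ x : EuclideanSpace ℝ (Fin d), cubeNorm x ≠ r := by
  have : Nonempty (Fin d) := ⟨⟨0, hd⟩⟩
  have h1 : {x : EuclideanSpace ℝ (Fin d) | cubeNorm x = r} =
      WithLp.ofLp ⁻¹' sphere (0 : Fin d → ℝ) r := by
    ext x; simp [cubeNorm]
  rw [ae_iff]
  simp only [ne_eq, not_not]
  rw [h1, (PiLp.volume_preserving_ofLp (Fin d)).measure_preimage
    isClosed_sphere.measurableSet.nullMeasurableSet, Measure.addHaar_sphere]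

/-- Almost every point has nonzero coordinates with distinct absolute values. -/
lemma ae_generic : ∀ᵐ x : EuclideanSpace ℝ (Fin d),
    (∀ i, x i ≠ 0) ∧ ∀ i j, i ≠ j → |x i| ≠ |x j| := by
  have key : ∀ f : EuclideanSpace ℝ (Fin d) →ₗ[ℝ] ℝ, f ≠ 0 → ∀ᵐ x, f x ≠ 0 := by
    intro f hf
    rw [ae_iff]
    simp only [ne_eq, not_not]
    exact Measure.addHaar_submodule volume (LinearMap.ker f) fun h => hf (LinearMap.ker_eq_top.1 h)
  let π : Fin d → EuclideanSpace ℝ (Fin d) →ₗ[ℝ] ℝ := fun i =>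
    (EuclideanSpace.proj i : EuclideanSpace ℝ (Fin d) →L[ℝ] ℝ)
  have hπ : ∀ i x, π i x = x i := fun i x => rfl
  have h1 : ∀ i, ∀ᵐ x : EuclideanSpace ℝ (Fin d), x i ≠ 0 := fun i =>
    key (π i) fun h => by
      have := LinearMap.congr_fun h (EuclideanSpace.single i 1)
      simp [hπ] at this
  have h2 : ∀ i j, i ≠ j → ∀ᵐ x : EuclideanSpace ℝ (Fin d), |x i| ≠ |x j| := by
    intro i j hij
    have ha := key (π i - π j) fun h => by
      have := LinearMap.congr_fun h (EuclideanSpace.single i 1)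
      simp [hπ, hij.symm] at this
    have hb := key (π i + π j) fun h => by
      have := LinearMap.congr_fun h (EuclideanSpace.single i 1)
      simp [hπ, hij.symm] at this
    filter_upwards [ha, hb] with x hxa hxb hx
    rcases abs_eq_abs.1 hx with h | h
    · exact hxa (by rw [LinearMap.sub_apply, hπ, hπ, h, sub_self])
    · exact hxb (by rw [LinearMap.add_apply, hπ, hπ, h, neg_add_cancel])
  have h3 : ∀ᵐ x : EuclideanSpace ℝ (Fin d), ∀ i j, i ≠ j → |x i| ≠ |x j| := by
    rw [ae_all_iff]
    intro i
    rw [ae_all_iff]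
    intro j
    by_cases hij : i = j
    · simp [hij]
    · filter_upwards [h2 i j hij] with x hx _ using hx
  filter_upwards [ae_all_iff.2 h1, h3] with x hx hx' using ⟨hx, hx'⟩

end CubeNorm

section CubeField

open Module MeasureTheory.Measure Filter Topology
open scoped ENNReal RealInnerProductSpace

variable {d : ℕ}

/-- The sign attached to a Boolean. -/
def boolSign (b : Bool) : ℝ := if b then 1 else -1

lemma boolSign_mul_self (b : Bool) : boolSign b * boolSign b = 1 := by
  cases b <;> simp [boolSign]

lemma abs_boolSign (b : Bool) : |boolSign b| = 1 := by
  cases b <;> simp [boolSign]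

/-- The coordinates of the radial retraction onto the unit cube. -/
noncomputable def cubeCoord (x : EuclideanSpace ℝ (Fin d)) (i : Fin d) : ℝ :=
  x i / max (cubeNorm x) 1

lemma abs_cubeCoord_le (x : EuclideanSpace ℝ (Fin d)) (i : Fin d) : |cubeCoord x i| ≤ 1 := by
  have h : 0 < max (cubeNorm x) 1 := lt_max_of_lt_right one_pos
  rw [cubeCoord, abs_div, abs_of_pos h, div_le_one h]
  exact (abs_apply_le_cubeNorm x i).trans (le_max_left _ _)

lemma boundedLipschitz_cubeCoord (i : Fin d) :
    BoundedLipschitz fun x : EuclideanSpace ℝ (Fin d) => cubeCoord x i := by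
  refine ⟨⟨2, LipschitzWith.of_dist_le_mul fun x y => ?_⟩, 1, fun x => abs_cubeCoord_le x i⟩
  have hx : 1 ≤ max (cubeNorm x) 1 := le_max_right _ _
  have hr : |max (cubeNorm y) 1 - max (cubeNorm x) 1| ≤ dist x y := by
    refine (abs_max_sub_max_le_abs _ _ _).trans ?_
    have := lipschitzWith_cubeNorm.dist_le_mul y x
    rwa [NNReal.coe_one, one_mul, Real.dist_eq, dist_comm y x] at this
  have hi : |x i - y i| ≤ dist x y := by
    rw [dist_eq_norm]
    exact PiLp.norm_apply_le (x - y) i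
  have hy := abs_cubeCoord_le y i
  have hy0 : max (cubeNorm y) 1 ≠ 0 := (lt_max_of_lt_right one_pos).ne'
  have key : cubeCoord x i - cubeCoord y i = ((x i - y i) +
      cubeCoord y i * (max (cubeNorm y) 1 - max (cubeNorm x) 1)) / max (cubeNorm x) 1 := by
    have h1 : y i = cubeCoord y i * max (cubeNorm y) 1 := by
      rw [cubeCoord, div_mul_cancel₀ _ hy0]
    rw [eq_div_iff (by linarith), sub_mul, cubeCoord, div_mul_cancel₀ _ (by linarith), h1]
    ring
  rw [Real.dist_eq, key, abs_div, abs_of_pos (by linarith : 0 < max (cubeNorm x) 1)]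
  refine (div_le_self (abs_nonneg _) hx).trans ((abs_add_le _ _).trans ?_)
  rw [abs_mul]
  push_cast
  have := mul_le_mul hy hr (abs_nonneg _) zero_le_one
  linarith

/-- The constant `(√2 - 1) / 2`, the positive root of `κ ^ 2 + κ = 1 / 4`. -/
noncomputable def cubeConst : ℝ := (√2 - 1) / 2

lemma cubeConst_nonneg : 0 ≤ cubeConst := by
  have : (1 : ℝ) ≤ √2 := Real.one_le_sqrt.2 (by norm_num)
  unfold cubeConst
  linarith

lemma cubeConst_sq_add : cubeConst ^ 2 + cubeConst = 1 / 4 := by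
  have : √2 ^ 2 = (2 : ℝ) := Real.sq_sqrt (by norm_num)
  unfold cubeConst
  nlinarith

/-- The calibrating fields for the facets of the cube. -/
noncomputable def cubeField (k : Fin d × Bool) (x : EuclideanSpace ℝ (Fin d)) :
    EuclideanSpace ℝ (Fin d) :=
  WithLp.toLp 2 fun l =>
    (if l = k.1 then boolSign k.2 / 2 + cubeConst * profile (cubeCoord x k.1) else 0) -
      cubeConst / (d - 1) * profileDeriv (cubeCoord x k.1) * cubeCoord x l

lemma cubeField_apply (k : Fin d × Bool) (x : EuclideanSpace ℝ (Fin d)) (l : Fin d) :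
    cubeField k x l =
      (if l = k.1 then boolSign k.2 / 2 + cubeConst * profile (cubeCoord x k.1) else 0) -
      cubeConst / (d - 1) * profileDeriv (cubeCoord x k.1) * cubeCoord x l := rfl

lemma exists_lipschitzWith_of_apply {X : Type*} [PseudoMetricSpace X]
    {f : X → EuclideanSpace ℝ (Fin d)} (hf : ∀ l, BoundedLipschitz fun x => f x l) :
    (∃ K : ℝ≥0, LipschitzWith K f) ∧ ∃ M : ℝ, ∀ x, ‖f x‖ ≤ M := by
  choose h1 M hM using hf
  choose K hK using h1
  have hL : LipschitzWith (∑ l, K l) fun x l => f x l := by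
    refine LipschitzWith.of_dist_le_mul fun x y => ?_
    rw [dist_pi_le_iff (by positivity)]
    intro l
    refine ((hK l).dist_le_mul x y).trans ?_
    gcongr
    exact Finset.single_le_sum (fun _ _ => zero_le) (Finset.mem_univ l)
  refine ⟨⟨_, (PiLp.lipschitzWith_toLp 2 fun _ : Fin d => ℝ).comp hL⟩, √d * ∑ l, |M l|,
    fun x => ?_⟩
  refine (norm_le_sqrt_mul_cubeNorm _).trans ?_
  gcongr
  rw [cubeNorm_le_iff (by positivity)]
  exact fun l => (hM l x).trans ((le_abs_self _).trans
    (Finset.single_le_sum (f := fun l => |M l|) (fun _ _ => abs_nonneg _) (Finset.mem_univ l)))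

lemma exists_lipschitzWith_cubeField : ∃ (L : ℝ≥0) (M : ℝ), ∀ k : Fin d × Bool,
    LipschitzWith L (cubeField k) ∧ ∀ x, ‖cubeField k x‖ ≤ M := by
  have h (k : Fin d × Bool) := exists_lipschitzWith_of_apply (f := cubeField k) fun l => by
    simp only [cubeField_apply]
    refine BoundedLipschitz.sub ?_ (((BoundedLipschitz.const _).mul
      (boundedLipschitz_cubeCoord k.1).profileDeriv).mul (boundedLipschitz_cubeCoord l))
    split_ifs
    · exact (BoundedLipschitz.const _).add
        ((BoundedLipschitz.const _).mul (boundedLipschitz_cubeCoord k.1).profile)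
    · exact BoundedLipschitz.const _
  choose h1 M hM using h
  choose K hK using h1
  refine ⟨∑ k, K k, ∑ k, |M k|, fun k => ⟨(hK k).weaken ?_, fun x => (hM k x).trans ?_⟩⟩
  · exact Finset.single_le_sum (fun _ _ => zero_le) (Finset.mem_univ k)
  · exact (le_abs_self _).trans
      (Finset.single_le_sum (f := fun l => |M l|) (fun _ _ => abs_nonneg _) (Finset.mem_univ k))

lemma boolSign_mul_profile (b : Bool) (t : ℝ) : boolSign b * profile (boolSign b * t) = profile t := by
  cases b <;> simp [boolSign, profile_neg]

lemma profileDeriv_boolSign_mul (b : Bool) (t : ℝ) :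
    profileDeriv (boolSign b * t) = profileDeriv t := by
  rw [← profileDeriv_abs, abs_mul, abs_boolSign, one_mul, profileDeriv_abs]

lemma norm_cubeField_sub_le (hd : 4 ≤ d) (k k' : Fin d × Bool) (x : EuclideanSpace ℝ (Fin d)) :
    ‖cubeField k x - cubeField k' x‖ ≤ 1 := by
  obtain ⟨i, b⟩ := k
  obtain ⟨j, b'⟩ := k'
  have hd' : (4 : ℝ) ≤ d := by exact_mod_cast hd
  rw [← sq_le_one_iff₀ (norm_nonneg _), EuclideanSpace.real_norm_sq_eq]
  by_cases hij : i = j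
  · subst hij
    have : ∀ l, (cubeField (i, b) x - cubeField (i, b') x) l ^ 2 ≤ if l = i then 1 else 0 := by
      intro l
      rw [PiLp.sub_apply, cubeField_apply, cubeField_apply]
      by_cases hl : l = i
      · simp only [hl, if_true]
        rw [sq_le_one_iff_abs_le_one]
        cases b <;> cases b' <;> norm_num [boolSign]
      · simp [hl]
    refine (Finset.sum_le_sum fun l _ => this l).trans ?_
    simp
  · have hji : j ≠ i := fun h => hij h.symm
    have hn : (d : ℝ) - 1 ≠ 0 := by linarith
    have hε : (0 : ℝ) ≤ 1 / (d - 1) := div_nonneg zero_le_one (by linarith)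
    have hε' : 1 / ((d : ℝ) - 1) ≤ 1 / 3 := one_div_le_one_div_of_le (by norm_num) (by linarith)
    have hp : |boolSign b * cubeCoord x i| ≤ 1 := by
      rw [abs_mul, abs_boolSign, one_mul]; exact abs_cubeCoord_le x i
    have hq : |boolSign b' * cubeCoord x j| ≤ 1 := by
      rw [abs_mul, abs_boolSign, one_mul]; exact abs_cubeCoord_le x j
    have key := profile_sq_add_le hp hq cubeConst_nonneg cubeConst_sq_add hε hε'
    rw [profileDeriv_boolSign_mul, profileDeriv_boolSign_mul] at key
    have hb2 := boolSign_mul_self b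
    have hb2' := boolSign_mul_self b'
    have hsi : (cubeField (i, b) x - cubeField (j, b') x) i = boolSign b * (1 / 2 + cubeConst *
        (profile (boolSign b * cubeCoord x i) - 1 / (d - 1) * (profileDeriv (cubeCoord x i) -
          profileDeriv (cubeCoord x j)) * (boolSign b * cubeCoord x i))) := by
      rw [PiLp.sub_apply, cubeField_apply, cubeField_apply, if_pos rfl, if_neg hij]
      dsimp only
      rw [← boolSign_mul_profile b (cubeCoord x i)]
      linear_combination (cubeConst * (1 / (d - 1) * (profileDeriv (cubeCoord x i) -
          profileDeriv (cubeCoord x j)) * cubeCoord x i)) * hb2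
    have hsj : (cubeField (i, b) x - cubeField (j, b') x) j = -(boolSign b' * (1 / 2 + cubeConst *
        (profile (boolSign b' * cubeCoord x j) + 1 / (d - 1) * (profileDeriv (cubeCoord x i) -
          profileDeriv (cubeCoord x j)) * (boolSign b' * cubeCoord x j)))) := by
      rw [PiLp.sub_apply, cubeField_apply, cubeField_apply, if_pos rfl, if_neg hji]
      dsimp only
      rw [← boolSign_mul_profile b' (cubeCoord x j)]
      linear_combination (cubeConst * (1 / (d - 1) * (profileDeriv (cubeCoord x i) -
          profileDeriv (cubeCoord x j)) * cubeCoord x j)) * hb2'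
    have hsl : ∀ l ∈ (Finset.univ.erase i).erase j,
        (cubeField (i, b) x - cubeField (j, b') x) l ^ 2 ≤
          (1 / (d - 1) * (cubeConst * (profileDeriv (cubeCoord x i) -
            profileDeriv (cubeCoord x j)))) ^ 2 := by
      intro l hl
      rw [Finset.mem_erase, Finset.mem_erase] at hl
      rw [PiLp.sub_apply, cubeField_apply, cubeField_apply, if_neg hl.1, if_neg hl.2.1]
      have h1 : cubeCoord x l ^ 2 ≤ 1 := by
        rw [sq_le_one_iff_abs_le_one]; exact abs_cubeCoord_le x l
      have h2 : ∀ a c : ℝ, (0 - cubeConst / (d - 1) * a * cubeCoord x l -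
          (0 - cubeConst / (d - 1) * c * cubeCoord x l)) ^ 2 =
          (1 / (d - 1) * (cubeConst * (a - c))) ^ 2 * cubeCoord x l ^ 2 := by
        intro a c
        ring
      rw [h2]
      exact mul_le_of_le_one_right (sq_nonneg _) h1
    rw [← Finset.add_sum_erase _ _ (Finset.mem_univ i), ← Finset.add_sum_erase (Finset.univ.erase i)
      _ (Finset.mem_erase.2 ⟨hji, Finset.mem_univ j⟩)]
    have hcard : (((Finset.univ.erase i).erase j).card : ℝ) = d - 2 := by
      rw [Finset.card_erase_of_mem (Finset.mem_erase.2 ⟨hji, Finset.mem_univ j⟩),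
        Finset.card_erase_of_mem (Finset.mem_univ i), Finset.card_univ, Fintype.card_fin,
        Nat.sub_sub, Nat.cast_sub (by omega)]
      norm_num
    have hsum := Finset.sum_le_card_nsmul _ _ _ hsl
    rw [nsmul_eq_mul, hcard] at hsum
    have hcoef : ((d : ℝ) - 2) * (1 / (d - 1)) ^ 2 = 1 / (d - 1) - (1 / (d - 1)) ^ 2 := by
      field_simp
      ring
    rw [mul_pow, ← mul_assoc, hcoef] at hsum
    rw [hsi, hsj, neg_sq, mul_pow, mul_pow, sq (boolSign b), sq (boolSign b'), hb2, hb2', one_mul,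
      one_mul]
    linarith

lemma profileDeriv_of_abs_eq_one {t : ℝ} (ht : |t| = 1) : profileDeriv t = 0 := by
  rw [profileDeriv, ht]; ring

lemma profile_boolSign (b : Bool) : profile (boolSign b) = boolSign b := by
  cases b <;> norm_num [boolSign, profile]

lemma cubeField_of_mul_eq {x : EuclideanSpace ℝ (Fin d)} (k : Fin d × Bool)
    (hx : 1 ≤ cubeNorm x) (hk : boolSign k.2 * x k.1 = cubeNorm x) :
    cubeField k x = (boolSign k.2 / √2) • EuclideanSpace.single k.1 1 := by
  have h2 : √2 * √2 = (2 : ℝ) := Real.mul_self_sqrt (by norm_num)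
  have hc : cubeCoord x k.1 = boolSign k.2 := by
    rw [cubeCoord, max_eq_left hx, div_eq_iff (by linarith), ← hk, ← mul_assoc, boolSign_mul_self,
      one_mul]
  ext l
  rw [cubeField_apply, hc, profile_boolSign, profileDeriv_of_abs_eq_one (abs_boolSign _),
    PiLp.smul_apply, PiLp.single_apply, smul_eq_mul]
  split_ifs
  · rw [cubeConst]
    have h3 : √2 ≠ (0 : ℝ) := by positivity
    field_simp
    linear_combination boolSign k.2 * h2
  · ring

end CubeField

section CubeFieldDivergence

open Module MeasureTheory.Measure Filter Topology
open scoped ENNReal RealInnerProductSpace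

variable {d : ℕ}

lemma hasDerivAt_profile {t : ℝ} (ht : t ≠ 0) : HasDerivAt profile (profileDeriv t) t := by
  have h1 := (((hasDerivAt_id t).const_mul 15).sub
    (((hasDerivAt_id t).mul (hasDerivAt_abs ht)).const_mul 6)).sub (hasDerivAt_pow 3 t)
  have h2 : HasDerivAt profile _ t := h1.div_const 8
  refine h2.congr_deriv ?_
  rcases lt_or_gt_of_ne ht with h | h
  · simp only [id, profileDeriv, abs_of_neg h, sign_neg h]
    norm_num
    ring
  · simp only [id, profileDeriv, abs_of_pos h, sign_pos h]
    norm_num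
    ring

lemma exists_hasDerivAt_profileDeriv {t : ℝ} (ht : t ≠ 0) : ∃ c, HasDerivAt profileDeriv c t :=
  ⟨_, (((hasDerivAt_abs ht).const_sub 1).const_mul (3 / 8)).mul ((hasDerivAt_abs ht).const_add 5)⟩

lemma abs_divergence_le {Y : EuclideanSpace ℝ (Fin d) → EuclideanSpace ℝ (Fin d)} {L : ℝ≥0}
    (hY : LipschitzWith L Y) (x : EuclideanSpace ℝ (Fin d)) : |divergence Y x| ≤ d * L := by
  rw [divergence, LinearMap.trace_eq_sum_inner _ (EuclideanSpace.basisFun (Fin d) ℝ)]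
  refine (Finset.abs_sum_le_sum_abs _ _).trans ?_
  calc _ ≤ ∑ _i : Fin d, (L : ℝ) := by
        refine Finset.sum_le_sum fun i _ => ?_
        refine (abs_real_inner_le_norm _ _).trans ?_
        rw [OrthonormalBasis.norm_eq_one, one_mul]
        refine ((fderiv ℝ Y x).le_opNorm _).trans ?_
        rw [OrthonormalBasis.norm_eq_one, mul_one]
        exact norm_fderiv_le_of_lipschitz ℝ hY
    _ = d * L := by simp

/-- Near a point with a unique coordinate of maximal absolute value, the cube norm is linear. -/
lemma eventually_cubeNorm_eq {x : EuclideanSpace ℝ (Fin d)} {m : Fin d}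
    (hm : |x m| = cubeNorm x) (hx : ∀ j, j ≠ m → |x j| ≠ |x m|) (b : Bool)
    (hb : 0 < boolSign b * x m) :
    ∀ᶠ y in 𝓝 x, cubeNorm y = boolSign b * y m := by
  have hc : ∀ j, Continuous fun y : EuclideanSpace ℝ (Fin d) => y j := fun j => by fun_prop
  have h1 : ∀ j, ∀ᶠ y in 𝓝 x, j ≠ m → |y j| < |y m| := by
    intro j
    by_cases hj : j = m
    · simp [hj]
    · have := (hc j).abs.continuousAt.eventually_lt (hc m).abs.continuousAt
        (lt_of_le_of_ne (hm ▸ abs_apply_le_cubeNorm x j) (hx j hj))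
      filter_upwards [this] with y hy _ using hy
  have h2 : ∀ᶠ y in 𝓝 x, 0 < boolSign b * y m :=
    continuousAt_const.eventually_lt (continuous_const.mul (hc m)).continuousAt hb
  filter_upwards [eventually_all.2 h1, h2] with y hy hy'
  have h3 : |y m| = boolSign b * y m := by
    rw [← abs_of_pos hy', abs_mul, abs_boolSign, one_mul]
  rw [← h3]
  refine le_antisymm ((cubeNorm_le_iff (abs_nonneg _)).2 fun j => ?_) (abs_apply_le_cubeNorm y m)
  by_cases hj : j = m
  · rw [hj]
  · exact (hy j hj).le

lemma exists_boolSign_mul_pos {t : ℝ} (ht : t ≠ 0) : ∃ b, 0 < boolSign b * t := by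
  rcases lt_or_gt_of_ne ht with h | h
  · exact ⟨false, by simpa [boolSign] using h⟩
  · exact ⟨true, by simpa [boolSign] using h⟩

lemma hasDerivAt_cubeCoord {x : EuclideanSpace ℝ (Fin d)} {m : Fin d} {b : Bool}
    (hev : ∀ᶠ y in 𝓝 x, cubeNorm y = boolSign b * y m) (hx : 1 < cubeNorm x) (l j : Fin d) :
    HasDerivAt (fun t : ℝ => cubeCoord (x + t • EuclideanSpace.single l 1) j)
      (((if j = l then 1 else 0) - (if m = l then boolSign b * cubeCoord x j else 0)) /
        cubeNorm x) 0 := by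
  have hline : Continuous fun t : ℝ => x + t • (EuclideanSpace.single l 1 : EuclideanSpace ℝ (Fin d)) := by
    fun_prop
  have hx0 : x + (0 : ℝ) • (EuclideanSpace.single l 1 : EuclideanSpace ℝ (Fin d)) = x := by simp
  have hρ : ∀ᶠ y in 𝓝 x, 1 < cubeNorm y :=
    continuousAt_const.eventually_lt lipschitzWith_cubeNorm.continuous.continuousAt hx
  have hev' : ∀ᶠ t : ℝ in 𝓝 0, cubeCoord (x + t • EuclideanSpace.single l 1) j =
      (x j + t * (if j = l then 1 else 0)) / (boolSign b * (x m + t * (if m = l then 1 else 0))) := by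
    have h1 : Tendsto (fun t : ℝ => x + t • (EuclideanSpace.single l 1 : EuclideanSpace ℝ (Fin d)))
        (𝓝 0) (𝓝 x) := by
      simpa using hline.tendsto 0
    filter_upwards [h1.eventually hev, h1.eventually hρ] with t ht ht'
    rw [cubeCoord, max_eq_left ht'.le, ht]
    simp [PiLp.single_apply]
  have hxx := hev.self_of_nhds
  have hne : boolSign b * x m ≠ 0 := by rw [← hxx]; linarith
  have h2 : ∀ (a e : ℝ), HasDerivAt (fun t : ℝ => a + t * e) e 0 := fun a e => by
    simpa using ((hasDerivAt_id (0 : ℝ)).mul_const e).const_add a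
  have h3 := (h2 (x j) (if j = l then 1 else 0)).div
    ((h2 (x m) (if m = l then 1 else 0)).const_mul (boolSign b)) (by simpa using hne)
  refine (h3.congr_of_eventuallyEq hev').congr_deriv ?_
  rw [cubeCoord, max_eq_left hx.le, hxx]
  have hs : boolSign b ≠ 0 := left_ne_zero_of_mul hne
  have hm : x m ≠ 0 := right_ne_zero_of_mul hne
  simp only [zero_mul, add_zero]
  split_ifs <;> field_simp <;> ring

lemma divergence_cubeField_eq_zero (hd : 4 ≤ d) {x : EuclideanSpace ℝ (Fin d)} (k : Fin d × Bool)
    (hx : 1 < cubeNorm x) (hdiff : DifferentiableAt ℝ (cubeField k) x)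
    (hgen : (∀ i, x i ≠ 0) ∧ ∀ i j, i ≠ j → |x i| ≠ |x j|) :
    divergence (cubeField k) x = 0 := by
  obtain ⟨m, hm⟩ := exists_abs_apply_eq_cubeNorm (by omega) x
  obtain ⟨b, hb⟩ := exists_boolSign_mul_pos (hgen.1 m)
  have hev := eventually_cubeNorm_eq hm (fun j hj => hgen.2 j m hj) b hb
  have hr : cubeNorm x ≠ 0 := by linarith
  have ht : cubeCoord x k.1 ≠ 0 := by
    rw [cubeCoord, max_eq_left hx.le]
    exact div_ne_zero (hgen.1 _) hr
  obtain ⟨c, hc⟩ := exists_hasDerivAt_profileDeriv ht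
  have hp := hasDerivAt_profile ht
  have hx0 : ∀ l, x + (0 : ℝ) • (EuclideanSpace.single l 1 : EuclideanSpace ℝ (Fin d)) = x := by simp
  set T : Fin d → Fin d → ℝ := fun l j => ((if j = l then 1 else 0) -
    (if m = l then boolSign b * cubeCoord x j else 0)) / cubeNorm x with hT
  have hl : ∀ l, lineDeriv ℝ (fun y => ⟪EuclideanSpace.basisFun (Fin d) ℝ l, cubeField k y⟫) x
      (EuclideanSpace.basisFun (Fin d) ℝ l) =
      (if l = k.1 then cubeConst * (profileDeriv (cubeCoord x k.1) * T l k.1) else 0) -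
        cubeConst / (d - 1) * ((c * T l k.1) * cubeCoord x l +
          profileDeriv (cubeCoord x k.1) * T l l) := by
    intro l
    simp only [EuclideanSpace.basisFun_apply]
    refine HasLineDerivAt.lineDeriv ?_
    rw [HasLineDerivAt]
    have hi := hasDerivAt_cubeCoord hev hx l k.1
    have hll := hasDerivAt_cubeCoord hev hx l l
    have e1 : HasDerivAt (fun t : ℝ => profile (cubeCoord (x + t • EuclideanSpace.single l 1) k.1))
        (profileDeriv (cubeCoord x k.1) * T l k.1) 0 :=
      HasDerivAt.comp (h₂ := profile) 0 (by rw [hx0]; exact hp) hi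
    have e2 : HasDerivAt
        (fun t : ℝ => profileDeriv (cubeCoord (x + t • EuclideanSpace.single l 1) k.1))
        (c * T l k.1) 0 :=
      HasDerivAt.comp (h₂ := profileDeriv) 0 (by rw [hx0]; exact hc) hi
    have e3 := ((e2.mul hll).const_mul (cubeConst / (d - 1)))
    rw [hx0] at e3
    have e4 : HasDerivAt (fun t : ℝ => if l = k.1 then boolSign k.2 / 2 + cubeConst *
        profile (cubeCoord (x + t • EuclideanSpace.single l 1) k.1) else 0)
        (if l = k.1 then cubeConst * (profileDeriv (cubeCoord x k.1) * T l k.1) else 0) 0 := by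
      split_ifs
      · exact (e1.const_mul _).const_add _
      · exact hasDerivAt_const _ _
    refine ((e4.sub e3).congr_of_eventuallyEq (Eventually.of_forall fun t => ?_))
    simp only [EuclideanSpace.inner_single_left, cubeField_apply, Pi.sub_apply, Pi.mul_apply]
    simp [mul_assoc]
  rw [divergence_eq_sum_lineDeriv (EuclideanSpace.basisFun (Fin d) ℝ) hdiff]
  simp only [hl]
  have hσ : boolSign b * cubeCoord x m = 1 := by
    rw [cubeCoord, max_eq_left hx.le, ← mul_div_assoc, ← hev.self_of_nhds, div_self hr]
  have hd' : (4 : ℝ) ≤ d := by exact_mod_cast hd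
  have s1 : ∑ l, T l k.1 * cubeCoord x l = 0 := by
    simp only [hT, div_mul_eq_mul_div, sub_mul, ite_mul, one_mul, zero_mul]
    rw [← Finset.sum_div, Finset.sum_sub_distrib, Finset.sum_ite_eq, Finset.sum_ite_eq,
      if_pos (Finset.mem_univ _), if_pos (Finset.mem_univ _)]
    rw [mul_right_comm, hσ, one_mul, sub_self, zero_div]
  have s2 : ∑ l, T l l = (d - 1) / cubeNorm x := by
    simp only [hT, if_true]
    rw [← Finset.sum_div, Finset.sum_sub_distrib, Finset.sum_ite_eq, if_pos (Finset.mem_univ _), hσ]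
    simp
  have s3 : profileDeriv (cubeCoord x k.1) * T k.1 k.1 =
      profileDeriv (cubeCoord x k.1) / cubeNorm x := by
    simp only [hT, if_true]
    split_ifs with h
    · have : |cubeCoord x k.1| = 1 := by
        rw [← h, ← one_mul |cubeCoord x m|, ← abs_boolSign b, ← abs_mul, hσ, abs_one, abs_boolSign]
      rw [profileDeriv_of_abs_eq_one this]
      simp
    · rw [sub_zero, mul_one_div]
  rw [Finset.sum_sub_distrib, Finset.sum_ite_eq', if_pos (Finset.mem_univ _), ← Finset.mul_sum,
    Finset.sum_add_distrib, ← Finset.mul_sum, s2, s3]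
  simp only [mul_assoc]
  rw [← Finset.mul_sum, s1]
  have hn : (d : ℝ) - 1 ≠ 0 := by linarith
  field_simp
  ring

end CubeFieldDivergence

section CubeCutoff

open Module MeasureTheory.Measure Filter Topology
open scoped ENNReal RealInnerProductSpace

variable {d : ℕ} {R T : ℝ}

/-- The cutoff equal to `1` for `cubeNorm x ≤ R` and to `0` for `T ≤ cubeNorm x`. -/
noncomputable def cubeCutoff (R T : ℝ) (x : EuclideanSpace ℝ (Fin d)) : ℝ :=
  max 0 (min 1 ((T - cubeNorm x) / (T - R)))

lemma cubeCutoff_nonneg (x : EuclideanSpace ℝ (Fin d)) : 0 ≤ cubeCutoff R T x := le_max_left _ _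

lemma cubeCutoff_le_one (x : EuclideanSpace ℝ (Fin d)) : cubeCutoff R T x ≤ 1 :=
  max_le zero_le_one (min_le_left _ _)

lemma cubeCutoff_eq_one (hRT : R < T) {x : EuclideanSpace ℝ (Fin d)} (hx : cubeNorm x ≤ R) :
    cubeCutoff R T x = 1 := by
  have : 1 ≤ (T - cubeNorm x) / (T - R) := by
    rw [le_div_iff₀ (by linarith)]; linarith
  rw [cubeCutoff, min_eq_left this, max_eq_right zero_le_one]

lemma cubeCutoff_eq_zero (hRT : R < T) {x : EuclideanSpace ℝ (Fin d)} (hx : T ≤ cubeNorm x) :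
    cubeCutoff R T x = 0 := by
  have : (T - cubeNorm x) / (T - R) ≤ 0 := div_nonpos_of_nonpos_of_nonneg (by linarith) (by linarith)
  rw [cubeCutoff, max_eq_left ((min_le_right _ _).trans this)]

lemma cubeCutoff_of_mem (hRT : R < T) {x : EuclideanSpace ℝ (Fin d)} (hx : R ≤ cubeNorm x)
    (hx' : cubeNorm x ≤ T) : cubeCutoff R T x = (T - cubeNorm x) / (T - R) := by
  have h1 : (T - cubeNorm x) / (T - R) ≤ 1 := by
    rw [div_le_one (by linarith)]; linarith
  rw [cubeCutoff, min_eq_right h1, max_eq_right (div_nonneg (by linarith) (by linarith))]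

lemma exists_lipschitzWith_cubeCutoff (R T : ℝ) :
    ∃ K : ℝ≥0, LipschitzWith K (cubeCutoff (d := d) R T) := by
  have h1 : LipschitzWith _ fun x : EuclideanSpace ℝ (Fin d) => T - cubeNorm x :=
    (LipschitzWith.const T).sub lipschitzWith_cubeNorm
  have h2 : LipschitzWith _ fun x : EuclideanSpace ℝ (Fin d) => (T - R)⁻¹ • (T - cubeNorm x) :=
    (lipschitzWith_smul (T - R)⁻¹).comp h1
  have h3 := (h2.const_min 1).const_max 0
  simp only [smul_eq_mul, inv_mul_eq_div] at h3
  exact ⟨_, h3⟩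

end CubeCutoff

section CubeCalibration

open Module MeasureTheory.Measure Filter Topology
open scoped ENNReal RealInnerProductSpace

variable {d : ℕ} {R T δ : ℝ}

lemma ae_divergence_cubeField_smul (hd : 4 ≤ d) (hδ : 0 < δ) :
    ∀ᵐ x : EuclideanSpace ℝ (Fin d), δ < cubeNorm x → ∀ k : Fin d × Bool,
      divergence (fun y => cubeField k (δ⁻¹ • y)) x = 0 := by
  filter_upwards [ae_generic (d := d)] with x hx hρ k
  have hδ' : 0 < δ⁻¹ := inv_pos.2 hδ
  rw [divergence, fderiv_comp_smul (f := cubeField k)]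
  have : divergence (cubeField k) (δ⁻¹ • x) = 0 := by
    by_cases hdiff : DifferentiableAt ℝ (cubeField k) (δ⁻¹ • x)
    · refine divergence_cubeField_eq_zero hd k ?_ hdiff ⟨fun i => ?_, fun i j hij => ?_⟩
      · rw [cubeNorm_smul, abs_of_pos hδ', inv_mul_eq_div, one_lt_div hδ]
        exact hρ
      · rw [PiLp.smul_apply, smul_eq_mul]
        exact mul_ne_zero hδ'.ne' (hx.1 i)
      · rw [PiLp.smul_apply, PiLp.smul_apply, smul_eq_mul, smul_eq_mul, abs_mul, abs_mul]
        exact fun h => hx.2 i j hij (mul_left_cancel₀ (abs_pos.2 hδ'.ne').ne' h)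
    · rw [divergence, fderiv_zero_of_not_differentiableAt hdiff]
      simp
  rw [divergence] at this
  rw [ContinuousLinearMap.toLinearMap_smul, map_smul, this, smul_zero]

lemma divergence_affine_smul_single (a c : ℝ) (i : Fin d) (x : EuclideanSpace ℝ (Fin d)) :
    divergence (fun y : EuclideanSpace ℝ (Fin d) =>
      (a - c * y i) • EuclideanSpace.single i (1 : ℝ)) x = -c := by
  have h1 : HasFDerivAt (fun y : EuclideanSpace ℝ (Fin d) => y i)
      (EuclideanSpace.proj i : EuclideanSpace ℝ (Fin d) →L[ℝ] ℝ) x :=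
    (EuclideanSpace.proj i : EuclideanSpace ℝ (Fin d) →L[ℝ] ℝ).hasFDerivAt
  have h2 := ((h1.const_mul c).const_sub a).smul_const (EuclideanSpace.single i (1 : ℝ))
  rw [divergence, h2.fderiv, ContinuousLinearMap.coe_smulRight, LinearMap.trace_smulRight]
  simp

/-- Pointwise description of the divergence of the truncated calibrating field. -/
lemma ae_divergence_cubeCutoff_smul (hd : 4 ≤ d) (hδ : 0 < δ) (hδR : δ < R) (hRT : R < T)
    {L : ℝ≥0} (hL : ∀ k : Fin d × Bool, LipschitzWith L (cubeField k))
    {lab : EuclideanSpace ℝ (Fin d) → Fin d × Bool}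
    (hlab : ∀ᵐ x, R < cubeNorm x → boolSign (lab x).2 * x (lab x).1 = cubeNorm x) :
    ∀ᵐ x, |divergence (fun y => cubeCutoff R T y • cubeField (lab x) (δ⁻¹ • y)) x +
        ({x | cubeNorm x < T} \ {x | cubeNorm x < R}).indicator
          (fun _ => 1 / (√2 * (T - R))) x| ≤
      {x | cubeNorm x < δ}.indicator (fun _ => d * (L * δ⁻¹)) x := by
  have hc : Continuous (cubeNorm (d := d)) := lipschitzWith_cubeNorm.continuous
  filter_upwards [ae_divergence_cubeField_smul hd hδ, hlab, ae_cubeNorm_ne (by omega) δ,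
    ae_cubeNorm_ne (by omega) R, ae_cubeNorm_ne (by omega) T, ae_generic (d := d)]
    with x hdiv hlab hxδ hxR hxT hgen
  rcases lt_or_gt_of_ne hxR with h | h
  · have hev : (fun y => cubeCutoff R T y • cubeField (lab x) (δ⁻¹ • y)) =ᶠ[𝓝 x]
        fun y => cubeField (lab x) (δ⁻¹ • y) := by
      filter_upwards [hc.continuousAt.eventually_lt continuousAt_const h] with y hy
      rw [cubeCutoff_eq_one hRT hy.le, one_smul]
    rw [divergence, hev.fderiv_eq, ← divergence, indicator_of_notMem (fun hx => hx.2 h), add_zero]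
    rcases lt_or_gt_of_ne hxδ with h' | h'
    · rw [indicator_of_mem (by exact h')]
      have h3 : LipschitzWith (L * δ⁻¹.toNNReal) fun y => cubeField (lab x) (δ⁻¹ • y) := by
        have := (hL (lab x)).comp (lipschitzWith_smul (β := EuclideanSpace ℝ (Fin d)) δ⁻¹)
        rwa [← Real.toNNReal_eq_nnnorm_of_nonneg (by positivity)] at this
      refine (abs_divergence_le h3 x).trans_eq ?_
      rw [NNReal.coe_mul, Real.coe_toNNReal _ (by positivity)]
    · rw [hdiv h', abs_zero]
      exact indicator_nonneg (fun _ _ => by positivity) _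
  · rw [indicator_of_notMem (s := {x | cubeNorm x < δ}) (fun hx => (hδR.trans h).not_gt hx)]
    rcases lt_or_gt_of_ne hxT with h' | h'
    · rw [indicator_of_mem (by exact ⟨h', h.not_gt⟩)]
      have hk := hlab h
      have hm : |x (lab x).1| = cubeNorm x := by
        rw [← one_mul |x (lab x).1|, ← abs_boolSign (lab x).2, ← abs_mul, hk,
          abs_of_nonneg (cubeNorm_nonneg x)]
      have hev : (fun y => cubeCutoff R T y • cubeField (lab x) (δ⁻¹ • y)) =ᶠ[𝓝 x] fun y =>
          (T * boolSign (lab x).2 / (√2 * (T - R)) - 1 / (√2 * (T - R)) * y (lab x).1) •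
            EuclideanSpace.single (lab x).1 (1 : ℝ) := by
        filter_upwards [hc.continuousAt.eventually_lt continuousAt_const h',
          continuousAt_const.eventually_lt hc.continuousAt h,
          eventually_cubeNorm_eq hm (fun j hj => hgen.2 j _ hj) (lab x).2
            (by rw [hk]; linarith)] with y hy1 hy2 hy3
        rw [cubeCutoff_of_mem hRT hy2.le hy1.le, cubeField_of_mul_eq, smul_smul, hy3]
        · congr 1
          have h4 := boolSign_mul_self (lab x).2
          have h5 : √2 ≠ (0 : ℝ) := by positivity
          have h6 : T - R ≠ 0 := by linarith
          field_simp
          linear_combination (-y (lab x).1) * h4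
        · rw [cubeNorm_smul, abs_of_pos (inv_pos.2 hδ), inv_mul_eq_div, one_le_div hδ]
          linarith
        · rw [cubeNorm_smul, abs_of_pos (inv_pos.2 hδ), PiLp.smul_apply, smul_eq_mul, hy3]
          ring
      rw [divergence, hev.fderiv_eq, ← divergence, divergence_affine_smul_single, neg_add_cancel,
        abs_zero]
    · rw [indicator_of_notMem (fun hx => h'.not_gt hx.1), add_zero]
      have hev : (fun y => cubeCutoff R T y • cubeField (lab x) (δ⁻¹ • y)) =ᶠ[𝓝 x]
          fun _ => 0 := by
        filter_upwards [continuousAt_const.eventually_lt hc.continuousAt h'] with y hy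
        rw [cubeCutoff_eq_zero hRT hy.le, zero_smul]
      rw [divergence, hev.fderiv_eq]
      simp

lemma cubeNorm_integral_le (hd : 4 ≤ d) (hδ : 0 < δ) (hδR : δ < R) (hRT : R < T)
    {L : ℝ≥0} {M : ℝ} (hL : ∀ k : Fin d × Bool, LipschitzWith L (cubeField k))
    (hM : ∀ (k : Fin d × Bool) x, ‖cubeField k x‖ ≤ M)
    {lab : EuclideanSpace ℝ (Fin d) → Fin d × Bool} (hlm : ∀ k, MeasurableSet (lab ⁻¹' {k}))
    (hlab : ∀ᵐ x, R < cubeNorm x → boolSign (lab x).2 * x (lab x).1 = cubeNorm x) :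
    1 / (√2 * (T - R)) * ((2 * T) ^ d - (2 * R) ^ d) ≤
      |∫ x, divergence (fun y => cubeCutoff R T y • cubeField (lab x) (δ⁻¹ • y)) x| +
        d * (L * δ⁻¹) * (2 * δ) ^ d := by
  have hR : 0 < R := hδ.trans hδR
  have hT : 0 < T := hR.trans hRT
  have hc : Continuous (cubeNorm (d := d)) := lipschitzWith_cubeNorm.continuous
  have hms : ∀ r, MeasurableSet {x : EuclideanSpace ℝ (Fin d) | cubeNorm x < r} := fun r =>
    (isOpen_lt hc continuous_const).measurableSet
  obtain ⟨K, hK⟩ := exists_lipschitzWith_cubeCutoff (d := d) R T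
  have hsup : ∀ x : EuclideanSpace ℝ (Fin d), √d * T < ‖x‖ → cubeCutoff R T x = 0 := by
    intro x hx
    refine cubeCutoff_eq_zero hRT ?_
    by_contra! h
    have := norm_le_sqrt_mul_cubeNorm x
    have h2 : √d * cubeNorm x ≤ √d * T := by gcongr
    linarith
  obtain ⟨C, hC⟩ := exists_lipschitzWith_smul hK hsup
    (fun k : Fin d × Bool => (hL k).comp (lipschitzWith_smul (β := EuclideanSpace ℝ (Fin d)) δ⁻¹))
    (fun k x => hM k _)
  have hInt := integrable_divergence hlm hC fun k x hx => by rw [hsup x hx, zero_smul]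
  have hfin : ∀ r, 0 < r → volume {x : EuclideanSpace ℝ (Fin d) | cubeNorm x < r} ≠ ∞ :=
    fun r hr => by rw [volume_cubeNorm_lt hr]; exact ENNReal.ofReal_ne_top
  set A : Set (EuclideanSpace ℝ (Fin d)) := {x | cubeNorm x < T} \ {x | cubeNorm x < R} with hA
  have hAm : MeasurableSet A := (hms T).diff (hms R)
  have hAi : Integrable (A.indicator fun _ => 1 / (√2 * (T - R))) :=
    (integrable_indicator_iff hAm).2 (integrableOn_const
      (measure_ne_top_of_subset sdiff_subset (hfin T hT)))
  have hBi : Integrable ({x : EuclideanSpace ℝ (Fin d) | cubeNorm x < δ}.indicator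
      fun _ => (d : ℝ) * (L * δ⁻¹)) :=
    (integrable_indicator_iff (hms δ)).2 (integrableOn_const (hfin δ hδ))
  have hreal : ∀ r, 0 < r → (volume : Measure (EuclideanSpace ℝ (Fin d))).real {x | cubeNorm x < r} =
      (2 * r) ^ d := fun r hr => by
    rw [measureReal_def, volume_cubeNorm_lt hr, ENNReal.toReal_ofReal (by positivity)]
  have hsub : {x : EuclideanSpace ℝ (Fin d) | cubeNorm x < R} ⊆ {x | cubeNorm x < T} :=
    fun x hx => lt_trans (show cubeNorm x < R from hx) hRT
  have e1 : ∫ x, A.indicator (fun _ => 1 / (√2 * (T - R))) x =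
      1 / (√2 * (T - R)) * ((2 * T) ^ d - (2 * R) ^ d) := by
    rw [integral_indicator hAm, setIntegral_const, hA, measureReal_sdiff hsub (hms R)
      (hfin T hT), hreal T hT, hreal R hR, smul_eq_mul, mul_comm]
  have e2 : ∫ x : EuclideanSpace ℝ (Fin d), {x : EuclideanSpace ℝ (Fin d) |
      cubeNorm x < δ}.indicator (fun _ => (d : ℝ) * (L * δ⁻¹)) x = d * (L * δ⁻¹) * (2 * δ) ^ d := by
    rw [integral_indicator (hms δ), setIntegral_const, hreal δ hδ, smul_eq_mul, mul_comm]
  have hae := ae_divergence_cubeCutoff_smul hd hδ hδR hRT hL hlab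
  simp only [← Real.norm_eq_abs] at hae
  simp only [Function.comp_apply] at hInt
  have h1 := norm_integral_le_of_norm_le hBi hae
  rw [integral_add hInt hAi, e1, e2, Real.norm_eq_abs] at h1
  have h2 := neg_abs_le (∫ x, divergence
    (fun y => cubeCutoff R T y • cubeField (lab x) (δ⁻¹ • y)) x)
  have h3 := (le_abs_self _).trans h1
  linarith

end CubeCalibration

section CubeLowerBound

open Module MeasureTheory.Measure Filter Topology
open scoped ENNReal RealInnerProductSpace

variable {d : ℕ} {R T δ : ℝ}

lemma mul_pow_pred_mul_sub_le (hd : 0 < d) (hR : 0 < R) (hRT : R ≤ T) :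
    d * R ^ (d - 1) * (T - R) ≤ T ^ d - R ^ d := by
  have h := one_add_mul_le_pow (a := (T - R) / R)
    (by have := div_nonneg (sub_nonneg.2 hRT) hR.le; linarith) d
  have h1 : 1 + (T - R) / R = T / R := by field_simp; ring
  rw [h1, div_pow, le_div_iff₀ (by positivity)] at h
  have h2 : R ^ d = R ^ (d - 1) * R := by
    rw [← pow_succ, Nat.sub_add_cancel hd]
  have h3 : (1 + d * ((T - R) / R)) * R ^ d = R ^ d + d * R ^ (d - 1) * (T - R) := by
    rw [add_mul, one_mul, h2]
    field_simp
  linarith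

lemma cubeNorm_le_subset_closedBall (T : ℝ) :
    {x : EuclideanSpace ℝ (Fin d) | cubeNorm x ≤ T} ⊆ closedBall 0 (√d * T) := by
  intro x hx
  rw [mem_closedBall_zero_iff]
  exact (norm_le_sqrt_mul_cubeNorm x).trans
    (mul_le_mul_of_nonneg_left hx (Real.sqrt_nonneg _))

lemma measure_inter_cubeNorm_le_ne_top {μ : Measure (EuclideanSpace ℝ (Fin d))}
    {E : Set (EuclideanSpace ℝ (Fin d))} (hfin : ∀ r, μ (E ∩ closedBall 0 r) ≠ ∞) (T : ℝ) :
    μ (E ∩ {x | cubeNorm x ≤ T}) ≠ ∞ :=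
  measure_ne_top_of_subset (inter_subset_inter_right _ (cubeNorm_le_subset_closedBall T)) (hfin _)

lemma setIntegral_cubeCutoff_le {μ : Measure (EuclideanSpace ℝ (Fin d))}
    {E : Set (EuclideanSpace ℝ (Fin d))} (hfin : ∀ r, μ (E ∩ closedBall 0 r) ≠ ∞) (hRT : R < T) :
    ∫ x in E, cubeCutoff R T x ∂μ ≤ (μ (E ∩ {x | cubeNorm x ≤ T})).toReal := by
  have hm : MeasurableSet {x : EuclideanSpace ℝ (Fin d) | cubeNorm x ≤ T} :=
    (isClosed_le lipschitzWith_cubeNorm.continuous continuous_const).measurableSet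
  have hμ : μ.restrict E {x | cubeNorm x ≤ T} = μ (E ∩ {x | cubeNorm x ≤ T}) := by
    rw [Measure.restrict_apply hm, inter_comm]
  calc ∫ x in E, cubeCutoff R T x ∂μ
      ≤ ∫ x in E, {x : EuclideanSpace ℝ (Fin d) | cubeNorm x ≤ T}.indicator
          (fun _ => (1 : ℝ)) x ∂μ := by
        refine integral_mono_of_nonneg (Eventually.of_forall cubeCutoff_nonneg) ?_
          (Eventually.of_forall fun x => ?_)
        · refine (integrable_indicator_iff hm).2 (integrableOn_const ?_)
          rw [hμ]
          exact measure_inter_cubeNorm_le_ne_top hfin T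
        · by_cases hx : cubeNorm x ≤ T
          · simpa [hx] using cubeCutoff_le_one x
          · simp [hx, cubeCutoff_eq_zero hRT (not_le.1 hx).le]
    _ = _ := by
        rw [integral_indicator hm, setIntegral_const, measureReal_def, hμ, smul_eq_mul, mul_one]

lemma le_of_forall_le_add_of_tendsto_zero {a H : ℝ} {f : ℝ → ℝ} (hR : 0 < R)
    (hf : Tendsto f (𝓝[>] 0) (𝓝 0)) (h : ∀ δ, 0 < δ → δ < R → a ≤ H + f δ) : a ≤ H := by
  have h1 : Tendsto (fun δ => H + f δ) (𝓝[>] 0) (𝓝 (H + 0)) := hf.const_add H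
  rw [add_zero] at h1
  refine ge_of_tendsto h1 ?_
  filter_upwards [Ioo_mem_nhdsGT hR] with δ hδ using h δ hδ.1 hδ.2

/-- The lower bound for separating sets given by the calibrating fields. -/
lemma le_measure_inter_cubeNorm_le (hd : 4 ≤ d) {E : Set (EuclideanSpace ℝ (Fin d))}
    (hE : IsClosed E) (hEf : NearlyFlatCover (d - 1) E)
    (hfin : ∀ r, μHE[d - 1] (E ∩ closedBall 0 r) ≠ ∞)
    {lab : EuclideanSpace ℝ (Fin d) → Fin d × Bool} (hlm : ∀ k, MeasurableSet (lab ⁻¹' {k}))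
    (hlab : ∀ x y, (∀ s ∈ Icc (0 : ℝ) 1, x + s • (y - x) ∉ E) → lab x = lab y)
    {R₀ : ℝ} (hlab' : ∀ᵐ x, R₀ < cubeNorm x → boolSign (lab x).2 * x (lab x).1 = cubeNorm x)
    (hT : 0 < T) (hRT : R₀ < T) :
    d * 2 ^ d * T ^ (d - 1) / √2 ≤ (μHE[d - 1] (E ∩ {x | cubeNorm x ≤ T})).toReal := by
  obtain ⟨L, M, hLM⟩ := exists_lipschitzWith_cubeField (d := d)
  have hL := fun k => (hLM k).1
  have hM := fun k => (hLM k).2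
  set H := (μHE[d - 1] (E ∩ {x | cubeNorm x ≤ T})).toReal with hH
  have hd' : finrank ℝ (EuclideanSpace ℝ (Fin d)) = d - 1 + 1 := by
    rw [finrank_euclideanSpace_fin]; omega
  have key : ∀ R, max R₀ 0 < R → R < T →
      1 / (√2 * (T - R)) * ((2 * T) ^ d - (2 * R) ^ d) ≤ H := by
    intro R hR hRT'
    have hR0 : 0 < R := (le_max_right _ _).trans_lt hR
    refine le_of_forall_le_add_of_tendsto_zero (f := fun δ => d * (L * δ⁻¹) * (2 * δ) ^ d) hR0 ?_
      fun δ hδ hδR => ?_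
    · have h1 : Tendsto (fun δ : ℝ => d * L * 2 * (2 * δ) ^ (d - 1)) (𝓝[>] 0) (𝓝 0) := by
        have : Continuous fun δ : ℝ => d * L * 2 * (2 * δ) ^ (d - 1) := by fun_prop
        have h2 := (this.tendsto 0).mono_left (nhdsWithin_le_nhds (s := Ioi 0))
        simpa [show d - 1 ≠ 0 by omega] using h2
      refine h1.congr' ?_
      filter_upwards [self_mem_nhdsWithin] with δ hδ
      have hδ0 : δ ≠ 0 := (show (0 : ℝ) < δ from hδ).ne'
      have h3 : (2 * δ) ^ d = (2 * δ) ^ (d - 1) * (2 * δ) := by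
        rw [← pow_succ, Nat.sub_add_cancel (by omega)]
      rw [h3]
      field_simp
    · have h1 := cubeNorm_integral_le hd hδ hδR hRT' hL hM hlm
        (hlab'.mono fun x hx h => hx (((le_max_left _ _).trans_lt hR).trans h))
      obtain ⟨K, hK⟩ := exists_lipschitzWith_cubeCutoff (d := d) R T
      have h2 := abs_integral_divergence_le (X := fun k x => cubeField k (δ⁻¹ • x)) hd' hE hEf hlab
        hlm (fun k => (hL k).comp (lipschitzWith_smul (β := EuclideanSpace ℝ (Fin d)) δ⁻¹))
        (fun k x => hM k _) (fun k l x => norm_cubeField_sub_le hd k l _) hK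
        (R := √d * T) (fun x hx => cubeCutoff_eq_zero hRT' (by
          by_contra! h
          have h3 := cubeNorm_le_subset_closedBall T h.le
          rw [mem_closedBall_zero_iff] at h3
          linarith)) cubeCutoff_nonneg cubeCutoff_le_one hfin
      have h3 := setIntegral_cubeCutoff_le hfin hRT'
      linarith
  have key2 : ∀ R, max R₀ 0 < R → R < T → d * 2 ^ d * R ^ (d - 1) / √2 ≤ H := by
    intro R hR hRT'
    have hR0 : 0 < R := (le_max_right _ _).trans_lt hR
    refine le_trans ?_ (key R hR hRT')
    have h1 := mul_pow_pred_mul_sub_le (by omega : 0 < d) hR0 hRT'.le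
    have h2 : 0 < T - R := by linarith
    have h3 : (0 : ℝ) < √2 := by positivity
    rw [one_div_mul_eq_div, div_le_div_iff₀ h3 (by positivity), mul_pow, mul_pow]
    have h4 : (0 : ℝ) ≤ 2 ^ d * √2 := by positivity
    have h5 := mul_le_mul_of_nonneg_left h1 h4
    calc _ = 2 ^ d * √2 * (d * R ^ (d - 1) * (T - R)) := by ring
      _ ≤ _ := h5
      _ = _ := by ring
  have hcont : Tendsto (fun R : ℝ => d * 2 ^ d * R ^ (d - 1) / √2) (𝓝[<] T)
      (𝓝 (d * 2 ^ d * T ^ (d - 1) / √2)) := by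
    have : Continuous fun R : ℝ => d * 2 ^ d * R ^ (d - 1) / √2 := by fun_prop
    exact (this.tendsto T).mono_left nhdsWithin_le_nhds
  refine le_of_tendsto hcont ?_
  filter_upwards [Ioo_mem_nhdsLT (max_lt hRT hT)] with R hR using key2 R hR.1 hR.2

end CubeLowerBound

section CubeConeCover

open Module MeasureTheory.Measure Filter Topology
open scoped ENNReal RealInnerProductSpace

variable {n : ℕ}

lemma mem_coneOver_cubeSkeleton_iff {d : ℕ} {x : EuclideanSpace ℝ (Fin d)} :
    x ∈ coneOver (cubeSkeleton d) ↔
      ∃ i j, i ≠ j ∧ |x i| = cubeNorm x ∧ |x j| = cubeNorm x := by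
  constructor
  · rintro ⟨t, ht, y, ⟨hy, i, j, hij, hi, hj⟩, rfl⟩
    have h1 : cubeNorm y = 1 := le_antisymm ((cubeNorm_le_iff zero_le_one).2 hy)
      (hi ▸ abs_apply_le_cubeNorm y i)
    refine ⟨i, j, hij, ?_, ?_⟩
    · rw [cubeNorm_smul, h1, PiLp.smul_apply, smul_eq_mul, abs_mul, hi]
    · rw [cubeNorm_smul, h1, PiLp.smul_apply, smul_eq_mul, abs_mul, hj]
  · rintro ⟨i, j, hij, hi, hj⟩
    rcases (cubeNorm_nonneg x).eq_or_lt with h | h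
    · refine ⟨0, le_rfl, WithLp.toLp 2 fun _ => 1, ⟨fun l => by simp, i, j, hij, by simp, by simp⟩, ?_⟩
      ext l
      have := abs_apply_le_cubeNorm x l
      rw [← h] at this
      simpa using abs_nonpos_iff.1 this
    · have h1 : ∀ l, |((cubeNorm x)⁻¹ • x) l| = |x l| / cubeNorm x := fun l => by
        rw [PiLp.smul_apply, smul_eq_mul, abs_mul, abs_inv, abs_of_pos h, inv_mul_eq_div]
      refine ⟨cubeNorm x, h.le, (cubeNorm x)⁻¹ • x, ⟨fun l => ?_, i, j, hij, ?_, ?_⟩, ?_⟩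
      · rw [h1, div_le_one h]; exact abs_apply_le_cubeNorm x l
      · rw [h1, hi, div_self h.ne']
      · rw [h1, hj, div_self h.ne']
      · rw [smul_smul, mul_inv_cancel₀ h.ne', one_smul]

lemma isClosed_coneOver_cubeSkeleton (d : ℕ) : IsClosed (coneOver (cubeSkeleton d)) := by
  have : coneOver (cubeSkeleton d) = ⋃ i : Fin d, ⋃ j : Fin d, ⋃ _ : i ≠ j,
      {x | |x i| = cubeNorm x} ∩ {x | |x j| = cubeNorm x} := by
    ext x
    simp only [mem_coneOver_cubeSkeleton_iff, mem_iUnion, mem_inter_iff, mem_ofPred_eq, exists_prop]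
  rw [this]
  have hc : ∀ i : Fin d, IsClosed {x : EuclideanSpace ℝ (Fin d) | |x i| = cubeNorm x} := fun i =>
    isClosed_eq (by fun_prop) lipschitzWith_cubeNorm.continuous
  exact isClosed_iUnion_of_finite fun i => isClosed_iUnion_of_finite fun j =>
    isClosed_iUnion_of_finite fun _ => (hc i).inter (hc j)

/-- Division of the `m`-th coordinate by `√2`. -/
noncomputable def coordShrink (m : Fin n) : EuclideanSpace ℝ (Fin n) →ₗ[ℝ] EuclideanSpace ℝ (Fin n) :=
  Matrix.toEuclideanLin (Matrix.diagonal fun l => if l = m then 1 / √2 else 1)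

lemma coordShrink_apply (m : Fin n) (z : EuclideanSpace ℝ (Fin n)) (l : Fin n) :
    coordShrink m z l = (if l = m then 1 / √2 else 1) * z l := by
  simp [coordShrink, Matrix.mulVec_diagonal]

lemma det_coordShrink (m : Fin n) : LinearMap.det (coordShrink m) = 1 / √2 := by
  rw [coordShrink, Matrix.toEuclideanLin_eq_toLin, LinearMap.det_toLin, Matrix.det_diagonal,
    Finset.prod_ite_eq' Finset.univ m fun _ => 1 / √2, if_pos (Finset.mem_univ _)]

/-- The sign `1` if `i < j` and `-1` otherwise. -/
noncomputable def orderSign (i j : Fin (n + 1)) : ℝ := if i < j then 1 else -1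

lemma abs_orderSign (i j : Fin (n + 1)) : |orderSign i j| = 1 := by
  unfold orderSign; split_ifs <;> simp

/-- An isometric parametrization of the hyperplane where the coordinates `i` and `i.succAbove m`
agree up to sign. -/
noncomputable def diagonalParam (i : Fin (n + 1)) (m : Fin n) :
    EuclideanSpace ℝ (Fin n) →ₗ[ℝ] EuclideanSpace ℝ (Fin (n + 1)) where
  toFun z := WithLp.toLp 2 (i.insertNth (α := fun _ => ℝ)
    (orderSign i (i.succAbove m) * coordShrink m z m) fun l => coordShrink m z l)
  map_add' z w := by
    ext l
    refine i.succAboveCases ?_ (fun l => ?_) l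
    · simp [mul_add]
    · simp
  map_smul' c z := by
    ext l
    refine i.succAboveCases ?_ (fun l => ?_) l
    · simp [mul_left_comm]
    · simp

lemma diagonalParam_apply_self (i : Fin (n + 1)) (m : Fin n) (z : EuclideanSpace ℝ (Fin n)) :
    diagonalParam i m z i = orderSign i (i.succAbove m) * coordShrink m z m := by
  simp [diagonalParam]

lemma diagonalParam_apply_succAbove (i : Fin (n + 1)) (m l : Fin n)
    (z : EuclideanSpace ℝ (Fin n)) :
    diagonalParam i m z (i.succAbove l) = coordShrink m z l := by
  simp [diagonalParam]

lemma isometry_diagonalParam (i : Fin (n + 1)) (m : Fin n) : Isometry (diagonalParam i m) := by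
  refine AddMonoidHomClass.isometry_of_norm _ fun z => ?_
  rw [← sq_eq_sq₀ (norm_nonneg _) (norm_nonneg _), EuclideanSpace.real_norm_sq_eq,
    EuclideanSpace.real_norm_sq_eq, Fin.sum_univ_succAbove _ i, diagonalParam_apply_self]
  simp only [diagonalParam_apply_succAbove]
  have h2 : (1 / √2) ^ 2 = (1 / 2 : ℝ) := by
    rw [div_pow, Real.sq_sqrt (by norm_num), one_pow]
  rw [← Finset.add_sum_erase _ _ (Finset.mem_univ m),
    ← Finset.add_sum_erase _ (fun l => z l ^ 2) (Finset.mem_univ m), mul_pow,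
    ← sq_abs (orderSign _ _), abs_orderSign, coordShrink_apply, if_pos rfl, mul_pow, h2]
  rw [Finset.sum_congr rfl fun l hl => by
    rw [coordShrink_apply, if_neg (Finset.ne_of_mem_erase hl), one_mul]]
  ring

/-- The points of the cube of half-side `T` whose `m`-th coordinate is maximal. -/
def maxCoordSet (m : Fin n) (T : ℝ) : Set (EuclideanSpace ℝ (Fin n)) :=
  {y | (∀ l, |y l| ≤ |y m|) ∧ |y m| ≤ T}

lemma measurableSet_maxCoordSet (m : Fin n) (T : ℝ) : MeasurableSet (maxCoordSet m T) := by
  have : maxCoordSet m T = (⋂ l, {y | |y l| ≤ |y m|}) ∩ {y | |y m| ≤ T} := by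
    ext y; simp [maxCoordSet]
  rw [this]
  exact ((isClosed_iInter fun l => isClosed_le (by fun_prop) (by fun_prop)).inter
    (isClosed_le (by fun_prop) (by fun_prop))).measurableSet

lemma sum_volume_maxCoordSet_le {T : ℝ} (hT : 0 < T) (hn : 0 < n) :
    ∑ m : Fin n, volume (maxCoordSet m T) ≤ ENNReal.ofReal ((2 * T) ^ n) := by
  have hdisj : Pairwise (Function.onFun (AEDisjoint volume) fun m : Fin n => maxCoordSet m T) := by
    intro m l hml
    refine measure_mono_null ?_ (ae_iff.1 (ae_generic (d := n)))
    rintro y ⟨hm, hl⟩ hy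
    exact hy.2 m l hml (le_antisymm (hl.1 m) (hm.1 l))
  have hae : (⋃ m : Fin n, maxCoordSet m T : Set (EuclideanSpace ℝ (Fin n))) ≤ᵐ[volume]
      {y | cubeNorm y < T} := by
    filter_upwards [ae_cubeNorm_ne hn T] with y hy hy'
    obtain ⟨m, hm⟩ := mem_iUnion.1 hy'
    exact lt_of_le_of_ne ((cubeNorm_le_iff hT.le).2 fun l => (hm.1 l).trans hm.2) hy
  calc ∑ m : Fin n, volume (maxCoordSet m T) = volume (⋃ m : Fin n, maxCoordSet m T) := by
        rw [measure_iUnion₀ hdisj fun m => (measurableSet_maxCoordSet m T).nullMeasurableSet,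
          tsum_fintype]
    _ ≤ volume {y : EuclideanSpace ℝ (Fin n) | cubeNorm y < T} := measure_mono_ae hae
    _ = _ := volume_cubeNorm_lt hT

lemma volume_preimage_coordShrink (m : Fin n) (s : Set (EuclideanSpace ℝ (Fin n))) :
    volume (coordShrink m ⁻¹' s) = ENNReal.ofReal (√2) * volume s := by
  have h : (0 : ℝ) < √2 := by positivity
  rw [addHaar_preimage_linearMap volume (by rw [det_coordShrink]; positivity), det_coordShrink,
    one_div, inv_inv, abs_of_pos h]

lemma exists_diagonalParam_eq {x : EuclideanSpace ℝ (Fin (n + 1))}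
    (hx : x ∈ coneOver (cubeSkeleton (n + 1))) :
    ∃ i m z, coordShrink m z ∈ maxCoordSet m (cubeNorm x) ∧ diagonalParam i m z = x := by
  obtain ⟨i, j, hij, hxij, hj⟩ : ∃ i j, i ≠ j ∧ x i = orderSign i j * x j ∧ |x j| = cubeNorm x := by
    obtain ⟨i, j, hij, hi, hj⟩ := mem_coneOver_cubeSkeleton_iff.1 hx
    have hneg : ∀ i j : Fin (n + 1), i ≠ j → orderSign j i = -orderSign i j := by
      intro i j hij
      rcases lt_or_gt_of_ne hij with h | h <;> simp [orderSign, h, h.not_gt]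
    have hij' : x i = orderSign i j * x j ∨ x j = orderSign j i * x i := by
      rw [hneg i j hij]
      rcases abs_eq_abs.1 (hi.trans hj.symm) with h | h <;> unfold orderSign <;> split_ifs <;>
        simp [h]
    rcases hij' with h | h
    · exact ⟨i, j, hij, h, hj⟩
    · exact ⟨j, i, hij.symm, h, hi⟩
  obtain ⟨m, rfl⟩ := Fin.exists_succAbove_eq hij.symm
  have h2 : √2 ≠ (0 : ℝ) := by positivity
  let z : EuclideanSpace ℝ (Fin n) :=
    WithLp.toLp 2 fun l => (if l = m then √2 else 1) * x (i.succAbove l)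
  have hz : ∀ l, coordShrink m z l = x (i.succAbove l) := by
    intro l
    rw [coordShrink_apply]
    change _ * ((if l = m then √2 else 1) * x (i.succAbove l)) = _
    split_ifs
    · field_simp
    · ring
  refine ⟨i, m, z, ⟨fun l => ?_, ?_⟩, ?_⟩
  · rw [hz, hz, hj]; exact abs_apply_le_cubeNorm x _
  · rw [hz, hj]
  · ext l
    refine i.succAboveCases ?_ (fun l => ?_) l
    · rw [diagonalParam_apply_self, hz, hxij]
    · rw [diagonalParam_apply_succAbove, hz]

lemma euclideanHausdorffMeasure_cone_le (hn : 0 < n) {T : ℝ} (hT : 0 < T) :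
    μHE[n] (coneOver (cubeSkeleton (n + 1)) ∩ {x | cubeNorm x ≤ T}) ≤
      ENNReal.ofReal ((n + 1 : ℕ) * 2 ^ (n + 1) * T ^ n / √2) := by
  have hsub : coneOver (cubeSkeleton (n + 1)) ∩ {x | cubeNorm x ≤ T} ⊆
      ⋃ i : Fin (n + 1), ⋃ m : Fin n,
        diagonalParam i m '' (coordShrink m ⁻¹' maxCoordSet m T) := by
    rintro x ⟨hx, hxT⟩
    obtain ⟨i, m, z, hz, rfl⟩ := exists_diagonalParam_eq hx
    exact mem_iUnion.2 ⟨i, mem_iUnion.2 ⟨m, z, ⟨hz.1, hz.2.trans hxT⟩, rfl⟩⟩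
  calc _ ≤ ∑ i : Fin (n + 1), ∑ m : Fin n,
        μHE[n] (diagonalParam i m '' (coordShrink m ⁻¹' maxCoordSet m T)) := by
        refine (measure_mono hsub).trans ((measure_iUnion_fintype_le _ _).trans ?_)
        exact Finset.sum_le_sum fun i _ => measure_iUnion_fintype_le _ _
    _ = ∑ _i : Fin (n + 1), ENNReal.ofReal (√2) * ∑ m : Fin n, volume (maxCoordSet m T) := by
        refine Finset.sum_congr rfl fun i _ => ?_
        rw [Finset.mul_sum]
        refine Finset.sum_congr rfl fun m _ => ?_
        rw [(isometry_diagonalParam i m).euclideanHausdorffMeasure_image,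
          EuclideanSpace.euclideanHausdorffMeasure_eq_volume, volume_preimage_coordShrink]
    _ ≤ ∑ _i : Fin (n + 1), ENNReal.ofReal (√2) * ENNReal.ofReal ((2 * T) ^ n) := by
        gcongr
        exact sum_volume_maxCoordSet_le hT hn
    _ = _ := by
        rw [Finset.sum_const, Finset.card_univ, Fintype.card_fin, nsmul_eq_mul,
          ← ENNReal.ofReal_mul (by positivity), ← ENNReal.ofReal_natCast,
          ← ENNReal.ofReal_mul (by positivity)]
        congr 1
        have h2 : √2 * √2 = (2 : ℝ) := Real.mul_self_sqrt (by norm_num)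
        have h3 : √2 ≠ (0 : ℝ) := by positivity
        rw [eq_div_iff h3, mul_pow, pow_succ]
        linear_combination ((n + 1 : ℕ) : ℝ) * 2 ^ n * T ^ n * h2

lemma LipschitzWith.nearlyFlatCover_image_cone {φ : EuclideanSpace ℝ (Fin (n + 1)) →
    EuclideanSpace ℝ (Fin (n + 1))} {K : ℝ≥0} (hφ : LipschitzWith K φ) (hn : 0 < n) :
    NearlyFlatCover n (φ '' coneOver (cubeSkeleton (n + 1))) := by
  have : Nonempty (Fin n) := ⟨⟨0, hn⟩⟩
  have h := nearlyFlatCover_iUnion (n := n) (ι := Fin (n + 1) × Fin n)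
    (E := fun p => range (φ ∘ diagonalParam p.1 p.2)) fun p => by
      have := (hφ.comp (isometry_diagonalParam p.1 p.2).lipschitz).nearlyFlatCover_range
        (by simp)
      rwa [finrank_euclideanSpace_fin] at this
  refine h.mono ?_
  rintro _ ⟨x, hx, rfl⟩
  obtain ⟨i, m, z, -, rfl⟩ := exists_diagonalParam_eq hx
  exact mem_iUnion.2 ⟨(i, m), z, rfl⟩

end CubeConeCover

section CubeRegions

open Module MeasureTheory.Measure Filter Topology
open scoped ENNReal RealInnerProductSpace

variable {d : ℕ}

lemma volume_coneOver_cubeSkeleton (d : ℕ) : volume (coneOver (cubeSkeleton d)) = 0 := by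
  refine measure_mono_null ?_ (ae_iff.1 (ae_generic (d := d)))
  intro x hx hx'
  obtain ⟨i, j, hij, hi, hj⟩ := mem_coneOver_cubeSkeleton_iff.1 hx
  exact hx'.2 i j hij (hi.trans hj.symm)

/-- The cone over a facet of the cube. -/
def facetCone (k : Fin d × Bool) : Set (EuclideanSpace ℝ (Fin d)) :=
  {x | boolSign k.2 * x k.1 = cubeNorm x}

lemma isClosed_facetCone (k : Fin d × Bool) : IsClosed (facetCone k) :=
  isClosed_eq (by fun_prop) lipschitzWith_cubeNorm.continuous

lemma mem_interior_facetCone (hd : 2 ≤ d) {k : Fin d × Bool} {x : EuclideanSpace ℝ (Fin d)}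
    (hx : x ∈ facetCone k) (hxE : x ∉ coneOver (cubeSkeleton d)) : x ∈ interior (facetCone k) := by
  have hxk : boolSign k.2 * x k.1 = cubeNorm x := hx
  have hm : |x k.1| = cubeNorm x := by
    rw [← abs_of_nonneg (cubeNorm_nonneg x), ← hxk, abs_mul, abs_boolSign, one_mul]
  have hne : ∀ j, j ≠ k.1 → |x j| ≠ |x k.1| := fun j hj h =>
    hxE (mem_coneOver_cubeSkeleton_iff.2 ⟨j, k.1, hj, h.trans hm, hm⟩)
  have hpos : 0 < cubeNorm x := by
    refine (cubeNorm_nonneg x).lt_of_ne fun h => ?_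
    have : Nontrivial (Fin d) := Fin.nontrivial_iff_two_le.2 hd
    obtain ⟨j, hj⟩ := exists_ne k.1
    refine hne j hj (le_antisymm ?_ ?_)
    · rw [hm]; exact abs_apply_le_cubeNorm x j
    · rw [hm, ← h]; exact abs_nonneg _
  refine mem_interior_iff_mem_nhds.2 ?_
  filter_upwards [eventually_cubeNorm_eq hm hne k.2 (hxk ▸ hpos)] with y hy using hy.symm

lemma frontier_facetCone_subset (hd : 2 ≤ d) (k : Fin d × Bool) :
    frontier (facetCone k) ⊆ coneOver (cubeSkeleton d) := by
  intro x hx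
  by_contra h
  exact hx.2 (mem_interior_facetCone hd ((isClosed_facetCone k).closure_subset hx.1) h)

lemma notMem_facetCone_of_mem_interior {k l : Fin d × Bool} (hkl : k ≠ l)
    {x : EuclideanSpace ℝ (Fin d)} (hx : x ∈ interior (facetCone l)) : x ∉ facetCone k := by
  intro hxk
  have hxk' : boolSign k.2 * x k.1 = cubeNorm x := hxk
  have hxl : boolSign l.2 * x l.1 = cubeNorm x := (interior_subset hx : x ∈ facetCone l)
  have hcont : Continuous fun t : ℝ =>
      x + t • (EuclideanSpace.single k.1 (boolSign k.2) : EuclideanSpace ℝ (Fin d)) := by fun_prop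
  have hev : ∀ᶠ t : ℝ in 𝓝 0,
      x + t • (EuclideanSpace.single k.1 (boolSign k.2) : EuclideanSpace ℝ (Fin d)) ∈
        facetCone l := by
    refine hcont.continuousAt.eventually (p := fun y => y ∈ facetCone l) ?_
    simpa using mem_interior_iff_mem_nhds.1 hx
  obtain ⟨ε, hε, hball⟩ := Metric.eventually_nhds_iff.1 hev
  have hy := hball (y := ε / 2) (by simp [abs_of_pos hε, hε])
  set y := x + (ε / 2) • (EuclideanSpace.single k.1 (boolSign k.2) : EuclideanSpace ℝ (Fin d))
  have hyl : boolSign l.2 * y l.1 = cubeNorm y := hy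
  have hyk : boolSign k.2 * y k.1 = cubeNorm x + ε / 2 := by
    have h1 := boolSign_mul_self k.2
    simp only [y, PiLp.add_apply, PiLp.smul_apply, PiLp.single_apply, smul_eq_mul, if_true]
    linear_combination hxk' + ε / 2 * h1
  have h2 : cubeNorm x + ε / 2 ≤ cubeNorm y := by
    rw [← hyk]
    refine (le_abs_self _).trans ?_
    rw [abs_mul, abs_boolSign, one_mul]
    exact abs_apply_le_cubeNorm y _
  have h3 : boolSign l.2 * y l.1 ≤ cubeNorm x := by
    simp only [y, PiLp.add_apply, PiLp.smul_apply, PiLp.single_apply, smul_eq_mul]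
    rw [mul_add, hxl]
    obtain ⟨i, b⟩ := k
    obtain ⟨j, c⟩ := l
    by_cases hij : j = i
    · subst hij
      have hbc : b ≠ c := fun h => hkl (by rw [h])
      cases b <;> cases c <;> simp_all [boolSign] <;> linarith
    · simp [hij]
  linarith

lemma ae_mem_facetCone (hd : 0 < d) : ∀ᵐ x : EuclideanSpace ℝ (Fin d), ∃ k, x ∈ facetCone k := by
  filter_upwards [ae_generic (d := d)] with x hx
  obtain ⟨m, hm⟩ := exists_abs_apply_eq_cubeNorm hd x
  obtain ⟨b, hb⟩ := exists_boolSign_mul_pos (hx.1 m)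
  refine ⟨(m, b), ?_⟩
  change boolSign b * x m = cubeNorm x
  rw [← hm, ← abs_of_pos hb, abs_mul, abs_boolSign, one_mul]

end CubeRegions

section ConeComparison

open Module MeasureTheory.Measure Filter Topology
open scoped ENNReal RealInnerProductSpace

lemma IsDeformation.exists_radius {N : ℕ}
    {φ : ℝ → EuclideanSpace ℝ (Fin N) → EuclideanSpace ℝ (Fin N)} (h : IsDeformation univ φ) :
    ∃ B, (∀ x, B < ‖x‖ → φ 1 x = x) ∧ ∀ x, ‖x‖ ≤ B → ‖φ 1 x‖ ≤ B := by
  obtain ⟨B, hB⟩ := h.2.2.2.2.2.isBounded.subset_closedBall 0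
  have hmem : ∀ x, φ 1 x ≠ x → ‖x‖ ≤ B ∧ ‖φ 1 x‖ ≤ B := by
    intro x hx
    have hx' : x ∈ {x ∈ closure univ | φ 1 x ≠ x} := ⟨by simp, hx⟩
    constructor
    · exact mem_closedBall_zero_iff.1 (hB (subset_closure
        (mem_biUnion (right_mem_Icc.2 zero_le_one) (Or.inl hx'))))
    · exact mem_closedBall_zero_iff.1 (hB (subset_closure
        (mem_biUnion (right_mem_Icc.2 zero_le_one) (Or.inr (mem_image_of_mem _ hx')))))
  refine ⟨B, fun x hx => ?_, fun x hx => ?_⟩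
  · by_contra hne
    exact hx.not_ge (hmem x hne).1
  · by_cases hne : φ 1 x = x
    · rwa [hne]
    · exact (hmem x hne).2

lemma mem_image_iff_of_lt_norm {V : Type*} [NormedAddCommGroup V] {φ : V → V} {B : ℝ} {E : Set V}
    (hB : ∀ x, B < ‖x‖ → φ x = x) (hB' : ∀ x, ‖x‖ ≤ B → ‖φ x‖ ≤ B) {x : V} (hx : B < ‖x‖) :
    x ∈ φ '' E ↔ x ∈ E := by
  constructor
  · rintro ⟨y, hy, rfl⟩
    rcases le_or_gt ‖y‖ B with h | h
    · exact absurd (hB' y h) hx.not_ge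
    · rwa [hB y h]
  · exact fun h => ⟨x, h, hB x hx⟩

lemma image_inter_closedBall_subset {V : Type*} [NormedAddCommGroup V] {φ : V → V} {B : ℝ}
    {E : Set V} (hB : ∀ x, B < ‖x‖ → φ x = x) (r : ℝ) :
    φ '' E ∩ closedBall 0 r ⊆ φ '' (E ∩ closedBall 0 (max r B)) := by
  rintro _ ⟨⟨y, hy, rfl⟩, hr⟩
  rw [mem_closedBall_zero_iff] at hr
  refine ⟨y, ⟨hy, mem_closedBall_zero_iff.2 ?_⟩, rfl⟩
  rcases le_or_gt ‖y‖ B with h | h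
  · exact h.trans (le_max_right _ _)
  · rw [hB y h] at hr
    exact hr.trans (le_max_left _ _)

lemma isClosed_image_of_eq_self {V : Type*} [NormedAddCommGroup V] [ProperSpace V] {φ : V → V}
    {B : ℝ} {E : Set V} (hφ : Continuous φ) (hE : IsClosed E)
    (hB : ∀ x, B < ‖x‖ → φ x = x) : IsClosed (φ '' E) := by
  refine isClosed_of_closure_subset fun x hx => ?_
  have hK : IsClosed (φ '' (E ∩ closedBall 0 (max (‖x‖ + 1) B))) :=
    (((isCompact_closedBall _ _).inter_left hE).image hφ).isClosed
  have h1 : x ∈ closure (φ '' E ∩ closedBall 0 (‖x‖ + 1)) := by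
    refine mem_closure_iff_nhds.2 fun U hU => ?_
    have h2 : closedBall (0 : V) (‖x‖ + 1) ∈ 𝓝 x := by
      refine mem_of_superset (closedBall_mem_nhds x one_pos) (closedBall_subset_closedBall' ?_)
      rw [dist_zero_right, add_comm]
    obtain ⟨y, hy, hyE⟩ := mem_closure_iff_nhds.1 hx _ (inter_mem hU h2)
    exact ⟨y, hy.1, hyE, hy.2⟩
  exact image_mono inter_subset_left (hK.closure_subset_iff.2 (image_inter_closedBall_subset hB _) h1)

lemma euclideanHausdorffMeasure_cone_inter_closedBall_ne_top {n : ℕ} (hn : 0 < n) (r : ℝ) :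
    μHE[n] (coneOver (cubeSkeleton (n + 1)) ∩ closedBall 0 r) ≠ ∞ := by
  refine measure_ne_top_of_subset (inter_subset_inter_right _ fun x hx => ?_)
    ((euclideanHausdorffMeasure_cone_le hn (T := max r 1) (by positivity)).trans_lt
      ENNReal.ofReal_lt_top).ne
  exact (cubeNorm_le_norm x).trans ((mem_closedBall_zero_iff.1 hx).trans (le_max_left _ _))

lemma measure_sdiff_le_of_inter_le {X : Type*} [MeasurableSpace X] {μ : Measure X} {E E' Q : Set X}
    (hE : MeasurableSet E) (hE' : MeasurableSet E') (hQ : ∀ x, x ∉ Q → (x ∈ E' ↔ x ∈ E))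
    (hfin : μ (E ∩ Q) ≠ ∞) (hle : μ (E ∩ Q) ≤ μ (E' ∩ Q)) : μ (E \ E') ≤ μ (E' \ E) := by
  have h1 : E \ E' = (E ∩ Q) \ E' := by
    ext x
    by_cases hx : x ∈ Q
    · simp [hx]
    · simp [hx, hQ x hx]
  have h2 : E' \ E = (E' ∩ Q) \ E := by
    ext x
    by_cases hx : x ∈ Q
    · simp [hx]
    · simp [hx, hQ x hx]
  have h3 : E ∩ Q ∩ E' = E' ∩ Q ∩ E := by
    ext x; simp only [mem_inter_iff]; tauto
  have h4 : μ (E ∩ Q ∩ E') ≠ ∞ := measure_ne_top_of_subset inter_subset_left hfin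
  rw [← measure_inter_add_sdiff (E ∩ Q) hE', ← measure_inter_add_sdiff (E' ∩ Q) hE, ← h3,
    ENNReal.add_le_add_iff_left h4] at hle
  rwa [h1, h2]

lemma euclideanHausdorffMeasure_cone_sdiff_le {n : ℕ} (hn : 3 ≤ n)
    {φ : EuclideanSpace ℝ (Fin (n + 1)) → EuclideanSpace ℝ (Fin (n + 1))} {K : ℝ≥0} {B : ℝ}
    (hφ : LipschitzWith K φ) (hB : ∀ x, B < ‖x‖ → φ x = x) (hB' : ∀ x, ‖x‖ ≤ B → ‖φ x‖ ≤ B) :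
    μHE[n] (coneOver (cubeSkeleton (n + 1)) \ φ '' coneOver (cubeSkeleton (n + 1))) ≤
      μHE[n] (φ '' coneOver (cubeSkeleton (n + 1)) \ coneOver (cubeSkeleton (n + 1))) := by
  set E := coneOver (cubeSkeleton (n + 1)) with hEdef
  have hEc : IsClosed E := isClosed_coneOver_cubeSkeleton _
  have hEc' : IsClosed (φ '' E) := isClosed_image_of_eq_self hφ.continuous hEc hB
  have hfin : ∀ r, μHE[n] (φ '' E ∩ closedBall 0 r) ≠ ∞ := by
    intro r
    refine measure_ne_top_of_subset (image_inter_closedBall_subset hB r) ?_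
    refine ((hφ.lipschitzOnWith.euclideanHausdorffMeasure_image_le n).trans_lt ?_).ne
    exact ENNReal.mul_lt_top (ENNReal.pow_lt_top ENNReal.coe_lt_top)
      (euclideanHausdorffMeasure_cone_inter_closedBall_ne_top (by omega) _).lt_top
  obtain ⟨lab, hlm, hlab, hlab'⟩ := exists_label hφ hB hB' isClosed_facetCone
    (fun k => measure_mono_null (frontier_facetCone_subset (by omega) k)
      (volume_coneOver_cubeSkeleton _)) hEc'
    (fun k x hx => mem_image_of_mem φ (frontier_facetCone_subset (by omega) k hx))
    fun k l hkl x hx => notMem_facetCone_of_mem_interior hkl hx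
  have hlab2 : ∀ᵐ x : EuclideanSpace ℝ (Fin (n + 1)), B + 1 < cubeNorm x →
      boolSign (lab x).2 * x (lab x).1 = cubeNorm x := by
    filter_upwards [ae_mem_facetCone (Nat.succ_pos n),
      measure_eq_zero_iff_ae_notMem.1 (volume_coneOver_cubeSkeleton (n + 1))] with x ⟨k, hk⟩ hxE hx
    have hxB : B + 1 < ‖x‖ := hx.trans_le (cubeNorm_le_norm x)
    rw [hlab' k x (mem_interior_facetCone (by omega) hk hxE) hxB
      (by rwa [mem_image_iff_of_lt_norm hB hB' (by linarith)])]
    exact hk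
  set T := max (B + 2) 1
  have hT : 0 < T := lt_max_of_lt_right one_pos
  have hBT : B + 1 < T := (by linarith : B + 1 < B + 2).trans_le (le_max_left _ _)
  have hlower := le_measure_inter_cubeNorm_le (by omega) hEc'
    (hφ.nearlyFlatCover_image_cone (by omega)) hfin hlm hlab hlab2 hT hBT
  have hle : μHE[n] (E ∩ {x | cubeNorm x ≤ T}) ≤ μHE[n] (φ '' E ∩ {x | cubeNorm x ≤ T}) :=
    (euclideanHausdorffMeasure_cone_le (by omega) hT).trans
      (ENNReal.ofReal_le_of_le_toReal hlower)
  refine measure_sdiff_le_of_inter_le hEc.measurableSet hEc'.measurableSet (fun x hx => ?_)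
    (measure_inter_cubeNorm_le_ne_top
      (euclideanHausdorffMeasure_cone_inter_closedBall_ne_top (by omega)) T) hle
  have hx' : T < cubeNorm x := not_le.1 hx
  have := cubeNorm_le_norm x
  exact mem_image_iff_of_lt_norm hB hB' (by linarith)

end ConeComparison

noncomputable section

/-- For every integer d ≥ 4, the cone over the (d−2)-skeleton of the cube
[−1,1]^d is an Almgren minimal set of dimension d−1 in ℝ^d. -/
theorem cone_over_cube_skeleton_almgren_minimal (d : ℕ) (hd : 4 ≤ d) :
    AlmgrenMinimal ((d - 1 : ℕ) : ℝ) (Set.univ) (coneOver (cubeSkeleton d)) := by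
  obtain ⟨n, rfl⟩ := Nat.exists_eq_add_of_le' (by omega : 1 ≤ d)
  have hc : (Measure.addHaarScalarFactor (volume : Measure (EuclideanSpace ℝ (Fin n)))
      μH[n] : ENNReal) ≠ 0 :=
    ENNReal.coe_ne_zero.2 (Measure.addHaarScalarFactor_volume_hausdorffMeasure_ne_zero n)
  have hmul : ∀ s : Set (EuclideanSpace ℝ (Fin (n + 1))), Measure.euclideanHausdorffMeasure n s =
      (Measure.addHaarScalarFactor (volume : Measure (EuclideanSpace ℝ (Fin n)))
        μH[n] : ENNReal) * μH[n] s := fun s => rfl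
  refine ⟨isClosed_coneOver_cubeSkeleton _, by simp, fun x r _ => ?_, fun φ hφ => ?_⟩
  · have h := euclideanHausdorffMeasure_cone_inter_closedBall_ne_top (n := n) (by omega) (r + ‖x‖)
    rw [hmul] at h
    refine (measure_mono (inter_subset_inter_right _ (closedBall_subset_closedBall' ?_))).trans_lt
      (ENNReal.lt_top_of_mul_ne_top_right h hc)
    rw [dist_zero_right]
  · obtain ⟨B, hB, hB'⟩ := hφ.exists_radius
    obtain ⟨K, hK⟩ := hφ.2.2.2.1
    rw [closure_univ, lipschitzOnWith_univ] at hK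
    have h := euclideanHausdorffMeasure_cone_sdiff_le (by omega) hK hB hB'
    rw [hmul, hmul] at h
    exact (ENNReal.mul_le_mul_iff_right hc ENNReal.coe_ne_top).1 h

end
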